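/- arXiv:1912.07965 — 2 statements merged into one kernel-verified Lean document; each statement's English description precedes it below -/
import Mathlib

section
/- For every integer ℓ ≥ 2 and every nonnegative integer k, every finite graph G either contains k pairwise edge-disjoint cycles each of length at least ℓ, or there is a set F of at most 8k(ℓ−1)(⌈log₂(kℓ)⌉+1) edges of G such that the graph G − F (obtained by deleting the edges in F) contains no cycle of length at least ℓ. -/
namespace EP
open Classical SimpleGraph

section basics
variable {V : Type*} {ι : Type*}

/-- `u` and `v` are joined by a walk with edges in `A`. -/
def Cn (A : Set (Sym2 V)) (u v : V) : Prop :=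
  ∃ w : (⊤ : SimpleGraph V).Walk u v, ∀ e ∈ w.edges, e ∈ A

theorem Cn.refl (A : Set (Sym2 V)) (u : V) : Cn A u u := ⟨Walk.nil, by simp⟩

theorem Cn.symm {A : Set (Sym2 V)} {u v : V} (h : Cn A u v) : Cn A v u := by
  obtain ⟨w, hw⟩ := h
  exact ⟨w.reverse, by simpa using hw⟩

theorem Cn.trans {A : Set (Sym2 V)} {u v x : V} (h : Cn A u v) (h' : Cn A v x) : Cn A u x := by
  obtain ⟨w, hw⟩ := h
  obtain ⟨w', hw'⟩ := h'
  refine ⟨w.append w', fun e he => ?_⟩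
  rw [Walk.edges_append, List.mem_append] at he
  exact he.elim (hw e) (hw' e)

theorem Cn.mono {A B : Set (Sym2 V)} (hAB : A ⊆ B) {u v : V} (h : Cn A u v) : Cn B u v := by
  obtain ⟨w, hw⟩ := h
  exact ⟨w, fun e he => hAB (hw e he)⟩

theorem Cn.step {A : Set (Sym2 V)} {u v : V} (h : s(u, v) ∈ A) : Cn A u v := by
  by_cases huv : u = v
  · subst huv; exact Cn.refl _ _
  · exact ⟨Walk.cons (by simpa using huv) Walk.nil, by simpa using h⟩

theorem Cn.path {A : Set (Sym2 V)} {u v : V} (h : Cn A u v) :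
    ∃ w : (⊤ : SimpleGraph V).Walk u v, w.IsPath ∧ ∀ e ∈ w.edges, e ∈ A := by
  obtain ⟨w, hw⟩ := h
  exact ⟨w.bypass, w.bypass_isPath, fun e he => hw e (w.edges_bypass_subset_edges he)⟩

theorem cn_of_mem_support {A : Set (Sym2 V)} {u v x : V} (w : (⊤ : SimpleGraph V).Walk u v)
    (hw : ∀ e ∈ w.edges, e ∈ A) (hx : x ∈ w.support) : Cn A u x :=
  ⟨w.takeUntil x hx, fun e he => hw e (w.edges_takeUntil_subset_edges hx he)⟩

/-- the first edge of a connection -/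
theorem Cn.exists_fst {A : Set (Sym2 V)} {u v : V} (h : Cn A u v) (huv : u ≠ v) :
    ∃ x, x ≠ u ∧ s(u, x) ∈ A := by
  obtain ⟨w, hw⟩ := h
  cases w with
  | nil => exact absurd rfl huv
  | cons h p => exact ⟨_, (by simpa using h.symm), hw _ (by simp)⟩

/-- there is a cycle of length at least `ℓ` inside `A` -/
def LongCyc (ℓ : ℕ) (A : Set (Sym2 V)) : Prop :=
  ∃ (v : V) (w : (⊤ : SimpleGraph V).Walk v v), w.IsCycle ∧ ℓ ≤ w.length ∧ ∀ e ∈ w.edges, e ∈ A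

theorem LongCyc.mono {ℓ : ℕ} {A B : Set (Sym2 V)} (hAB : A ⊆ B) (h : LongCyc ℓ A) :
    LongCyc ℓ B := by
  obtain ⟨v, w, h1, h2, h3⟩ := h
  exact ⟨v, w, h1, h2, fun e he => hAB (h3 e he)⟩

def TauGe (ℓ : ℕ) (A : Set (Sym2 V)) (m : ℕ) : Prop :=
  ∀ Y : Set (Sym2 V), ¬ LongCyc ℓ (A \ Y) → m ≤ Y.ncard

/-- edges of `A` of class `Q` -/
def AQ (cl : Sym2 V → ι) (A : Set (Sym2 V)) (Q : ι) : Set (Sym2 V) := {e | e ∈ A ∧ cl e = Q}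

theorem AQ_mono (cl : Sym2 V → ι) {A B : Set (Sym2 V)} (h : A ⊆ B) (Q : ι) :
    AQ cl A Q ⊆ AQ cl B Q := fun _ he => ⟨h he.1, he.2⟩

def inc (cl : Sym2 V → ι) (A : Set (Sym2 V)) (v : V) (Q : ι) : Prop :=
  ∃ e ∈ A, v ∈ e ∧ cl e = Q

def term (cl : Sym2 V → ι) (A : Set (Sym2 V)) (v : V) : Prop :=
  ∃ Q Q', Q ≠ Q' ∧ inc cl A v Q ∧ inc cl A v Q'

def kap (cl : Sym2 V → ι) (A : Set (Sym2 V)) (Q : ι) (s : V) : Set (Sym2 V) :=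
  {e | cl e = Q ∧ ∀ x ∈ e, Cn (AQ cl A Q) s x}

def HasCyc (cl : Sym2 V → ι) (A : Set (Sym2 V)) : Prop :=
  ∃ (Q : ι) (s t : V), s ≠ t ∧ Cn (AQ cl A Q) s t ∧ Cn (A \ kap cl A Q s) s t

theorem Cn.inc_left {cl : Sym2 V → ι} {A : Set (Sym2 V)} {Q : ι} {u v : V}
    (h : Cn (AQ cl A Q) u v) (huv : u ≠ v) : inc cl A u Q := by
  obtain ⟨x, -, hx⟩ := h.exists_fst huv
  exact ⟨_, hx.1, by simp, hx.2⟩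

theorem L1a {A : Set (Sym2 V)} {S : Set V} {b u : V} (p : (⊤ : SimpleGraph V).Walk b u)
    (hp : ∀ e ∈ p.edges, e ∈ A) (hu : u ∈ S) :
    ∃ t ∈ p.support, t ∈ S ∧ Cn {e | e ∈ A ∧ ∃ x ∈ e, x ∉ S} b t := by
  induction p with
  | nil => exact ⟨_, by simp, hu, Cn.refl _ _⟩
  | @cons b c u h p ih =>
    by_cases hb : b ∈ S
    · exact ⟨b, by simp, hb, Cn.refl _ _⟩
    · obtain ⟨t, ht, htS, hc⟩ := ih (fun e he => hp e (by simp [he])) hu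
      refine ⟨t, by simp [ht], htS, Cn.trans (Cn.step ⟨hp _ (by simp), b, by simp, hb⟩) hc⟩

theorem L1b {cl : Sym2 V → ι} {A : Set (Sym2 V)} {Q : ι} {u0 v u : V}
    (p : (⊤ : SimpleGraph V).Walk v u) (hpp : p.IsPath) (hp : ∀ e ∈ p.edges, e ∈ A)
    (hv : Cn (AQ cl A Q) u0 v) (hu : Cn (AQ cl A Q) u0 u) (hne : ∃ e ∈ p.edges, cl e ≠ Q) :
    ∃ a t, a ≠ t ∧ Cn (AQ cl A Q) u0 a ∧ Cn (AQ cl A Q) u0 t ∧ Cn (A \ kap cl A Q u0) a t := by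
  induction p with
  | nil => simp at hne
  | @cons v c u h p ih =>
    have hp' : ∀ e ∈ p.edges, e ∈ A := fun e he => hp e (by simp [he])
    have hA : s(v, c) ∈ A := hp _ (by simp)
    rw [Walk.cons_isPath_iff] at hpp
    by_cases hc : cl s(v, c) = Q
    · refine ih hpp.1 hp' (hv.trans (Cn.step ⟨hA, hc⟩)) hu ?_
      obtain ⟨e, he, heQ⟩ := hne
      rw [Walk.edges_cons, List.mem_cons] at he
      rcases he with rfl | he
      · exact absurd hc heQ
      · exact ⟨e, he, heQ⟩
    · obtain ⟨t, ht, htS, hct⟩ := L1a (S := {x | Cn (AQ cl A Q) u0 x}) p hp' hu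
      refine ⟨v, t, ?_, hv, htS, ?_⟩
      · rintro rfl; exact hpp.2 ht
      · refine Cn.trans (Cn.step ⟨hA, fun h => hc h.1⟩) (hct.mono ?_)
        rintro e ⟨h1, x, hx, hxS⟩
        exact ⟨h1, fun h => hxS (h.2 x hx)⟩

theorem kap_congr {cl : Sym2 V → ι} {A : Set (Sym2 V)} {Q : ι} {s t : V}
    (h : Cn (AQ cl A Q) s t) : kap cl A Q s = kap cl A Q t := by
  ext e
  constructor
  · rintro ⟨h1, h2⟩; exact ⟨h1, fun x hx => h.symm.trans (h2 x hx)⟩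
  · rintro ⟨h1, h2⟩; exact ⟨h1, fun x hx => h.trans (h2 x hx)⟩

/-- A cycle with two edges of different classes gives `HasCyc`. -/
theorem L1 {cl : Sym2 V → ι} {A : Set (Sym2 V)} {v : V} (w : (⊤ : SimpleGraph V).Walk v v)
    (hw : w.IsCycle) (hA : ∀ e ∈ w.edges, e ∈ A)
    (hne : ∃ e ∈ w.edges, ∃ f ∈ w.edges, cl e ≠ cl f) : HasCyc cl A := by
  cases w with
  | nil => simp at hne
  | @cons _ c _ h p =>
    rw [Walk.cons_isCycle_iff] at hw
    have hvc : s(v, c) ∈ A := hA _ (by simp)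
    have h1 : Cn (AQ cl A (cl s(v, c))) v c := Cn.step ⟨hvc, rfl⟩
    obtain ⟨a, t, hat, ha, ht, hct⟩ := L1b (cl := cl) (A := A) (Q := cl s(v, c)) (u0 := v) p hw.1
      (fun e he => hA e (by simp [he])) h1 (Cn.refl _ _) (by
        by_contra hcon
        push Not at hcon
        obtain ⟨e, he, f, hf, hef⟩ := hne
        have key : ∀ g ∈ (Walk.cons h p).edges, cl g = cl s(v, c) := by
          intro g hg
          rw [Walk.edges_cons, List.mem_cons] at hg
          rcases hg with rfl | hg
          · rfl
          · exact hcon g hg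
        exact hef ((key e he).trans (key f hf).symm))
    refine ⟨_, a, t, hat, ha.symm.trans ht, ?_⟩
    rw [← kap_congr ha]
    exact hct

theorem L2 {cl : Sym2 V → ι} {A : Set (Sym2 V)} (h : HasCyc cl A) :
    ∃ (v : V) (w : (⊤ : SimpleGraph V).Walk v v), w.IsCycle ∧ (∀ e ∈ w.edges, e ∈ A) ∧
      ∃ e ∈ w.edges, ∃ f ∈ w.edges, cl e ≠ cl f := by
  obtain ⟨Q, s, t, hst, h1, q, hq⟩ := h
  obtain ⟨p, hp, hpA⟩ := h1.path
  cases p with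
  | nil => exact absurd rfl hst
  | @cons _ x _ hadj p =>
    rw [Walk.cons_isPath_iff] at hp
    have hsx : s(s, x) ∈ AQ cl A Q := hpA _ (by simp)
    have hp' : ∀ e ∈ p.edges, e ∈ AQ cl A Q := fun e he => hpA e (by simp [he])
    set r := (p.append q.reverse).bypass with hr
    have hrp : r.IsPath := Walk.bypass_isPath _
    have hre : ∀ e ∈ r.edges, e ∈ p.edges ∨ e ∈ q.edges := by
      intro e he
      have := Walk.edges_bypass_subset_edges _ he
      simpa [Walk.edges_append] using this
    have hnotp : ∀ y, s(s, y) ∉ p.edges := fun y hy => hp.2 (p.fst_mem_support_of_mem_edges hy)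
    have hnot : s(s, x) ∉ r.edges := by
      intro he
      rcases hre _ he with he | he
      · exact hnotp _ he
      · refine (hq _ he).2 ⟨hsx.2, ?_⟩
        intro y hy
        rw [Sym2.mem_iff] at hy
        rcases hy with rfl | rfl
        · exact Cn.refl _ _
        · exact Cn.step hsx
    refine ⟨s, Walk.cons hadj r, (Walk.cons_isCycle_iff _ _).2 ⟨hrp, hnot⟩, ?_, ?_⟩
    · intro e he
      rw [Walk.edges_cons, List.mem_cons] at he
      rcases he with rfl | he
      · exact hsx.1
      · rcases hre e he with he | he
        · exact (hp' e he).1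
        · exact (hq e he).1
    · by_contra hcon
      push Not at hcon
      have hrQ : ∀ e ∈ r.edges, e ∈ AQ cl A Q := by
        intro e he
        refine ⟨?_, ?_⟩
        · rcases hre e he with he | he
          · exact (hp' e he).1
          · exact (hq e he).1
        · rw [← hsx.2]; exact hcon e (by simp [he]) _ (by simp)
      have hrp' : ∀ e ∈ r.edges, e ∈ p.edges := by
        intro e he
        rcases hre e he with h | h
        · exact h
        · refine absurd ⟨(hrQ e he).2, ?_⟩ (hq e h).2
          intro y hy
          have : y ∈ r.support := Walk.mem_support_of_mem_edges he hy
          exact (Cn.step hsx).trans (cn_of_mem_support r hrQ this)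
      have : Cn {e | e ∈ p.edges} s x := Cn.symm ⟨r, hrp'⟩
      have hne : s ≠ x := by simpa using hadj
      obtain ⟨y, -, hy⟩ := this.exists_fst hne
      exact hnotp y hy

theorem L3 {cl : Sym2 V → ι} {A A1 A2 : Set (Sym2 V)} (h21 : A2 ⊆ A1) (h1A : A1 ⊆ A)
    (H : ∀ Q a b, term cl A a → term cl A b → inc cl A a Q → inc cl A b Q →
      Cn (AQ cl A1 Q) a b → Cn (AQ cl A2 Q) a b) (h : HasCyc cl A1) : HasCyc cl A2 := by
  obtain ⟨Q, s, t, hst, h1, h2⟩ := h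
  have incl : ∀ {u : V} {Q : ι}, inc cl A1 u Q → inc cl A u Q :=
    fun ⟨e, he, h⟩ => ⟨e, h1A he, h⟩
  have hterm : ∀ u, Cn (AQ cl A1 Q) s u → (∃ x, x ≠ u ∧ s(u, x) ∈ A1 \ kap cl A1 Q s) →
      inc cl A1 u Q → term cl A u := by
    rintro u hu ⟨x, hxu, hx⟩ hinc
    refine ⟨Q, cl s(u, x), ?_, incl hinc, incl ⟨_, hx.1, by simp, rfl⟩⟩
    intro hQ
    refine hx.2 ⟨hQ.symm, ?_⟩
    intro y hy
    rw [Sym2.mem_iff] at hy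
    rcases hy with rfl | rfl
    · exact hu
    · exact hu.trans (Cn.step ⟨hx.1, hQ.symm⟩)
  have hs : term cl A s := hterm s (Cn.refl _ _) (h2.exists_fst hst) (h1.inc_left hst)
  have ht : term cl A t := hterm t h1 (h2.symm.exists_fst hst.symm) (h1.symm.inc_left hst.symm)
  have hst2 : Cn (AQ cl A2 Q) s t :=
    H Q s t hs ht (incl (h1.inc_left hst)) (incl (h1.symm.inc_left hst.symm)) h1
  refine ⟨Q, s, t, hst, hst2, ?_⟩
  have conv : ∀ Q' z u, term cl A z → term cl A u → Cn (AQ cl A1 Q' \ kap cl A1 Q s) z u →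
      Cn (A2 \ kap cl A2 Q s) z u := by
    intro Q' z u hz hu hc
    by_cases hzu : z = u
    · subst hzu; exact Cn.refl _ _
    have hc' : Cn (AQ cl A1 Q') z u := hc.mono Set.sdiff_subset
    have hc2 := H Q' z u hz hu (incl (hc'.inc_left hzu)) (incl (hc'.symm.inc_left (Ne.symm hzu))) hc'
    by_cases hQ : Q' = Q
    · subst hQ
      have hzS : ¬ Cn (AQ cl A1 Q') s z := by
        intro hzS
        obtain ⟨x, hx, hx1, hx2⟩ := hc.exists_fst hzu
        refine hx2 ⟨hx1.2, ?_⟩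
        intro y hy
        rw [Sym2.mem_iff] at hy
        rcases hy with rfl | rfl
        · exact hzS
        · exact hzS.trans (Cn.step hx1)
      obtain ⟨w, hw⟩ := hc2
      refine ⟨w, fun e he => ⟨(hw e he).1, fun hk => hzS ?_⟩⟩
      induction e with
      | h a b =>
        have ha := hk.2 a (by simp)
        have : Cn (AQ cl A2 Q') z a :=
          cn_of_mem_support w hw (w.fst_mem_support_of_mem_edges he)
        exact (ha.trans this.symm).mono (AQ_mono cl h21 Q')
    · refine Cn.mono ?_ hc2
      intro e he
      exact ⟨he.1, fun hk => hQ (he.2.symm.trans hk.1)⟩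
  obtain ⟨w, hw⟩ := h2
  have main : ∀ (u t : V) (w : (⊤ : SimpleGraph V).Walk u t), term cl A t →
      (∀ e ∈ w.edges, e ∈ A1 \ kap cl A1 Q s) →
      ∀ Q' z, term cl A z → Cn (A2 \ kap cl A2 Q s) s z →
        Cn (AQ cl A1 Q' \ kap cl A1 Q s) z u → Cn (A2 \ kap cl A2 Q s) s t := by
    intro u t w ht
    induction w with
    | nil =>
      intro _ Q' z hz hsz hzu
      exact hsz.trans (conv Q' _ _ hz ht hzu)
    | @cons u c t hadj w ih =>
      intro hw Q' z hz hsz hzu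
      have huc := hw s(u, c) (by simp)
      have hw' : ∀ e ∈ w.edges, e ∈ A1 \ kap cl A1 Q s := fun e he => hw e (by simp [he])
      by_cases hQ : cl s(u, c) = Q'
      · exact ih ht hw' Q' z hz hsz (hzu.trans (Cn.step ⟨⟨huc.1, hQ⟩, huc.2⟩))
      · have hut : term cl A u := by
          by_cases hzu' : z = u
          · rwa [← hzu']
          · have := ((hzu.mono Set.sdiff_subset).symm.inc_left (Ne.symm hzu'))
            exact ⟨_, _, hQ, incl ⟨_, huc.1, by simp, rfl⟩, incl this⟩
        exact ih ht hw' _ u hut (hsz.trans (conv Q' _ _ hz hut hzu))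
          (Cn.step ⟨⟨huc.1, rfl⟩, huc.2⟩)
  exact main s t w ht hw Q s hs (Cn.refl _ _) (Cn.refl _ _)

end basics
end EP
namespace EP
open Classical SimpleGraph

section walks
variable {V : Type*} {G : SimpleGraph V}

theorem isPath_append {u v x : V} {p : G.Walk u v} {q : G.Walk v x} (hp : p.IsPath) (hq : q.IsPath)
    (h : ∀ y ∈ p.support, y ∈ q.support → y = v) : (p.append q).IsPath := by
  rw [Walk.isPath_def, Walk.support_append, List.nodup_append']
  refine ⟨hp.support_nodup, hq.support_nodup.tail, ?_⟩
  intro y hy hy'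
  have h1 := h y hy (List.mem_of_mem_tail hy')
  subst h1
  have := hq.support_nodup
  rw [← Walk.cons_tail_support, List.nodup_cons] at this
  exact this.1 hy'

theorem eq_of_mem_append {u v x y : V} {p : G.Walk u v} {q : G.Walk v x}
    (h : (p.append q).IsPath) (hp : y ∈ p.support) (hq : y ∈ q.support) : y = v := by
  by_contra hne
  exact h.ne_of_mem_support_of_append hne hp hq rfl

theorem isCycle_append_comm {u v : V} {p : G.Walk u v} {q : G.Walk v u}
    (h : (p.append q).IsCycle) : (q.append p).IsCycle := by
  have h1 := h.isTrail
  have h2 := h.ne_nil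
  have h3 := h.support_nodup
  rw [Walk.isCycle_def]
  refine ⟨?_, ?_, ?_⟩
  · rw [Walk.isTrail_append] at h1 ⊢
    exact ⟨h1.2.1, h1.1, h1.2.2.symm⟩
  · intro h
    apply h2
    rw [Walk.eq_nil_iff_nil] at h ⊢
    rw [Walk.nil_append_iff] at h ⊢
    exact h.symm
  · rw [Walk.tail_support_append] at h3 ⊢
    exact List.nodup_append_comm.1 h3

theorem exists_split_of_mem_edges {u v : V} (w : G.Walk u v) {e : Sym2 V} (he : e ∈ w.edges) :
    ∃ (a b : V) (h : G.Adj a b) (p : G.Walk u a) (q : G.Walk b v),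
      s(a, b) = e ∧ w = p.append (Walk.cons h q) := by
  induction w with
  | nil => simp at he
  | @cons u c v h w ih =>
    rw [Walk.edges_cons, List.mem_cons] at he
    rcases he with rfl | he
    · exact ⟨u, c, h, Walk.nil, w, rfl, rfl⟩
    · obtain ⟨a, b, hab, p, q, h1, h2⟩ := ih he
      exact ⟨a, b, hab, Walk.cons h p, q, h1, by rw [h2]; rfl⟩

/-- opening up a cycle at an edge -/
theorem cycle_open {v : V} {w : G.Walk v v} (hw : w.IsCycle) {e : Sym2 V} (he : e ∈ w.edges) :
    ∃ (a b : V) (_ : G.Adj a b) (p : G.Walk b a), s(a, b) = e ∧ p.IsPath ∧ e ∉ p.edges ∧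
      p.length + 1 = w.length ∧ (∀ f, f ∈ w.edges ↔ f = e ∨ f ∈ p.edges) ∧
      (∀ x, x ∈ p.support ↔ x ∈ w.support) := by
  obtain ⟨a, b, h, p, q, h1, h2⟩ := exists_split_of_mem_edges w he
  subst h2
  have hc := isCycle_append_comm hw
  rw [Walk.cons_append, Walk.cons_isCycle_iff] at hc
  refine ⟨a, b, h, q.append p, h1, hc.1, h1 ▸ hc.2, ?_, ?_, ?_⟩
  · simp [Walk.length_append]; omega
  · intro f; subst h1
    simp only [Walk.edges_append, Walk.edges_cons, List.mem_append, List.mem_cons]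
    tauto
  · intro x
    simp only [Walk.mem_support_append_iff, Walk.support_cons, List.mem_cons]
    constructor
    · rintro (h | h)
      · exact Or.inr (Or.inr h)
      · exact Or.inl h
    · rintro (h | rfl | h)
      · exact Or.inr h
      · exact Or.inr (by simp)
      · exact Or.inl h

theorem firstHit {S : Set V} {u v : V} (w : G.Walk u v) (h : ∃ x ∈ w.support, x ∈ S) :
    ∃ (r : V) (p : G.Walk u r) (q : G.Walk r v), r ∈ S ∧ w = p.append q ∧
      ∀ x ∈ p.support, x ∈ S → x = r := by
  induction w with
  | @nil u =>
    obtain ⟨x, hx, hxS⟩ := h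
    simp at hx; subst hx
    exact ⟨x, Walk.nil, Walk.nil, hxS, rfl, by simp⟩
  | @cons u c v hadj w ih =>
    by_cases hu : u ∈ S
    · exact ⟨u, Walk.nil, Walk.cons hadj w, hu, rfl, by simp⟩
    · obtain ⟨r, p, q, h1, h2, h3⟩ := ih (by
        obtain ⟨x, hx, hxS⟩ := h
        rw [Walk.support_cons, List.mem_cons] at hx
        rcases hx with rfl | hx
        · exact absurd hxS hu
        · exact ⟨x, hx, hxS⟩)
      refine ⟨r, Walk.cons hadj p, q, h1, by rw [h2]; rfl, ?_⟩
      intro x hx hxS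
      rw [Walk.support_cons, List.mem_cons] at hx
      rcases hx with rfl | hx
      · exact absurd hxS hu
      · exact h3 x hx hxS

theorem lastHit {S : Set V} {u v : V} (w : G.Walk u v) (h : ∃ x ∈ w.support, x ∈ S) :
    ∃ (r : V) (p : G.Walk u r) (q : G.Walk r v), r ∈ S ∧ w = p.append q ∧
      ∀ x ∈ q.support, x ∈ S → x = r := by
  obtain ⟨r, p, q, h1, h2, h3⟩ := firstHit (S := S) w.reverse (by simpa using h)
  refine ⟨r, q.reverse, p.reverse, h1, ?_, by simpa using h3⟩
  rw [← Walk.reverse_append, ← h2, Walk.reverse_reverse]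

/-- two vertices of a cycle: the two arcs -/
theorem cycle_arcs {v : V} {w : G.Walk v v} (hw : w.IsCycle) {r p : V} (hr : r ∈ w.support)
    (hp : p ∈ w.support) (hrp : r ≠ p) :
    ∃ (α : G.Walk r p) (β : G.Walk r p), α.IsPath ∧ β.IsPath ∧ α.length + β.length = w.length ∧
      (∀ f, f ∈ w.edges ↔ f ∈ α.edges ∨ f ∈ β.edges) ∧
      (∀ x ∈ α.support, x ∈ w.support) ∧ (∀ x ∈ β.support, x ∈ w.support) := by
  obtain ⟨w', hw'⟩ : ∃ w', w' = w.rotate r hr := ⟨_, rfl⟩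
  have hc : w'.IsCycle := by rw [hw']; exact (Walk.isCycle_rotate hr).2 hw
  have hl : w'.length = w.length := by rw [hw']; simp
  have hs : ∀ x, x ∈ w'.support ↔ x ∈ w.support := by
    intro x; rw [hw']; exact Walk.mem_support_rotate_iff _ _ _
  have he : ∀ f, f ∈ w'.edges ↔ f ∈ w.edges := by
    intro f; rw [hw']; exact (Walk.rotate_edges _ _ _).mem_iff
  obtain ⟨α, β, hab⟩ := (Walk.mem_support_iff_exists_append).1 ((hs p).2 hp)
  subst hab
  refine ⟨α, β.reverse, ?_, ?_, ?_, ?_, ?_, ?_⟩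
  · exact hc.isPath_of_append_left (Walk.not_nil_of_ne hrp.symm)
  · exact (hc.isPath_of_append_right (Walk.not_nil_of_ne hrp)).reverse
  · rw [← hl]; simp
  · intro f; rw [← he]; simp
  · intro x hx; rw [← hs]; simp [hx]
  · intro x hx; rw [← hs]; simp at hx; simp [hx]

/-- transitivity of lying on a common cycle -/
theorem cycle_trans {v1 v2 : V} {C1 : G.Walk v1 v1} {C2 : G.Walk v2 v2} (h1 : C1.IsCycle)
    (h2 : C2.IsCycle) {e f g : Sym2 V} (he : e ∈ C1.edges) (hf : f ∈ C1.edges) (hf2 : f ∈ C2.edges)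
    (hg : g ∈ C2.edges) (heC : e ∉ C2.edges) :
    ∃ (v : V) (C : G.Walk v v), C.IsCycle ∧ e ∈ C.edges ∧ g ∈ C.edges ∧
      C.length ≤ C1.length + C2.length ∧ ∀ x ∈ C.edges, x ∈ C1.edges ∨ x ∈ C2.edges := by
  obtain ⟨a, b, hab, π, hes, hπ, heπ, hlen, hedge, -⟩ := cycle_open h1 he
  have hfπ : f ∈ π.edges := by
    rcases (hedge f).1 hf with h | h
    · subst h; exact absurd hf2 heC
    · exact h
  obtain ⟨f1, f2, hff⟩ : ∃ f1 f2, f = s(f1, f2) := by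
    induction f with | h x y => exact ⟨x, y, rfl⟩
  subst hff
  have hf12 : f1 ≠ f2 := (Walk.adj_of_mem_edges _ hfπ).ne
  have hS1 := π.fst_mem_support_of_mem_edges hfπ
  have hS2 := π.snd_mem_support_of_mem_edges hfπ
  have hS1' := C2.fst_mem_support_of_mem_edges hf2
  have hS2' := C2.snd_mem_support_of_mem_edges hf2
  obtain ⟨r, π1, π', hrS, hπeq, hr⟩ := firstHit (S := {x | x ∈ C2.support}) π ⟨f1, hS1, hS1'⟩
  subst hπeq
  obtain ⟨p, π2, π3, hpS, hπeq, hp⟩ := lastHit (S := {x | x ∈ C2.support}) π' ⟨r, by simp, hrS⟩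
  subst hπeq
  have hrp : r ≠ p := by
    rintro rfl
    have : π2 = Walk.nil := (Walk.isPath_iff_nil.1 hπ.of_append_right.of_append_left).eq_nil
    subst this
    have key : ∀ x, x ∈ (π1.append ((Walk.nil : G.Walk r r).append π3)).support →
        x ∈ C2.support → x = r := by
      intro x hx hx2
      rw [Walk.mem_support_append_iff] at hx
      rcases hx with hx | hx
      · exact hr x hx hx2
      · exact hp x (by simpa using hx) hx2
    exact hf12 ((key _ hS1 hS1').trans (key _ hS2 hS2').symm)
  obtain ⟨α, β, hα, hβ, hαβ, hαβe, hαs, hβs⟩ := cycle_arcs h2 hrS hpS hrp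
  obtain ⟨γ, hγ, hγg, hγl, hγe, hγs⟩ : ∃ γ : G.Walk r p, γ.IsPath ∧ g ∈ γ.edges ∧
      γ.length ≤ C2.length ∧ (∀ x ∈ γ.edges, x ∈ C2.edges) ∧ ∀ x ∈ γ.support, x ∈ C2.support := by
    rcases (hαβe g).1 hg with h | h
    · exact ⟨α, hα, h, by omega, fun x hx => (hαβe x).2 (Or.inl hx), hαs⟩
    · exact ⟨β, hβ, h, by omega, fun x hx => (hαβe x).2 (Or.inr hx), hβs⟩
  have hγ3 : (γ.append π3).IsPath := isPath_append hγ hπ.of_append_right.of_append_right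
    fun y hy hy' => hp y hy' (hγs y hy)
  have hP : (π1.append (γ.append π3)).IsPath := by
    refine isPath_append hπ.of_append_left hγ3 ?_
    intro y hy hy'
    rw [Walk.mem_support_append_iff] at hy'
    rcases hy' with hy' | hy'
    · exact hr y hy (hγs y hy')
    · exact eq_of_mem_append hπ hy (by simp [hy'])
  subst hes
  refine ⟨a, Walk.cons hab (π1.append (γ.append π3)), ?_, by simp, by simp [hγg], ?_, ?_⟩
  · rw [Walk.cons_isCycle_iff]
    refine ⟨hP, ?_⟩
    simp only [Walk.edges_append, List.mem_append, not_or] at heπ ⊢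
    exact ⟨heπ.1, fun h => heC (hγe _ h), heπ.2.2⟩
  · simp only [Walk.length_cons, Walk.length_append] at hlen ⊢
    omega
  · intro x hx
    simp only [Walk.edges_cons, Walk.edges_append, List.mem_cons, List.mem_append] at hx hedge
    rcases hx with rfl | h | h | h
    · exact Or.inl he
    · exact Or.inl ((hedge x).2 (by tauto))
    · exact Or.inr (hγe _ h)
    · exact Or.inl ((hedge x).2 (by tauto))

end walks
end EP
namespace EP
open Classical SimpleGraph

section ears
variable {V : Type*} {G : SimpleGraph V}

theorem no_cycle_in_path {u v : V} (p : G.Walk u v) (hp : p.IsPath) {x : V} (c : G.Walk x x)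
    (hc : c.IsCycle) (h : ∀ e ∈ c.edges, e ∈ p.edges) : False := by
  induction p with
  | nil =>
    apply hc.ne_nil
    rw [Walk.eq_nil_iff_nil, ← Walk.edges_eq_nil]
    exact List.eq_nil_iff_forall_not_mem.2 fun e he => by simpa using h e he
  | @cons u d v hadj p ih =>
    rw [Walk.cons_isPath_iff] at hp
    by_cases hm : s(u, d) ∈ c.edges
    · obtain ⟨a, b, hab, π, hes, hπ, heπ, hlen, hedge, -⟩ := cycle_open hc hm
      have h' : ∀ e ∈ π.edges, e ∈ p.edges := by
        intro e he
        have := h e ((hedge e).2 (Or.inr he))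
        rw [Walk.edges_cons, List.mem_cons] at this
        rcases this with rfl | h
        · exact absurd he heπ
        · exact h
      have h2nd : ∀ x ∈ π.support, x ≠ u := by
        intro x hx hxu
        subst hxu
        have hnn : ¬ π.Nil := Walk.not_nil_of_ne hab.ne.symm
        obtain ⟨e, he, hxe⟩ := (Walk.mem_support_iff_exists_mem_edges_of_not_nil hnn).1 hx
        exact hp.2 (Walk.mem_support_of_mem_edges (h' e he) hxe)
      have hu : u ∈ s(a, b) := by rw [hes]; simp
      rw [Sym2.mem_iff] at hu
      rcases hu with rfl | rfl
      · exact h2nd u π.end_mem_support rfl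
      · exact h2nd u π.start_mem_support rfl
    · refine ih hp.1 fun e he => ?_
      have := h e he
      rw [Walk.edges_cons, List.mem_cons] at this
      rcases this with rfl | h
      · exact absurd he hm
      · exact h

theorem cycle_in_cycle {u v : V} {K : G.Walk u u} {c : G.Walk v v} (hK : K.IsCycle) (hc : c.IsCycle)
    (h : ∀ e ∈ c.edges, e ∈ K.edges) : K.length ≤ c.length := by
  have : ∀ e ∈ K.edges, e ∈ c.edges := by
    intro e he
    by_contra hne
    obtain ⟨a, b, hab, π, hes, hπ, heπ, hlen, hedge, -⟩ := cycle_open hK he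
    refine no_cycle_in_path π hπ c hc fun f hf => ?_
    rcases (hedge f).1 (h f hf) with rfl | h
    · exact absurd hf hne
    · exact h
  rw [← Walk.length_edges, ← Walk.length_edges]
  exact (List.Nodup.subperm hK.isTrail.edges_nodup this).length_le

theorem ear {B : Set (Sym2 V)} {ℓ : ℕ} {x : V} {K : G.Walk x x} (hK : K.IsCycle)
    (hKB : ∀ e ∈ K.edges, e ∈ B) (hKl : 2 * ℓ ≤ K.length)
    (hmin : ∀ v (w : G.Walk v v), w.IsCycle → (∀ e ∈ w.edges, e ∈ B) → w.length < K.length →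
      w.length < ℓ) {r p : V} (hr : r ∈ K.support) (hp : p ∈ K.support) (hrp : r ≠ p)
    (π : G.Walk r p) (hπ : π.IsPath) (hπB : ∀ e ∈ π.edges, e ∈ B)
    (hπK : ∀ y ∈ π.support, y ∈ K.support → y = r ∨ y = p) :
    ∃ γ : G.Walk r p, (∀ e ∈ γ.edges, e ∈ K.edges) ∧ γ.length ≤ π.length := by
  obtain ⟨α, β, hα, hβ, hαβ, hαβe, hαs, hβs⟩ := cycle_arcs hK hr hp hrp
  by_contra hcon
  push Not at hcon
  have h1 := hcon α (fun e he => (hαβe e).2 (Or.inl he))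
  have h2 := hcon β (fun e he => (hαβe e).2 (Or.inr he))
  have hπl : 1 ≤ π.length := by
    by_contra h
    exact hrp (Walk.eq_of_length_eq_zero (by omega : π.length = 0))
  have key : ∀ α : G.Walk r p, α.IsPath → (∀ y ∈ α.support, y ∈ K.support) →
      (∀ e ∈ α.edges, e ∈ K.edges) → π.length < α.length → π.length + α.length < K.length →
      π.length + α.length < ℓ := by
    intro α hα hαs hαe hl hl2
    have hcyc : (π.append α.reverse).IsCycle := by
      refine hπ.isCycle_append hα.reverse ?_ (Or.inr (by simp; omega))
      intro y hy hy'
      have e1 : y ≠ r := by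
        rintro rfl
        have := hπ.support_nodup
        rw [← Walk.cons_tail_support, List.nodup_cons] at this
        exact this.1 hy
      have e2 : y ≠ p := by
        rintro rfl
        have := hα.reverse.support_nodup
        rw [← Walk.cons_tail_support, List.nodup_cons] at this
        exact this.1 hy'
      have e3 := List.mem_of_mem_tail hy'
      rw [Walk.support_reverse, List.mem_reverse] at e3
      rcases hπK y (List.mem_of_mem_tail hy) (hαs y e3) with h | h
      · exact e1 h
      · exact e2 h
    have := hmin r _ hcyc (by
      intro e he
      simp at he
      rcases he with he | he
      · exact hπB e he
      · exact hKB e (hαe e he)) (by simpa using hl2)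
    simpa using this
  have k1 := key α hα hαs (fun e he => (hαβe e).2 (Or.inl he)) h1 (by omega)
  have k2 := key β hβ hβs (fun e he => (hαβe e).2 (Or.inr he)) h2 (by omega)
  omega

theorem iso {B : Set (Sym2 V)} {ℓ : ℕ} {x : V} {K : G.Walk x x} (hK : K.IsCycle)
    (hKB : ∀ e ∈ K.edges, e ∈ B) (hKl : 2 * ℓ ≤ K.length)
    (hmin : ∀ v (w : G.Walk v v), w.IsCycle → (∀ e ∈ w.edges, e ∈ B) → w.length < K.length →
      w.length < ℓ) (n : ℕ) : ∀ {u v : V} (_ : u ∈ K.support) (_ : v ∈ K.support)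
    (P : G.Walk u v), P.length ≤ n → P.IsPath → (∀ e ∈ P.edges, e ∈ B) →
    ∃ γ : G.Walk u v, (∀ e ∈ γ.edges, e ∈ K.edges) ∧ γ.length ≤ P.length := by
  induction n with
  | zero =>
    intro u v hu hv P hn hP hPB
    cases P with
    | nil => exact ⟨Walk.nil, by simp, le_rfl⟩
    | cons h P => simp at hn
  | succ n ih =>
    intro u v hu hv P hn hP hPB
    cases P with
    | nil => exact ⟨Walk.nil, by simp, le_rfl⟩
    | @cons _ c _ h P =>
      obtain ⟨r, p, q, h1, h2, h3⟩ := firstHit (S := {x | x ∈ K.support}) P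
        ⟨v, P.end_mem_support, hv⟩
      subst h2
      rw [Walk.cons_isPath_iff] at hP
      have hur : u ≠ r := by
        rintro rfl; exact hP.2 (by simp)
      obtain ⟨γ1, hγ1, hl1⟩ := ear hK hKB hKl hmin hu h1 hur (Walk.cons h p)
        (by rw [Walk.cons_isPath_iff]
            exact ⟨hP.1.of_append_left, fun hh => hP.2 (by simp [hh])⟩)
        (fun e he => hPB e (by simp at he ⊢; tauto))
        (by intro y hy hyK
            rw [Walk.support_cons, List.mem_cons] at hy
            rcases hy with rfl | hy
            · exact Or.inl rfl
            · exact Or.inr (h3 y hy hyK))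
      simp only [Walk.length_cons, Walk.length_append] at hn
      obtain ⟨γ2, hγ2, hl2⟩ := ih h1 hv q (by omega) hP.1.of_append_right
        (fun e he => hPB e (by simp [he]))
      refine ⟨γ1.append γ2, ?_, ?_⟩
      · intro e he
        rw [Walk.edges_append, List.mem_append] at he
        exact he.elim (hγ1 e) (hγ2 e)
      · simp only [Walk.length_cons, Walk.length_append] at hl1 ⊢
        omega

theorem no_long {B : Set (Sym2 V)} {ℓ : ℕ} (hℓ : 1 ≤ ℓ)
    (gap : ∀ v (w : G.Walk v v), w.IsCycle → (∀ e ∈ w.edges, e ∈ B) → ℓ ≤ w.length →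
      2 * ℓ ≤ w.length)
    (hs : ∀ u v, (∃ e ∈ B, u ∈ e) → (∃ e ∈ B, v ∈ e) →
      ∃ p : G.Walk u v, p.length < ℓ ∧ ∀ e ∈ p.edges, e ∈ B) :
    ¬ ∃ (v : V) (w : G.Walk v v), w.IsCycle ∧ ℓ ≤ w.length ∧ ∀ e ∈ w.edges, e ∈ B := by
  intro hex
  have hex' : ∃ n : ℕ, ∃ (v : V) (w : G.Walk v v), w.IsCycle ∧ ℓ ≤ w.length ∧
      (∀ e ∈ w.edges, e ∈ B) ∧ w.length = n := by
    obtain ⟨v, w, h1, h2, h3⟩ := hex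
    exact ⟨_, v, w, h1, h2, h3, rfl⟩
  obtain ⟨x, K, hK, hKl, hKB, hKn⟩ := Nat.find_spec hex'
  have hmin : ∀ v (w : G.Walk v v), w.IsCycle → (∀ e ∈ w.edges, e ∈ B) → w.length < K.length →
      w.length < ℓ := by
    intro v w hw hwB hl
    by_contra hcon
    rw [hKn] at hl
    exact Nat.find_min hex' hl ⟨v, w, hw, by omega, hwB, rfl⟩
  have h2 := gap x K hK hKB hKl
  have hnn : ¬ K.Nil := hK.not_nil
  have hinc : ∀ y ∈ K.support, ∃ e ∈ B, y ∈ e := by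
    intro y hy
    obtain ⟨e, he, hye⟩ := (Walk.mem_support_iff_exists_mem_edges_of_not_nil hnn).1 hy
    exact ⟨e, hKB e he, hye⟩
  have hyK := K.getVert_mem_support (K.length / 2)
  obtain ⟨P0, hP0, hP0B⟩ := hs x _ (hinc x K.start_mem_support) (hinc _ hyK)
  obtain ⟨γ0, hγ0, hγ0l⟩ := iso hK hKB h2 hmin _ K.start_mem_support hyK P0.bypass le_rfl
    P0.bypass_isPath (fun e he => hP0B e (P0.edges_bypass_subset_edges he))
  have hb := P0.length_bypass_le_length
  have hγb := γ0.length_bypass_le_length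
  have hne : K.take (K.length / 2) ≠ γ0.bypass := by
    intro h
    have := congrArg Walk.length h
    rw [Walk.take_length] at this
    omega
  have htp : (K.take (K.length / 2)).IsPath := by
    have := hK.three_le_length
    exact hK.isPath_take (by omega)
  obtain ⟨u', v', p', q', hp', hq', hcyc⟩ := htp.exists_isCycle_of_ne γ0.bypass_isPath hne
  have hle := cycle_in_cycle hK hcyc (by
    intro e he
    rw [Walk.edges_append, List.mem_append, Walk.edges_reverse, List.mem_reverse] at he
    rcases he with he | he
    · have := hp'.edges_subset he
      exact (K.isSubwalk_take _).edges_subset this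
    · have := hq'.edges_subset he
      exact hγ0 e (γ0.edges_bypass_subset_edges this))
  have l1 := Walk.length_le_of_isSubwalk hp'
  have l2 := Walk.length_le_of_isSubwalk hq'
  rw [Walk.length_append, Walk.length_reverse] at hle
  rw [Walk.take_length] at l1
  omega

end ears
end EP
namespace EP
open Classical SimpleGraph

section good
variable {V : Type*} {ι : Type*}

structure Good (ℓ q : ℕ) (A : Set (Sym2 V)) (cl : Sym2 V → ι) : Prop where
  a1 : ∀ Q, ¬ LongCyc ℓ (AQ cl A Q)
  a2 : ∀ v (w : (⊤ : SimpleGraph V).Walk v v), w.IsCycle → (∀ e ∈ w.edges, e ∈ A) →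
    (∃ e ∈ w.edges, ∃ f ∈ w.edges, cl e ≠ cl f) → ℓ ≤ w.length
  a3 : ∀ Q u v, inc cl A u Q → inc cl A v Q → Cn (AQ cl A Q) u v
  b : ∀ Q u v, u ≠ v → term cl A u → term cl A v → inc cl A u Q → inc cl A v Q →
    ∃ P ⊆ AQ cl A Q, Cn P u v ∧ ∀ Y : Set (Sym2 V), ∃ D ⊆ P, D.ncard ≤ q ∧
      ∀ s t, term cl A s → term cl A t → inc cl A s Q → inc cl A t Q →
        Cn ((AQ cl A Q \ Y) \ D) s t → Cn ((AQ cl A Q \ P) \ Y) s t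
  d : ℓ = 2 → ∀ Q u v w, term cl A u → term cl A v → term cl A w →
    inc cl A u Q → inc cl A v Q → inc cl A w Q → u = v ∨ v = w ∨ u = w

theorem ncard_edges_le {G : SimpleGraph V} {u v : V} (w : G.Walk u v) :
    {e | e ∈ w.edges}.ncard ≤ w.length := by
  have : {e | e ∈ w.edges} = ↑(w.edges.toFinset) := by ext; simp
  rw [this, Set.ncard_coe_finset]
  exact (List.toFinset_card_le _).trans (by simp)

section initial
variable {ℓ : ℕ} {A : Set (Sym2 V)}

def Rel (ℓ : ℕ) (A : Set (Sym2 V)) (e f : Sym2 V) : Prop :=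
  ∃ (v : V) (w : (⊤ : SimpleGraph V).Walk v v), w.IsCycle ∧ w.length < ℓ ∧
    (∀ e ∈ w.edges, e ∈ A) ∧ e ∈ w.edges ∧ f ∈ w.edges

def cl0 (ℓ : ℕ) (A : Set (Sym2 V)) (e : Sym2 V) : Set (Sym2 V) := {f | f = e ∨ Rel ℓ A e f}

theorem Rel.symm {e f : Sym2 V} (h : Rel ℓ A e f) : Rel ℓ A f e := by
  obtain ⟨v, w, h1, h2, h3, h4, h5⟩ := h
  exact ⟨v, w, h1, h2, h3, h5, h4⟩

theorem Rel.trans (gap : ∀ v (w : (⊤ : SimpleGraph V).Walk v v), w.IsCycle →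
      (∀ e ∈ w.edges, e ∈ A) → ℓ ≤ w.length → 2 * ℓ ≤ w.length)
    {e f g : Sym2 V} (h : Rel ℓ A e f) (h' : Rel ℓ A f g) : Rel ℓ A e g := by
  obtain ⟨v, w, h1, h2, h3, h4, h5⟩ := h
  obtain ⟨v', w', h1', h2', h3', h4', h5'⟩ := h'
  by_cases he : e ∈ w'.edges
  · exact ⟨v', w', h1', h2', h3', he, h5'⟩
  obtain ⟨x, C, hC, heC, hgC, hl, hCe⟩ := cycle_trans h1 h1' h4 h5 h4' h5' he
  have hCA : ∀ e ∈ C.edges, e ∈ A := fun f hf => (hCe f hf).elim (h3 f) (h3' f)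
  refine ⟨x, C, hC, ?_, hCA, heC, hgC⟩
  by_contra hcon
  have := gap x C hC hCA (by omega)
  omega

theorem cl0_eq_iff (gap : ∀ v (w : (⊤ : SimpleGraph V).Walk v v), w.IsCycle →
      (∀ e ∈ w.edges, e ∈ A) → ℓ ≤ w.length → 2 * ℓ ≤ w.length) {e f : Sym2 V} :
    cl0 ℓ A e = cl0 ℓ A f ↔ e = f ∨ Rel ℓ A e f := by
  constructor
  · intro h
    have : f ∈ cl0 ℓ A e := by rw [h]; exact Or.inl rfl
    rcases this with rfl | h
    · exact Or.inl rfl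
    · exact Or.inr h
  · rintro (rfl | h)
    · rfl
    · ext g
      constructor
      · rintro (rfl | hg)
        · exact Or.inr h.symm
        · exact Or.inr (h.symm.trans gap hg)
      · rintro (rfl | hg)
        · exact Or.inr h
        · exact Or.inr (h.trans gap hg)

theorem cl0_path (gap : ∀ v (w : (⊤ : SimpleGraph V).Walk v v), w.IsCycle →
      (∀ e ∈ w.edges, e ∈ A) → ℓ ≤ w.length → 2 * ℓ ≤ w.length) {Q : Set (Sym2 V)} {u v : V}
    (huv : u ≠ v) (hu : inc (cl0 ℓ A) A u Q) (hv : inc (cl0 ℓ A) A v Q) :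
    ∃ p : (⊤ : SimpleGraph V).Walk u v, p.length ≤ max 1 ((ℓ - 1) / 2) ∧
      ∀ e ∈ p.edges, e ∈ AQ (cl0 ℓ A) A Q := by
  obtain ⟨e, he, hue, heQ⟩ := hu
  obtain ⟨f, hf, hvf, hfQ⟩ := hv
  have hef : cl0 ℓ A e = cl0 ℓ A f := heQ.trans hfQ.symm
  rw [cl0_eq_iff gap] at hef
  rcases hef with rfl | ⟨x, C, hC, hl, hCA, heC, hfC⟩
  · have : e = s(u, v) := (Sym2.mem_and_mem_iff huv).1 ⟨hue, hvf⟩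
    subst this
    exact ⟨Walk.cons (by simpa using huv) Walk.nil, by simp, by simp [AQ, he, heQ]⟩
  · obtain ⟨α, β, hα, hβ, hαβ, hαβe, hαs, hβs⟩ := cycle_arcs hC
      (Walk.mem_support_of_mem_edges heC hue) (Walk.mem_support_of_mem_edges hfC hvf) huv
    have hCQ : ∀ g ∈ C.edges, g ∈ AQ (cl0 ℓ A) A Q := by
      intro g hg
      refine ⟨hCA g hg, ?_⟩
      rw [← heQ, cl0_eq_iff gap]
      exact Or.inr ⟨x, C, hC, hl, hCA, hg, heC⟩
    rcases le_total α.length β.length with h | h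
    · exact ⟨α, by omega, fun e he => hCQ e ((hαβe e).2 (Or.inl he))⟩
    · exact ⟨β, by omega, fun e he => hCQ e ((hαβe e).2 (Or.inr he))⟩

theorem good_initial (hℓ : 2 ≤ ℓ) (gap : ∀ v (w : (⊤ : SimpleGraph V).Walk v v), w.IsCycle →
      (∀ e ∈ w.edges, e ∈ A) → ℓ ≤ w.length → 2 * ℓ ≤ w.length) :
    Good ℓ (max 1 ((ℓ - 1) / 2)) A (cl0 ℓ A) where
  a1 := by
    intro Q
    refine no_long (by omega) (fun v w hw hwB => gap v w hw fun e he => (hwB e he).1) ?_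
    rintro u v ⟨e, he, hue⟩ ⟨f, hf, hvf⟩
    by_cases huv : u = v
    · subst huv; exact ⟨Walk.nil, by simp; omega, by simp⟩
    obtain ⟨p, hp, hpe⟩ := cl0_path gap huv ⟨e, he.1, hue, he.2⟩ ⟨f, hf.1, hvf, hf.2⟩
    exact ⟨p, by omega, hpe⟩
  a2 := by
    rintro v w hw hwA ⟨e, he, f, hf, hef⟩
    by_contra hcon
    refine hef ((cl0_eq_iff gap).2 (Or.inr ⟨v, w, hw, by omega, hwA, he, hf⟩))
  a3 := by
    intro Q u v hu hv
    by_cases huv : u = v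
    · subst huv; exact Cn.refl _ _
    obtain ⟨p, hp, hpe⟩ := cl0_path gap huv hu hv
    exact ⟨p, hpe⟩
  b := by
    intro Q u v huv _ _ hu hv
    obtain ⟨p, hp, hpe⟩ := cl0_path gap huv hu hv
    refine ⟨{e | e ∈ p.edges}, hpe, ⟨p, fun e he => he⟩, fun Y => ⟨_, subset_rfl, ?_, ?_⟩⟩
    · exact (ncard_edges_le p).trans hp
    · intro s t _ _ _ _ h
      exact h.mono fun e he => by exact ⟨⟨he.1.1, he.2⟩, he.1.2⟩
  d := by
    intro h2 Q u v w _ _ _ ⟨e, he, hue, heQ⟩ ⟨f, hf, hvf, hfQ⟩ ⟨g, hg, hwg, hgQ⟩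
    have key : ∀ e f, cl0 ℓ A e = Q → cl0 ℓ A f = Q → e = f := by
      intro e f h h'
      rcases (cl0_eq_iff gap).1 (h.trans h'.symm) with h | ⟨x, C, hC, hl, -⟩
      · exact h
      · have := hC.three_le_length; omega
    have h1 := key f e hfQ heQ
    have h2 := key g e hgQ heQ
    subst h1 h2
    induction g with
    | h x y =>
      simp only [Sym2.mem_iff] at hue hvf hwg
      rcases hue with rfl | rfl <;> rcases hvf with rfl | rfl <;> rcases hwg with rfl | rfl <;> simp

end initial

section merge
variable {ℓ q : ℕ} {A : Set (Sym2 V)} {cl : Sym2 V → ι}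

theorem HasCyc.terms (h : HasCyc cl A) : ∃ Q s t, s ≠ t ∧ inc cl A s Q ∧ inc cl A t Q ∧
    (∃ R, R ≠ Q ∧ inc cl A s R) ∧ (∃ R, R ≠ Q ∧ inc cl A t R) := by
  obtain ⟨Q, s, t, hst, h1, h2⟩ := h
  have hterm : ∀ u, Cn (AQ cl A Q) s u → (∃ x, x ≠ u ∧ s(u, x) ∈ A \ kap cl A Q s) →
      ∃ R, R ≠ Q ∧ inc cl A u R := by
    rintro u hu ⟨x, hxu, hx⟩
    refine ⟨cl s(u, x), ?_, ⟨_, hx.1, by simp, rfl⟩⟩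
    intro hQ
    refine hx.2 ⟨hQ, ?_⟩
    intro y hy
    rw [Sym2.mem_iff] at hy
    rcases hy with rfl | rfl
    · exact hu
    · exact hu.trans (Cn.step ⟨hx.1, hQ⟩)
  exact ⟨Q, s, t, hst, h1.inc_left hst, h1.symm.inc_left hst.symm,
    hterm s (Cn.refl _ _) (h2.exists_fst hst), hterm t h1 (h2.symm.exists_fst hst.symm)⟩

/-- a vertex of two classes, each having exactly two terminals -/
structure Mergeable (cl : Sym2 V → ι) (A : Set (Sym2 V)) (v c c' : V) (Q Q' : ι) : Prop where
  hQ : Q ≠ Q'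
  vQ : inc cl A v Q
  vQ' : inc cl A v Q'
  vonly : ∀ R, inc cl A v R → R = Q ∨ R = Q'
  cv : c ≠ v
  cv' : c' ≠ v
  cc : c ≠ c'
  cT : term cl A c
  cT' : term cl A c'
  cQ : inc cl A c Q
  cQ' : inc cl A c' Q'
  tQ : ∀ x, term cl A x → inc cl A x Q → x = c ∨ x = v
  tQ' : ∀ x, term cl A x → inc cl A x Q' → x = c' ∨ x = v

noncomputable def mcl (cl : Sym2 V → ι) (Q Q' : ι) (e : Sym2 V) : ι := if cl e = Q' then Q else cl e

theorem AQ_mcl_self {Q Q' : ι} : AQ (mcl cl Q Q') A Q = AQ cl A Q ∪ AQ cl A Q' := by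
  ext e
  simp only [AQ, mcl, Set.mem_ofPred_eq, Set.mem_union]
  split_ifs with h
  · simp only [h]; tauto
  · simp [h]

theorem AQ_mcl_other {Q Q' R : ι} (hR : R ≠ Q) (hR' : R ≠ Q') :
    AQ (mcl cl Q Q') A R = AQ cl A R := by
  ext e
  simp only [AQ, mcl, Set.mem_ofPred_eq]
  split_ifs with h
  · simp [h, hR.symm, hR'.symm]
  · rfl

theorem AQ_mcl_empty {Q Q' : ι} (hQ : Q ≠ Q') : AQ (mcl cl Q Q') A Q' = ∅ := by
  ext e
  simp only [AQ, mcl, Set.mem_ofPred_eq, Set.mem_empty_iff_false, iff_false]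
  split_ifs with h
  · simp [hQ]
  · simp [h]

theorem inc_iff {u : V} {Q : ι} : inc cl A u Q ↔ ∃ e ∈ AQ cl A Q, u ∈ e := by
  constructor
  · rintro ⟨e, h1, h2, h3⟩; exact ⟨e, ⟨h1, h3⟩, h2⟩
  · rintro ⟨e, ⟨h1, h3⟩, h2⟩; exact ⟨e, h1, h2, h3⟩

theorem inc_mcl_self {Q Q' : ι} {u : V} :
    inc (mcl cl Q Q') A u Q ↔ inc cl A u Q ∨ inc cl A u Q' := by
  rw [inc_iff, inc_iff, inc_iff, AQ_mcl_self]
  constructor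
  · rintro ⟨e, h | h, he⟩
    · exact Or.inl ⟨e, h, he⟩
    · exact Or.inr ⟨e, h, he⟩
  · rintro (⟨e, h, he⟩ | ⟨e, h, he⟩)
    · exact ⟨e, Or.inl h, he⟩
    · exact ⟨e, Or.inr h, he⟩

theorem inc_mcl_other {Q Q' R : ι} {u : V} (hR : R ≠ Q) (hR' : R ≠ Q') :
    inc (mcl cl Q Q') A u R ↔ inc cl A u R := by
  rw [inc_iff, inc_iff, AQ_mcl_other hR hR']

theorem inc_mcl_empty {Q Q' : ι} {u : V} (hQ : Q ≠ Q') : ¬ inc (mcl cl Q Q') A u Q' := by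
  rw [inc_iff, AQ_mcl_empty hQ]; simp

theorem Mergeable.share {v c c' : V} {Q Q' : ι} (M : Mergeable cl A v c c' Q Q') {x : V}
    (h : inc cl A x Q) (h' : inc cl A x Q') : x = v := by
  have ht : term cl A x := ⟨Q, Q', M.hQ, h, h'⟩
  rcases M.tQ x ht h with rfl | h1
  · rcases M.tQ' x ht h' with h2 | h2
    · exact absurd h2 M.cc
    · exact h2
  · exact h1

theorem Mergeable.term_of {v c c' : V} {Q Q' : ι} (M : Mergeable cl A v c c' Q Q') {x : V}
    (h : term (mcl cl Q Q') A x) : term cl A x ∧ x ≠ v := by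
  obtain ⟨R, R', hRR, hR, hR'⟩ := h
  have hv : ∀ R, inc (mcl cl Q Q') A v R → R = Q := by
    intro R hR
    by_contra h1
    by_cases h2 : R = Q'
    · subst h2; exact inc_mcl_empty M.hQ hR
    · rw [inc_mcl_other h1 h2] at hR
      rcases M.vonly R hR with h | h <;> contradiction
  refine ⟨?_, ?_⟩
  swap
  · rintro rfl
    exact hRR ((hv R hR).trans (hv R' hR').symm)
  have hne : ∀ R, inc (mcl cl Q Q') A x R → R ≠ Q' := by
    rintro R hR rfl; exact inc_mcl_empty M.hQ hR
  have h1 := hne R hR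
  have h2 := hne R' hR'
  by_cases h3 : R = Q
  · subst h3
    rw [inc_mcl_other (Ne.symm hRR) h2] at hR'
    rw [inc_mcl_self] at hR
    rcases hR with hR | hR
    · exact ⟨_, _, hRR, hR, hR'⟩
    · exact ⟨_, _, h2.symm, hR, hR'⟩
  · rw [inc_mcl_other h3 h1] at hR
    by_cases h4 : R' = Q
    · subst h4
      rw [inc_mcl_self] at hR'
      rcases hR' with hR' | hR'
      · exact ⟨_, _, hRR, hR, hR'⟩
      · exact ⟨_, _, h1, hR, hR'⟩
    · rw [inc_mcl_other h4 h2] at hR'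
      exact ⟨_, _, hRR, hR, hR'⟩

theorem leave {B : Set (Sym2 V)} {Q Q' : ι} {v c : V}
    (share : ∀ x, inc cl A x Q → inc cl A x Q' → x = v)
    (hc : inc cl A c Q) (hcv : c ≠ v) (hB : B ⊆ AQ cl A Q ∪ AQ cl A Q') :
    ∀ {u x : V} (w : (⊤ : SimpleGraph V).Walk u x), (∀ e ∈ w.edges, e ∈ B) →
      Cn (B ∩ AQ cl A Q) c u → Cn (B ∩ AQ cl A Q) c x ∨ Cn (B ∩ AQ cl A Q) c v := by
  intro u x w
  induction w with
  | nil => intro _ h; exact Or.inl h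
  | @cons u d x hadj w ih =>
    intro hw hcu
    have hud : s(u, d) ∈ B := hw _ (by simp)
    rcases hB hud with hQ | hQ'
    · exact ih (fun e he => hw e (by simp [he])) (hcu.trans (Cn.step ⟨hud, hQ⟩))
    · right
      have huQ' : inc cl A u Q' := ⟨_, hQ'.1, by simp, hQ'.2⟩
      have huQ : inc cl A u Q := by
        by_cases h : c = u
        · rwa [← h]
        · exact (hcu.mono Set.inter_subset_right).symm.inc_left (Ne.symm h)
      rw [← share u huQ huQ']; exact hcu

theorem good_merge (hg : Good ℓ q A cl) {v c c' : V} {Q Q' : ι} (M : Mergeable cl A v c c' Q Q') :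
    Good ℓ q A (mcl cl Q Q') where
  a1 := by
    intro R hR
    by_cases h1 : R = Q
    · subst h1
      rw [AQ_mcl_self] at hR
      obtain ⟨x, w, hw, hwl, hwe⟩ := hR
      by_cases hne : ∃ e ∈ w.edges, ∃ f ∈ w.edges, cl e ≠ cl f
      · obtain ⟨S, s, t, hst, h1, h2, ⟨R1, hR1, h3⟩, ⟨R2, hR2, h4⟩⟩ := (L1 w hw hwe hne).terms
        have key : ∀ x S, inc cl (AQ cl A R ∪ AQ cl A Q') x S →
            inc cl A x S ∧ (S = R ∨ S = Q') := by
          rintro x S ⟨e, he | he, hx, hS⟩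
          · exact ⟨⟨e, he.1, hx, hS⟩, Or.inl (hS ▸ he.2)⟩
          · exact ⟨⟨e, he.1, hx, hS⟩, Or.inr (hS ▸ he.2)⟩
        have key2 : ∀ x S T, S ≠ T → inc cl (AQ cl A R ∪ AQ cl A Q') x S →
            inc cl (AQ cl A R ∪ AQ cl A Q') x T → x = v := by
          intro x S T hST hS hT
          obtain ⟨k1, rfl | rfl⟩ := key x S hS <;> obtain ⟨k2, rfl | rfl⟩ := key x T hT
          · exact absurd rfl hST
          · exact M.share k1 k2
          · exact M.share k2 k1
          · exact absurd rfl hST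
        exact hst ((key2 s _ _ hR1 h3 h1).trans (key2 t _ _ hR2 h4 h2).symm)
      · push Not at hne
        have hnn : w.edges ≠ [] := by
          intro h
          exact hw.not_nil (Walk.edges_eq_nil.1 h)
        obtain ⟨e0, he0⟩ := List.exists_mem_of_ne_nil _ hnn
        exact hg.a1 (cl e0) ⟨x, w, hw, hwl, fun e he => ⟨by
          rcases hwe e he with h | h <;> exact h.1, hne e he e0 he0⟩⟩
    · by_cases h2 : R = Q'
      · subst h2
        rw [AQ_mcl_empty M.hQ] at hR
        obtain ⟨x, w, hw, hwl, hwe⟩ := hR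
        exact hw.not_nil (Walk.edges_eq_nil.1 (List.eq_nil_iff_forall_not_mem.2 hwe))
      · rw [AQ_mcl_other h1 h2] at hR
        exact hg.a1 R hR
  a2 := by
    rintro x w hw hwA ⟨e, he, f, hf, hef⟩
    exact hg.a2 x w hw hwA ⟨e, he, f, hf, fun h => hef (by simp [mcl, h])⟩
  a3 := by
    intro R x y hx hy
    by_cases h1 : R = Q
    · subst h1
      rw [inc_mcl_self] at hx hy
      rw [AQ_mcl_self]
      have key : ∀ x, inc cl A x R ∨ inc cl A x Q' → Cn (AQ cl A R ∪ AQ cl A Q') x v := by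
        rintro x (h | h)
        · exact (hg.a3 R x v h M.vQ).mono Set.subset_union_left
        · exact (hg.a3 Q' x v h M.vQ').mono Set.subset_union_right
      exact (key x hx).trans (key y hy).symm
    · by_cases h2 : R = Q'
      · subst h2
        exact absurd hx (inc_mcl_empty M.hQ)
      · rw [inc_mcl_other h1 h2] at hx hy
        rw [AQ_mcl_other h1 h2]
        exact hg.a3 R x y hx hy
  b := by
    intro R x y hxy hx hy hxR hyR
    by_cases h1 : R = Q
    · subst h1
      have hv : term cl A v := ⟨R, Q', M.hQ, M.vQ, M.vQ'⟩
      obtain ⟨P1, hP1, hc1, hD1⟩ := hg.b R c v M.cv M.cT hv M.cQ M.vQ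
      obtain ⟨P2, hP2, hc2, hD2⟩ := hg.b Q' c' v M.cv' M.cT' hv M.cQ' M.vQ'
      have hin : ∀ x, term (mcl cl R Q') A x → inc (mcl cl R Q') A x R → x = c ∨ x = c' := by
        intro x hx hxR
        obtain ⟨hx1, hx2⟩ := M.term_of hx
        rw [inc_mcl_self] at hxR
        rcases hxR with h | h
        · rcases M.tQ x hx1 h with h | h
          · exact Or.inl h
          · exact absurd h hx2
        · rcases M.tQ' x hx1 h with h | h
          · exact Or.inr h
          · exact absurd h hx2
      have hwlog : ∀ (B : Set (Sym2 V)), Cn B c c' → ∀ s t, term (mcl cl R Q') A s →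
          term (mcl cl R Q') A t → inc (mcl cl R Q') A s R → inc (mcl cl R Q') A t R → Cn B s t := by
        intro B hB s t hs ht hsR htR
        rcases hin s hs hsR with rfl | rfl <;> rcases hin t ht htR with rfl | rfl
        · exact Cn.refl _ _
        · exact hB
        · exact hB.symm
        · exact Cn.refl _ _
      refine ⟨P1 ∪ P2, ?_, ?_, ?_⟩
      · rw [AQ_mcl_self]; exact Set.union_subset_union hP1 hP2
      · exact hwlog _ ((hc1.mono Set.subset_union_left).trans
          (hc2.mono Set.subset_union_right).symm) x y hx hy hxR hyR
      · intro Y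
        rw [AQ_mcl_self]
        have disj : ∀ e ∈ AQ cl A R, e ∉ AQ cl A Q' := fun e h h' => M.hQ (h.2.symm.trans h'.2)
        have hwlog2 : ∀ (B : Set (Sym2 V)), ∀ s t, term (mcl cl R Q') A s →
            term (mcl cl R Q') A t → inc (mcl cl R Q') A s R → inc (mcl cl R Q') A t R →
            Cn B s t → s ≠ t → Cn B c c' := by
          intro B s t hs ht hsR htR hB hst
          rcases hin s hs hsR with rfl | rfl <;> rcases hin t ht htR with rfl | rfl
          · exact absurd rfl hst
          · exact hB
          · exact hB.symm
          · exact absurd rfl hst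
        have red : ∀ D : Set (Sym2 V), ¬ Cn (((AQ cl A R ∪ AQ cl A Q') \ Y) \ D) c c' →
          ∀ s t, term (mcl cl R Q') A s → term (mcl cl R Q') A t → inc (mcl cl R Q') A s R →
            inc (mcl cl R Q') A t R → Cn (((AQ cl A R ∪ AQ cl A Q') \ Y) \ D) s t →
            Cn (((AQ cl A R ∪ AQ cl A Q') \ (P1 ∪ P2)) \ Y) s t := by
          intro D hD s t hs ht hsR htR h
          by_cases hst : s = t
          · subst hst; exact Cn.refl _ _
          · exact absurd (hwlog2 _ s t hs ht hsR htR h hst) hD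
        by_cases k1 : Cn ((AQ cl A R \ P1) \ Y) c v
        · by_cases k2 : Cn ((AQ cl A Q' \ P2) \ Y) c' v
          · refine ⟨∅, Set.empty_subset _, by simp, ?_⟩
            intro s t hs ht hsR htR _
            refine hwlog _ ?_ s t hs ht hsR htR
            refine (k1.mono ?_).trans (k2.mono ?_).symm
            · rintro e ⟨⟨h1, h2⟩, h3⟩
              exact ⟨⟨Or.inl h1, fun h => h.elim h2 fun h => disj e h1 (hP2 h)⟩, h3⟩
            · rintro e ⟨⟨h1, h2⟩, h3⟩
              exact ⟨⟨Or.inr h1, fun h => h.elim (fun h => disj e (hP1 h) h1) h2⟩, h3⟩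
          · obtain ⟨D, hDP, hDq, hD⟩ := hD2 Y
            refine ⟨D, hDP.trans Set.subset_union_right, hDq, red D ?_⟩
            intro hcon
            obtain ⟨w, hw⟩ := hcon.symm
            have := leave (cl := cl) (A := A) (Q := Q') (Q' := R) (v := v) (c := c')
              (B := ((AQ cl A R ∪ AQ cl A Q') \ Y) \ D)
              (fun x h h' => M.share h' h) M.cQ' M.cv'
              (fun e he => he.1.1.symm) w hw (Cn.refl _ _)
            have hfin : Cn ((((AQ cl A R ∪ AQ cl A Q') \ Y) \ D) ∩ AQ cl A Q') c' v := by
              rcases this with h | h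
              · have hc := (h.mono Set.inter_subset_right).symm.inc_left M.cc
                exact absurd (M.share M.cQ hc) M.cv
              · exact h
            exact k2 (hD c' v M.cT' hv M.cQ' M.vQ'
              (hfin.mono fun e he => by exact ⟨⟨he.2, he.1.1.2⟩, he.1.2⟩))
        · obtain ⟨D, hDP, hDq, hD⟩ := hD1 Y
          refine ⟨D, hDP.trans Set.subset_union_left, hDq, red D ?_⟩
          intro hcon
          obtain ⟨w, hw⟩ := hcon
          have := leave (cl := cl) (A := A) (Q := R) (Q' := Q') (v := v) (c := c)
            (B := ((AQ cl A R ∪ AQ cl A Q') \ Y) \ D)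
            (fun x h h' => M.share h h') M.cQ M.cv
            (fun e he => he.1.1) w hw (Cn.refl _ _)
          have hfin : Cn ((((AQ cl A R ∪ AQ cl A Q') \ Y) \ D) ∩ AQ cl A R) c v := by
            rcases this with h | h
            · have hc := (h.mono Set.inter_subset_right).symm.inc_left M.cc.symm
              exact absurd (M.share hc M.cQ') M.cv'
            · exact h
          exact k1 (hD c v M.cT hv M.cQ M.vQ
            (hfin.mono fun e he => by exact ⟨⟨he.2, he.1.1.2⟩, he.1.2⟩))
    · by_cases h2 : R = Q'
      · subst h2
        exact absurd hxR (inc_mcl_empty M.hQ)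
      · rw [inc_mcl_other h1 h2] at hxR hyR
        rw [AQ_mcl_other h1 h2]
        obtain ⟨P, hP, hc, hD⟩ := hg.b R x y hxy (M.term_of hx).1 (M.term_of hy).1 hxR hyR
        refine ⟨P, hP, hc, fun Y => ?_⟩
        obtain ⟨D, hDP, hDq, hD⟩ := hD Y
        refine ⟨D, hDP, hDq, fun s t hs ht hsR htR => ?_⟩
        rw [inc_mcl_other h1 h2] at hsR htR
        exact hD s t (M.term_of hs).1 (M.term_of ht).1 hsR htR
  d := by
    intro hl R x y z hx hy hz hxR hyR hzR
    by_cases h1 : R = Q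
    · subst h1
      have hin : ∀ x, term (mcl cl R Q') A x → inc (mcl cl R Q') A x R → x = c ∨ x = c' := by
        intro x hx hxR
        obtain ⟨hx1, hx2⟩ := M.term_of hx
        rw [inc_mcl_self] at hxR
        rcases hxR with h | h
        · rcases M.tQ x hx1 h with h | h
          · exact Or.inl h
          · exact absurd h hx2
        · rcases M.tQ' x hx1 h with h | h
          · exact Or.inr h
          · exact absurd h hx2
      rcases hin x hx hxR with rfl | rfl <;> rcases hin y hy hyR with rfl | rfl <;>
        rcases hin z hz hzR with rfl | rfl <;> simp
    · by_cases h2 : R = Q'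
      · subst h2
        exact absurd hxR (inc_mcl_empty M.hQ)
      · rw [inc_mcl_other h1 h2] at hxR hyR hzR
        exact hg.d hl R x y z (M.term_of hx).1 (M.term_of hy).1 (M.term_of hz).1 hxR hyR hzR

theorem mcl_image_lt [Finite V] {v c c' : V} {Q Q' : ι} (M : Mergeable cl A v c c' Q Q') :
    (Set.image (mcl cl Q Q') A).ncard < (Set.image cl A).ncard := by
  apply Set.ncard_lt_ncard _ (Set.toFinite _)
  obtain ⟨e, he, -, heQ⟩ := M.vQ
  obtain ⟨e', he', -, heQ'⟩ := M.vQ'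
  refine (Set.ssubset_iff_of_subset ?_).2 ⟨Q', ⟨e', he', heQ'⟩, ?_⟩
  · rintro _ ⟨f, hf, rfl⟩
    unfold mcl
    split_ifs with h
    · exact ⟨e, he, heQ⟩
    · exact ⟨f, hf, rfl⟩
  · rintro ⟨f, hf, h⟩
    unfold mcl at h
    split_ifs at h with h'
    · exact M.hQ h
    · exact h' h

end merge
end good
end EP
namespace EP
open Classical SimpleGraph

section moore
variable {W : Type*} {J : SimpleGraph W}

def Br (J : SimpleGraph W) (z : W) : Prop :=
  ∀ y, ∃ a b, a ≠ b ∧ a ≠ y ∧ b ≠ y ∧ J.Adj z a ∧ J.Adj z b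

theorem ext_one {M : ℕ} (nocyc : ∀ v (c : J.Walk v v), c.IsCycle → M < c.length) {z ρ : W}
    (p : J.Walk z ρ) (hp : p.IsPath) (hM : p.length + 1 ≤ M) {w : W} (hw : J.Adj w z)
    (hne : w ≠ p.snd) : (Walk.cons hw p).IsPath := by
  rw [Walk.cons_isPath_iff]
  refine ⟨hp, fun hmem => ?_⟩
  obtain ⟨q, r, hqr⟩ := Walk.mem_support_iff_exists_append.1 hmem
  have hc : (Walk.cons hw q).IsCycle := by
    rw [Walk.cons_isCycle_iff]
    refine ⟨(hqr ▸ hp).of_append_left, fun he => hne ?_⟩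
    have : s(z, w) ∈ p.edges := by
      rw [hqr, Walk.edges_append, List.mem_append, Sym2.eq_swap]; exact Or.inl he
    exact (hp.eq_snd_of_mem_edges this)
  have h1 := nocyc _ _ hc
  have h2 := congrArg Walk.length hqr
  rw [Walk.length_append] at h2
  rw [Walk.length_cons] at h1
  omega

theorem soon {M : ℕ} (nocyc : ∀ v (c : J.Walk v v), c.IsCycle → M < c.length)
    (h2 : ∀ x y, J.Adj x y → ∀ y', ∃ w, w ≠ y' ∧ J.Adj x w) {z ρ : W}
    (p : J.Walk z ρ) (hp : p.IsPath) (hp1 : 1 ≤ p.length) (j : ℕ) (hM : p.length + j ≤ M) :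
    (∃ (z1 z2 : W) (q1 : J.Walk z1 z) (q2 : J.Walk z2 z), q1.length = j ∧ q2.length = j ∧
      (q1.append p).IsPath ∧ (q2.append p).IsPath ∧ q1.support ≠ q2.support) ∨
    (∃ (z1 : W) (q : J.Walk z1 z), q.length = j ∧ (q.append p).IsPath ∧
      ∀ x ∈ q.support.tail, ¬ Br J x) := by
  have hadj : ∀ {x : W} (P : J.Walk x ρ), 1 ≤ P.length → ∃ y, J.Adj x y := by
    intro x P hP
    cases P with
    | nil => simp at hP
    | cons h P => exact ⟨_, h⟩
  have e1 : ∀ {x : W} (q : J.Walk x z), q.length + 1 ≤ j → (q.append p).IsPath →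
      ∃ (y : W) (hy : J.Adj y x), ((Walk.cons hy q).append p).IsPath := by
    intro x q hq hqp
    have hl : 1 ≤ (q.append p).length := by rw [Walk.length_append]; omega
    obtain ⟨y0, hy0⟩ := hadj _ hl
    obtain ⟨w, hw, hwx⟩ := h2 x y0 hy0 (q.append p).snd
    exact ⟨w, hwx.symm, ext_one nocyc (q.append p) hqp
      (by rw [Walk.length_append]; omega) hwx.symm hw⟩
  induction j with
  | zero => exact Or.inr ⟨z, Walk.nil, rfl, by simpa using hp, by simp⟩
  | succ j ih =>
    rcases ih (by omega) (fun q hq => e1 q (by omega)) with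
      ⟨z1, z2, q1, q2, hl1, hl2, hp1', hp2', hne⟩ | ⟨z1, q, hl, hqp, hbr⟩
    · obtain ⟨y1, hy1, hP1⟩ := e1 q1 (by omega) hp1'
      obtain ⟨y2, hy2, hP2⟩ := e1 q2 (by omega) hp2'
      refine Or.inl ⟨y1, y2, _, _, ?_, ?_, hP1, hP2, ?_⟩
      · simp [hl1]
      · simp [hl2]
      · simp only [Walk.support_cons, ne_eq, List.cons.injEq, not_and]
        exact fun _ => hne
    · by_cases hB : Br J z1
      · obtain ⟨a, b, hab, ha, hb, haz, hbz⟩ := hB (q.append p).snd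
        have hl' : (q.append p).length + 1 ≤ M := by rw [Walk.length_append]; omega
        refine Or.inl ⟨a, b, Walk.cons haz.symm q, Walk.cons hbz.symm q, by simp [hl], by simp [hl],
          ext_one nocyc _ hqp hl' haz.symm ha, ext_one nocyc _ hqp hl' hbz.symm hb, ?_⟩
        simp [hab]
      · obtain ⟨y1, hy1, hP1⟩ := e1 q (by omega) hqp
        refine Or.inr ⟨y1, _, by simp [hl], hP1, ?_⟩
        intro x hx
        rw [Walk.support_cons, List.tail_cons, ← Walk.cons_tail_support, List.mem_cons] at hx
        rcases hx with rfl | hx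
        · exact hB
        · exact hbr x hx

def Ends {z ρ : W} (p : J.Walk z ρ) (n : ℕ) : Set W :=
  {z' | ∃ q : J.Walk z' z, q.length = n ∧ (q.append p).IsPath}

theorem ends_card [Finite W] {h R : ℕ} (hh : 1 ≤ h)
    (nocyc : ∀ v (c : J.Walk v v), c.IsCycle → 2 * (h * R + 1) < c.length)
    (h2 : ∀ x y, J.Adj x y → ∀ y', ∃ w, w ≠ y' ∧ J.Adj x w)
    (hbr : ∀ x y (p : J.Walk x y), p.IsPath → p.length + 1 = h → ∃ z ∈ p.support, Br J z) (r : ℕ) :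
    ∀ {z ρ : W} (p : J.Walk z ρ), p.IsPath → 1 ≤ p.length → p.length + h * r ≤ h * R + 1 →
      2 ^ r ≤ (Ends p (h * r)).ncard := by
  induction r with
  | zero =>
    intro z ρ p hp h1 hl
    have : (Ends p (h * 0)).Nonempty := ⟨z, Walk.nil, by simp, by simpa using hp⟩
    have := (Set.ncard_pos (Set.toFinite _)).2 this
    rw [pow_zero]; omega
  | succ r ih =>
    intro z ρ p hp h1 hl
    rw [Nat.mul_succ] at hl
    rcases soon nocyc h2 p hp h1 h (by omega) with
      ⟨z1, z2, q1, q2, hl1, hl2, hp1', hp2', hne⟩ | ⟨z1, q, hl, hqp, hb⟩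
    · have i1 := ih (q1.append p) hp1' (by simp; omega) (by simp; omega)
      have i2 := ih (q2.append p) hp2' (by simp; omega) (by simp; omega)
      have hdis : Disjoint (Ends (q1.append p) (h * r)) (Ends (q2.append p) (h * r)) := by
        rw [Set.disjoint_left]
        rintro x ⟨a1, ha1, hP1⟩ ⟨a2, ha2, hP2⟩
        have : a1.append (q1.append p) ≠ a2.append (q2.append p) := by
          intro heq
          apply hne
          have := congrArg Walk.support heq
          rw [Walk.support_append_eq_support_dropLast_append a1,
            Walk.support_append_eq_support_dropLast_append a2] at this
          have := (List.append_inj this (by simp [ha1, ha2])).2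
          rw [Walk.support_append, Walk.support_append] at this
          exact List.append_cancel_right this
        obtain ⟨v, -, -, c, hc, hcl⟩ := hP1.exists_isCycle_length_le_add_of_ne hP2 this
        have := nocyc v c hc
        simp only [Walk.length_append] at hcl
        omega
      have hsub : Ends (q1.append p) (h * r) ∪ Ends (q2.append p) (h * r) ⊆
          Ends p (h * (r + 1)) := by
        rintro x (⟨a, ha, hP⟩ | ⟨a, ha, hP⟩)
        · exact ⟨a.append q1, by simp [ha, hl1, Nat.mul_succ], by rwa [Walk.append_assoc] at hP⟩
        · exact ⟨a.append q2, by simp [ha, hl2, Nat.mul_succ], by rwa [Walk.append_assoc] at hP⟩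
      have := Set.ncard_le_ncard hsub (Set.toFinite _)
      rw [Set.ncard_union_eq hdis (Set.toFinite _) (Set.toFinite _)] at this
      rw [pow_succ]; omega
    · exfalso
      cases q with
      | nil => simp at hl; omega
      | cons hadj q =>
        have hqp' : (q.append p).IsPath := by
          rw [Walk.cons_append, Walk.cons_isPath_iff] at hqp; exact hqp.1
        obtain ⟨x, hx, hxB⟩ := hbr _ _ q hqp'.of_append_left (by simpa using hl)
        exact hb x (by simpa using hx) hxB

theorem moore [Finite W] {h R : ℕ} (hh : 1 ≤ h)
    (nocyc : ∀ v (c : J.Walk v v), c.IsCycle → 2 * (h * R + 1) < c.length)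
    (h2 : ∀ x y, J.Adj x y → ∀ y', ∃ w, w ≠ y' ∧ J.Adj x w)
    (hbr : ∀ x y (p : J.Walk x y), p.IsPath → p.length + 1 = h → ∃ z ∈ p.support, Br J z)
    (hne : ∃ x y, J.Adj x y) : 2 ^ R ≤ {x | ∃ y, J.Adj x y}.ncard := by
  obtain ⟨x, y, hxy⟩ := hne
  have hp : (Walk.cons hxy Walk.nil).IsPath := by simp [hxy.ne]
  refine (ends_card hh nocyc h2 hbr R _ hp (by simp) (by simp; omega)).trans ?_
  refine Set.ncard_le_ncard ?_ (Set.toFinite _)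
  rintro z ⟨q, hq, -⟩
  cases q with
  | nil => exact ⟨y, hxy⟩
  | cons h q => exact ⟨_, h⟩

end moore
end EP
namespace EP
open Classical SimpleGraph

section forest
variable {V : Type*} {ι : Type*}

def EAc (F : Set (Sym2 V)) : Prop :=
  ∀ v (w : (⊤ : SimpleGraph V).Walk v v), w.IsCycle → ¬ ∀ e ∈ w.edges, e ∈ F

theorem eac_iff (F : Set (Sym2 V)) : EAc F ↔ (fromEdgeSet F).IsAcyclic := by
  constructor
  · intro h v w hw
    refine h v (w.mapLe le_top) (by simpa using hw) ?_
    intro e he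
    rw [Walk.edges_mapLe_eq_edges] at he
    have := w.edges_subset_edgeSet he
    rw [edgeSet_fromEdgeSet] at this
    exact this.1
  · intro h v w hw he
    have h' : ∀ e ∈ w.edges, e ∈ (fromEdgeSet F).edgeSet := by
      intro e hee
      rw [edgeSet_fromEdgeSet]
      have := w.edges_subset_edgeSet hee
      exact ⟨he e hee, not_isDiag_of_mem_edgeSet _ this⟩
    exact h (w.transfer _ h') (hw.transfer h')

theorem forest_span [Finite V] (B : Set (Sym2 V)) (hB : ∀ e ∈ B, ¬ e.IsDiag) (W : Set V)
    (hW : ∀ v, v ∈ W ↔ ∃ e ∈ B, v ∈ e) (hc : ∀ u ∈ W, ∀ v ∈ W, Cn B u v) :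
    ∃ F ⊆ B, EAc F ∧ W.ncard ≤ F.ncard + 1 := by
  obtain ⟨Fg, hle, hac, hre⟩ := (fromEdgeSet B).exists_isAcyclic_reachable_eq_le
  have hsub : Fg.edgeSet ⊆ B := by
    intro e he
    have := edgeSet_mono hle he
    rw [edgeSet_fromEdgeSet] at this
    exact this.1
  refine ⟨Fg.edgeSet, hsub, ?_, ?_⟩
  · rw [eac_iff, fromEdgeSet_edgeSet]; exact hac
  rcases W.eq_empty_or_nonempty with rfl | hne
  · simp
  have : Fintype V := Fintype.ofFinite V
  have hconn : (Fg.induce W).Connected := by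
    rw [connected_iff]
    refine ⟨?_, hne.to_subtype⟩
    rintro ⟨x, hx⟩ ⟨y, hy⟩
    have h1 : (fromEdgeSet B).Reachable x y := by
      obtain ⟨w, hw⟩ := hc x hx y hy
      refine ⟨w.transfer _ ?_⟩
      intro e he
      rw [edgeSet_fromEdgeSet]
      exact ⟨hw e he, hB e (hw e he)⟩
    rw [← hre] at h1
    obtain ⟨w⟩ := h1
    refine ⟨w.induce W ?_⟩
    intro z hz
    by_cases hn : w.Nil
    · have : z = x := by
        cases w with
        | nil => simpa using hz
        | cons h p => simp at hn
      exact this ▸ hx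
    · obtain ⟨e, he, hze⟩ := (Walk.mem_support_iff_exists_mem_edges_of_not_nil hn).1 hz
      exact (hW z).2 ⟨e, hsub (w.edges_subset_edgeSet he), hze⟩
  have h1 := hconn.card_vert_le_card_edgeSet_add_one
  have hs : Fg.support ⊆ W := by
    rintro x ⟨y, hxy⟩
    exact (hW x).2 ⟨s(x, y), hsub hxy, by simp⟩
  have h2 := card_edgeFinset_induce_of_support_subset hs
  rw [Nat.card_eq_fintype_card (α := (Fg.induce W).edgeSet), ← edgeFinset_card, h2,
    edgeFinset_card, ← Nat.card_eq_fintype_card] at h1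
  exact h1

theorem forest_le [Finite V] (F : Set (Sym2 V)) (hF : ∀ e ∈ F, ¬ e.IsDiag) (W : Set V)
    (hW : ∀ e ∈ F, ∀ v ∈ e, v ∈ W) (hac : EAc F) : F.ncard ≤ W.ncard := by
  have : Fintype V := Fintype.ofFinite V
  rw [eac_iff] at hac
  have hes : (fromEdgeSet F).edgeSet = F := by
    rw [edgeSet_fromEdgeSet]
    ext e
    exact ⟨fun h => h.1, fun h => ⟨h, hF e h⟩⟩
  rcases F.eq_empty_or_nonempty with rfl | ⟨e0, he0⟩
  · simp
  have hne : Nonempty W := by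
    induction e0 with
    | _ x y => exact ⟨x, hW _ he0 x (by simp)⟩
  have hs : (fromEdgeSet F).support ⊆ W := by
    rintro x ⟨y, hxy⟩
    have hxy' := (fromEdgeSet_adj F).1 hxy
    exact hW _ hxy'.1 x (by simp)
  have h2 : ((fromEdgeSet F).induce W).edgeFinset.card = (fromEdgeSet F).edgeFinset.card := by
    convert card_edgeFinset_induce_of_support_subset hs
  have hac' := hac.induce W
  obtain ⟨T, hT, -, hTt⟩ := (connected_top (V := W)).exists_isTree_le_of_le_of_isAcyclic
    le_top hac'
  have h3 := hTt.card_edgeFinset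
  have h4 : ((fromEdgeSet F).induce W).edgeFinset.card ≤ T.edgeFinset.card :=
    Finset.card_le_card (edgeFinset_mono hT)
  have h5 : (fromEdgeSet F).edgeFinset.card = F.ncard := by
    rw [edgeFinset_card, ← Nat.card_eq_fintype_card, Nat.card_coe_set_eq, hes]
  have h6 : Fintype.card W = W.ncard := by
    rw [← Nat.card_eq_fintype_card, Nat.card_coe_set_eq]
  omega

theorem count [Fintype V] {ℓ q : ℕ} {A : Set (Sym2 V)} {cl : Sym2 V → ι}
    (hA : ∀ e ∈ A, ¬ e.IsDiag) (hg : Good ℓ q A cl) (X : Set (Sym2 V))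
    (hX : ¬ LongCyc ℓ (A \ X)) (Cs : Finset ι) (hCs : ∀ Q, Q ∈ Cs ↔ ∃ e ∈ A, cl e = Q) :
    ∑ Q ∈ Cs, {v | term cl A v ∧ inc cl A v Q}.ncard ≤ {v | term cl A v}.ncard + Cs.card + X.ncard := by
  have hF : ∀ Q, ∃ F ⊆ AQ cl A Q, EAc F ∧ {v | inc cl A v Q}.ncard ≤ F.ncard + 1 := by
    intro Q
    refine forest_span (AQ cl A Q) (fun e he => hA e he.1) _ ?_ ?_
    · intro v
      constructor
      · rintro ⟨e, h1, h2, h3⟩; exact ⟨e, ⟨h1, h3⟩, h2⟩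
      · rintro ⟨e, h1, h2⟩; exact ⟨e, h1.1, h2, h1.2⟩
    · exact fun u hu v hv => hg.a3 Q u v hu hv
  choose F hFs hFa hFc using hF
  let U : Finset (Sym2 V) := Cs.biUnion fun Q => (F Q).toFinset
  have hU : U.card = ∑ Q ∈ Cs, (F Q).ncard := by
    rw [Finset.card_biUnion]
    · refine Finset.sum_congr rfl fun Q _ => ?_
      rw [Set.ncard_eq_toFinset_card']
    · intro Q _ Q' _ hne
      rw [Function.onFun, Finset.disjoint_left]
      intro e he he'
      rw [Set.mem_toFinset] at he he'
      exact hne ((hFs Q he).2.symm.trans (hFs Q' he').2)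
  have hmemU : ∀ e, e ∈ U ↔ ∃ Q ∈ Cs, e ∈ F Q := by intro e; simp [U]
  have hUA : ∀ e ∈ U, e ∈ A := by
    intro e he
    obtain ⟨Q, _, h⟩ := (hmemU e).1 he
    exact (hFs Q h).1
  have hUF : ∀ e ∈ U, e ∈ F (cl e) := by
    intro e he
    obtain ⟨Q, _, h⟩ := (hmemU e).1 he
    rwa [(hFs Q h).2]
  have hac : EAc ((U : Set (Sym2 V)) \ X) := by
    intro v w hw he
    by_cases hm : ∃ e ∈ w.edges, ∃ f ∈ w.edges, cl e ≠ cl f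
    · refine hX ⟨v, w, hw, hg.a2 v w hw (fun e h => hUA e (he e h).1) hm, ?_⟩
      exact fun e h => ⟨hUA e (he e h).1, (he e h).2⟩
    · push Not at hm
      obtain ⟨e0, he0⟩ := w.edges.exists_mem_of_ne_nil (by simp [hw.not_nil])
      refine hFa (cl e0) v w hw ?_
      intro e h
      rw [hm e0 he0 e h]
      exact hUF e (he e h).1
  have h1 : ((U : Set (Sym2 V)) \ X).ncard ≤ {v | ∃ e ∈ A, v ∈ e}.ncard := by
    refine forest_le _ (fun e he => hA e (hUA e he.1)) _ ?_ hac
    exact fun e he v hv => ⟨e, hUA e he.1, hv⟩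
  have h2 : U.card ≤ ((U : Set (Sym2 V)) \ X).ncard + X.ncard := by
    rw [← Set.ncard_coe_finset]
    have := Set.ncard_le_ncard_sdiff_add_ncard (U : Set (Sym2 V)) X (Set.toFinite _)
    exact this
  have h3 : ∑ Q ∈ Cs, {v | inc cl A v Q}.ncard ≤ ∑ Q ∈ Cs, (F Q).ncard + Cs.card := by
    have := Finset.sum_le_sum (s := Cs) (fun Q _ => hFc Q)
    rw [Finset.sum_add_distrib] at this
    simpa using this
  have h4 : ∀ Q, {v | inc cl A v Q}.ncard = {v | term cl A v ∧ inc cl A v Q}.ncard +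
      {v | ¬ term cl A v ∧ inc cl A v Q}.ncard := by
    intro Q
    rw [← Set.ncard_union_eq ?_ (Set.toFinite _) (Set.toFinite _)]
    · congr 1; ext v; simp only [Set.mem_ofPred_eq, Set.mem_union]; tauto
    · rw [Set.disjoint_left]; exact fun v h h' => h'.1 h.1
  have h5 : {v | ¬ term cl A v ∧ ∃ e ∈ A, v ∈ e}.ncard ≤
      ∑ Q ∈ Cs, {v | ¬ term cl A v ∧ inc cl A v Q}.ncard := by
    have hsub : {v | ¬ term cl A v ∧ ∃ e ∈ A, v ∈ e} ⊆
        ((Cs.biUnion fun Q => {v | ¬ term cl A v ∧ inc cl A v Q}.toFinset : Finset V) : Set V) := by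
      rintro v ⟨hv, e, he, hve⟩
      simp only [Finset.coe_biUnion, Set.mem_iUnion]
      refine ⟨cl e, Finset.mem_coe.2 ((hCs _).2 ⟨e, he, rfl⟩), ?_⟩
      simp only [Set.coe_toFinset]
      exact ⟨hv, e, he, hve, rfl⟩
    refine (Set.ncard_le_ncard hsub (Set.toFinite _)).trans ?_
    rw [Set.ncard_coe_finset]
    refine Finset.card_biUnion_le.trans (le_of_eq ?_)
    refine Finset.sum_congr rfl fun Q _ => ?_
    rw [Set.ncard_eq_toFinset_card']
  have h6 : {v | ∃ e ∈ A, v ∈ e}.ncard ≤ {v | term cl A v}.ncard +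
      {v | ¬ term cl A v ∧ ∃ e ∈ A, v ∈ e}.ncard := by
    refine (Set.ncard_le_ncard ?_ (Set.toFinite _)).trans (Set.ncard_union_le _ _)
    intro v hv
    by_cases h : term cl A v
    · exact Or.inl h
    · exact Or.inr ⟨h, hv⟩
  have h7 : ∑ Q ∈ Cs, {v | inc cl A v Q}.ncard = ∑ Q ∈ Cs, {v | term cl A v ∧ inc cl A v Q}.ncard +
      ∑ Q ∈ Cs, {v | ¬ term cl A v ∧ inc cl A v Q}.ncard := by
    rw [← Finset.sum_add_distrib]
    exact Finset.sum_congr rfl fun Q _ => h4 Q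
  omega

theorem discharge (T : Finset V) (Cs : Finset ι) (r : V → ι → Prop) (x : ℕ)
    (hv : ∀ v ∈ T, 2 ≤ {Q ∈ Cs | r v Q}.card) (hQ : ∀ Q ∈ Cs, 2 ≤ {v ∈ T | r v Q}.card)
    (noM : ∀ v ∈ T, {Q ∈ Cs | r v Q}.card = 2 → ∃ Q ∈ Cs, r v Q ∧ {v ∈ T | r v Q}.card ≠ 2)
    (hI : ∑ Q ∈ Cs, {v ∈ T | r v Q}.card ≤ T.card + Cs.card + x) :
    T.card + Cs.card ≤ 11 * x := by
  set dv : V → ℕ := fun v => {Q ∈ Cs | r v Q}.card with hdv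
  set dQ : ι → ℕ := fun Q => {v ∈ T | r v Q}.card with hdQ
  let a : V → ι → ℕ := fun v Q =>
    if dv v = 2 then (if dQ Q = 2 then 10 else 14) else (if dQ Q = 2 then 8 else 11)
  have ha : ∀ v Q, a v Q ≤ 22 := by
    intro v Q; simp only [a]; split_ifs <;> omega
  have h1 : ∀ v ∈ T, 24 ≤ ∑ Q ∈ Cs with r v Q, a v Q := by
    intro v hvT
    by_cases h2 : dv v = 2
    · obtain ⟨Q, hQC, hr, hne⟩ := noM v hvT h2
      have hmem : Q ∈ Cs.filter (fun Q => r v Q) := by simp [hQC, hr]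
      rw [← Finset.add_sum_erase _ _ hmem]
      have hc : ((Cs.filter (fun Q => r v Q)).erase Q).card = 1 := by
        rw [Finset.card_erase_of_mem hmem]
        show dv v - 1 = 1
        omega
      have h3 : ((Cs.filter (fun Q => r v Q)).erase Q).card • 10 ≤
          ∑ Q ∈ (Cs.filter (fun Q => r v Q)).erase Q, a v Q := by
        refine Finset.card_nsmul_le_sum _ _ _ ?_
        intro Q' _
        simp only [a, if_pos h2]; split_ifs <;> omega
      have h4 : a v Q = 14 := by
        simp only [a, if_pos h2]; rw [if_neg hne]
      rw [hc] at h3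
      simp at h3
      omega
    · have h3 : (Cs.filter (fun Q => r v Q)).card • 8 ≤
          ∑ Q ∈ (Cs.filter (fun Q => r v Q)), a v Q := by
        refine Finset.card_nsmul_le_sum _ _ _ ?_
        intro Q' _
        simp only [a, if_neg h2]; split_ifs <;> omega
      have h4 := hv v hvT
      have h5 : 3 ≤ (Cs.filter (fun Q => r v Q)).card := by
        have : (Cs.filter (fun Q => r v Q)).card ≠ 2 := h2
        omega
      simp only [smul_eq_mul] at h3
      omega
  have h2 : ∀ Q ∈ Cs, 24 ≤ ∑ v ∈ T with r v Q, (22 - a v Q) := by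
    intro Q hQC
    by_cases h2 : dQ Q = 2
    · have h3 : (T.filter (fun v => r v Q)).card • 12 ≤
          ∑ v ∈ (T.filter (fun v => r v Q)), (22 - a v Q) := by
        refine Finset.card_nsmul_le_sum _ _ _ ?_
        intro Q' _
        simp only [a, if_pos h2]; split_ifs <;> omega
      have : (T.filter (fun v => r v Q)).card = 2 := h2
      simp only [smul_eq_mul] at h3
      omega
    · have h3 : (T.filter (fun v => r v Q)).card • 8 ≤
          ∑ v ∈ (T.filter (fun v => r v Q)), (22 - a v Q) := by
        refine Finset.card_nsmul_le_sum _ _ _ ?_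
        intro Q' _
        simp only [a, if_neg h2]; split_ifs <;> omega
      have h4 := hQ Q hQC
      have : (T.filter (fun v => r v Q)).card ≠ 2 := h2
      simp only [smul_eq_mul] at h3
      omega
  have s1 : 24 * T.card ≤ ∑ v ∈ T, ∑ Q ∈ Cs with r v Q, a v Q := by
    have := Finset.card_nsmul_le_sum T _ 24 h1
    simp only [smul_eq_mul] at this; omega
  have s2 : 24 * Cs.card ≤ ∑ Q ∈ Cs, ∑ v ∈ T with r v Q, (22 - a v Q) := by
    have := Finset.card_nsmul_le_sum Cs _ 24 h2
    simp only [smul_eq_mul] at this; omega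
  have s3 : ∑ v ∈ T, ∑ Q ∈ Cs with r v Q, a v Q = ∑ Q ∈ Cs, ∑ v ∈ T with r v Q, a v Q := by
    simp only [Finset.sum_filter]
    exact Finset.sum_comm
  have s4 : ∑ Q ∈ Cs, ∑ v ∈ T with r v Q, a v Q + ∑ Q ∈ Cs, ∑ v ∈ T with r v Q, (22 - a v Q)
      = 22 * ∑ Q ∈ Cs, {v ∈ T | r v Q}.card := by
    rw [← Finset.sum_add_distrib, Finset.mul_sum]
    refine Finset.sum_congr rfl fun Q _ => ?_
    rw [← Finset.sum_add_distrib]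
    rw [Finset.sum_congr rfl (g := fun _ => 22)]
    · simp [mul_comm]
    · intro v _
      have := ha v Q
      omega
  have hI' : ∑ Q ∈ Cs, {v ∈ T | r v Q}.card ≤ T.card + Cs.card + x := hI
  omega

end forest
end EP
namespace EP
open Classical SimpleGraph

section switch
variable {V : Type*} {ι : Type*} {cl : Sym2 V → ι} {A : Set (Sym2 V)} {ℓ q : ℕ}

def JG (cl : Sym2 V → ι) (A : Set (Sym2 V)) : SimpleGraph (V ⊕ ι) where
  Adj x y := ∃ v Q, term cl A v ∧ inc cl A v Q ∧
    ((x = Sum.inl v ∧ y = Sum.inr Q) ∨ (x = Sum.inr Q ∧ y = Sum.inl v))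
  symm := ⟨by
    rintro x y ⟨v, Q, h1, h2, h3⟩
    exact ⟨v, Q, h1, h2, by tauto⟩⟩
  loopless := ⟨by
    rintro x ⟨v, Q, h1, h2, h | h⟩
    · exact absurd (h.1.symm.trans h.2) (by simp)
    · exact absurd (h.1.symm.trans h.2) (by simp)⟩

theorem JG_left {v : V} {y : V ⊕ ι} : (JG cl A).Adj (Sum.inl v) y ↔
    ∃ Q, y = Sum.inr Q ∧ term cl A v ∧ inc cl A v Q := by
  constructor
  · rintro ⟨v', Q, h1, h2, h | h⟩
    · have : v = v' := by simpa using h.1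
      subst this
      exact ⟨Q, h.2, h1, h2⟩
    · simp at h
  · rintro ⟨Q, h, h1, h2⟩
    exact ⟨v, Q, h1, h2, Or.inl ⟨rfl, h⟩⟩

theorem JG_right {Q : ι} {y : V ⊕ ι} : (JG cl A).Adj (Sum.inr Q) y ↔
    ∃ v, y = Sum.inl v ∧ term cl A v ∧ inc cl A v Q := by
  constructor
  · rintro ⟨v, Q', h1, h2, h | h⟩
    · simp at h
    · have : Q = Q' := by simpa using h.1
      subst this
      exact ⟨v, h.2, h1, h2⟩
  · rintro ⟨v, h, h1, h2⟩
    exact ⟨v, Q, h1, h2, Or.inr ⟨rfl, h⟩⟩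

structure Sw (cl : Sym2 V → ι) (A E : Set (Sym2 V)) (n : ℕ) : Prop where
  sub : E ⊆ A
  sw : ∀ Y : Set (Sym2 V), ∃ D ⊆ E, D.ncard ≤ n ∧
    ∀ Q s t, term cl A s → term cl A t → inc cl A s Q → inc cl A t Q →
        Cn ((AQ cl A Q \ Y) \ D) s t → Cn ((AQ cl A Q \ E) \ Y) s t

theorem Sw.empty : Sw cl A ∅ 0 :=
  ⟨Set.empty_subset _, fun Y => ⟨∅, le_rfl, by simp, fun Q s t _ _ _ _ h => by simpa using h⟩⟩

theorem Sw.single (hg : Good ℓ q A cl) {Q : ι} {u v : V} (huv : u ≠ v) (hu : term cl A u)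
    (hv : term cl A v) (hu' : inc cl A u Q) (hv' : inc cl A v Q) :
    ∃ P ⊆ AQ cl A Q, Cn P u v ∧ Sw cl A P q := by
  obtain ⟨P, hP, hc, hY⟩ := hg.b Q u v huv hu hv hu' hv'
  refine ⟨P, hP, hc, fun e he => (hP he).1, fun Y => ?_⟩
  obtain ⟨D, hD, hDq, h⟩ := hY Y
  refine ⟨D, hD, hDq, fun R s t hs ht hs' ht' hst => ?_⟩
  by_cases hR : R = Q
  · subst hR; exact h s t hs ht hs' ht' hst
  · refine hst.mono ?_
    rintro e ⟨⟨h1, h2⟩, h3⟩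
    exact ⟨⟨h1, fun heP => hR (h1.2.symm.trans (hP heP).2)⟩, h2⟩

theorem Sw.union {E1 E2 : Set (Sym2 V)} {n1 n2 : ℕ} (h1 : Sw cl A E1 n1) (h2 : Sw cl A E2 n2)
    (hd : ∀ e ∈ E1, ∀ f ∈ E2, cl e ≠ cl f) : Sw cl A (E1 ∪ E2) (n1 + n2) := by
  refine ⟨Set.union_subset h1.sub h2.sub, fun Y => ?_⟩
  obtain ⟨D1, hD1, hn1, hh1⟩ := h1.sw Y
  obtain ⟨D2, hD2, hn2, hh2⟩ := h2.sw Y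
  refine ⟨D1 ∪ D2, Set.union_subset_union hD1 hD2,
    (Set.ncard_union_le _ _).trans (by omega), fun Q s t hs ht hs' ht' h => ?_⟩
  by_cases hQ : ∃ e ∈ E1, cl e = Q
  · obtain ⟨e0, he0, rfl⟩ := hQ
    have := hh1 _ s t hs ht hs' ht' (h.mono fun e he => by
      exact ⟨he.1, fun h => he.2 (Or.inl h)⟩)
    refine this.mono ?_
    rintro e ⟨⟨a1, a2⟩, a3⟩
    exact ⟨⟨a1, fun h => h.elim a2 fun h => hd e0 he0 e h a1.2.symm⟩, a3⟩
  · have := hh2 _ s t hs ht hs' ht' (h.mono fun e he => by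
      exact ⟨he.1, fun h => he.2 (Or.inr h)⟩)
    refine this.mono ?_
    rintro e ⟨⟨a1, a2⟩, a3⟩
    exact ⟨⟨a1, fun h => h.elim (fun h => hQ ⟨e, h, a1.2⟩) a2⟩, a3⟩

theorem sw_path (hg : Good ℓ q A cl) (N : ℕ) : ∀ {s t : V}
    (p : (JG cl A).Walk (Sum.inl s) (Sum.inl t)), p.IsPath → p.length ≤ N →
    ∃ n E, p.length = 2 * n ∧ Sw cl A E (q * n) ∧ Cn E s t ∧ ∀ e ∈ E, Sum.inr (cl e) ∈ p.support := by
  induction N using Nat.strong_induction_on with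
  | _ N ih =>
  intro s t p hp hN
  generalize hx : (Sum.inl s : V ⊕ ι) = x at p
  cases p with
  | nil =>
    have : s = t := by simpa using hx
    subst this
    exact ⟨0, ∅, by simp, Sw.empty, Cn.refl _ _, by simp⟩
  | cons h p =>
    subst hx
    obtain ⟨Q, rfl, hs, hsQ⟩ := JG_left.1 h
    cases p with
    | cons h' p =>
      obtain ⟨u, rfl, hu, huQ⟩ := JG_right.1 h'
      rw [Walk.cons_isPath_iff, Walk.cons_isPath_iff] at hp
      obtain ⟨⟨hp, hQ⟩, hsp⟩ := hp
      have hsu : s ≠ u := by rintro rfl; exact hsp (by simp)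
      simp only [Walk.length_cons] at hN
      obtain ⟨n, E, hn, hE, hc, hcl⟩ := ih (N - 1) (by omega) p hp (by omega)
      obtain ⟨P, hP, hPc, hPs⟩ := Sw.single hg hsu hs hu hsQ huQ
      refine ⟨n + 1, P ∪ E, by simp; omega, ?_, ?_, ?_⟩
      · rw [Nat.mul_succ, Nat.add_comm]
        refine hPs.union hE fun e he f hf hef => hQ ?_
        rw [← (hP he).2, hef]
        exact hcl f hf
      · exact (hPc.mono Set.subset_union_left).trans (hc.mono Set.subset_union_right)
      · rintro e (he | he)
        · rw [(hP he).2]; simp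
        · simp [hcl e he]

theorem sw_cycle (hg : Good ℓ q A cl) {M : ℕ} {x : V ⊕ ι} (c : (JG cl A).Walk x x) (hc : c.IsCycle)
    (hM : c.length ≤ 2 * M) : ∃ E n, n ≤ q * M ∧ Sw cl A E n ∧ HasCyc cl E := by
  have main : ∀ (s : V) (c : (JG cl A).Walk (Sum.inl s) (Sum.inl s)), c.IsCycle →
      c.length ≤ 2 * M → ∃ E n, n ≤ q * M ∧ Sw cl A E n ∧ HasCyc cl E := by
    intro s c hc hM
    cases c with
    | nil => simp at hc
    | cons h p =>
      obtain ⟨Q, rfl, hs, hsQ⟩ := JG_left.1 h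
      rw [Walk.cons_isCycle_iff] at hc
      obtain ⟨hp, hnd⟩ := hc
      cases p with
      | cons h' p =>
        obtain ⟨t, rfl, ht, htQ⟩ := JG_right.1 h'
        rw [Walk.cons_isPath_iff] at hp
        obtain ⟨hp, hQ⟩ := hp
        have hst : t ≠ s := by
          rintro rfl
          exact hnd (by simp [Sym2.eq_swap])
        simp only [Walk.length_cons] at hM
        obtain ⟨n, E, hn, hE, hcE, hcl⟩ := sw_path hg _ p hp le_rfl
        obtain ⟨P, hP, hPc, hPs⟩ := Sw.single hg hst ht hs htQ hsQ
        refine ⟨P ∪ E, q + q * n, ?_, ?_, ?_⟩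
        · calc q + q * n = q * (n + 1) := by ring
            _ ≤ q * M := Nat.mul_le_mul_left _ (by omega)
        · refine hPs.union hE fun e he f hf hef => hQ ?_
          rw [← (hP he).2, hef]
          exact hcl f hf
        · refine ⟨Q, t, s, hst, hPc.mono ?_, hcE.mono ?_⟩
          · exact fun e he => ⟨Or.inl he, (hP he).2⟩
          · refine fun e he => ⟨Or.inr he, fun hk => hQ ?_⟩
            rw [← hk.1]; exact hcl e he
  cases x with
  | inl s => exact main s c hc hM
  | inr Q =>
    have hadj := c.adj_snd hc.not_nil
    obtain ⟨s, hs, -, -⟩ := JG_right.1 hadj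
    have hmem : (Sum.inl s : V ⊕ ι) ∈ c.support := by
      rw [← hs]; exact c.getVert_mem_support 1
    refine main s (c.rotate _ hmem) (hc.rotate hmem) ?_
    rw [Walk.length_rotate]; exact hM

theorem remove_cycle [Finite V] (hg : Good ℓ q A cl) {m n : ℕ} (hm : TauGe ℓ A m)
    {E : Set (Sym2 V)} (hE : Sw cl A E n) (hcyc : HasCyc cl E) :
    ∃ (v : V) (w : (⊤ : SimpleGraph V).Walk v v), w.IsCycle ∧ ℓ ≤ w.length ∧
      (∀ e ∈ w.edges, e ∈ A) ∧ TauGe ℓ (A \ {e | e ∈ w.edges}) (m - n) := by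
  obtain ⟨v, w, hw, hwE, hne⟩ := L2 hcyc
  have hwA : ∀ e ∈ w.edges, e ∈ A := fun e he => hE.sub (hwE e he)
  refine ⟨v, w, hw, hg.a2 v w hw hwA hne, hwA, fun Y hY => ?_⟩
  obtain ⟨D, hD, hDn, hsw⟩ := hE.sw Y
  have key : ¬ LongCyc ℓ (A \ (Y ∪ D)) := by
    rintro ⟨x, c, hc, hcl, hcA⟩
    have hmix : ∃ e ∈ c.edges, ∃ f ∈ c.edges, cl e ≠ cl f := by
      by_contra hcon
      push Not at hcon
      obtain ⟨e0, he0⟩ := c.edges.exists_mem_of_ne_nil (by simp [hc.not_nil])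
      exact hg.a1 (cl e0) ⟨x, c, hc, hcl, fun e he => ⟨(hcA e he).1, (hcon e0 he0 e he).symm⟩⟩
    have h1 : HasCyc cl (A \ (Y ∪ D)) := L1 c hc hcA hmix
    have h2 : HasCyc cl ((A \ E) \ Y) := by
      refine L3 (A := A) ?_ Set.sdiff_subset ?_ h1
      · rintro e ⟨⟨h1, h2⟩, h3⟩
        exact ⟨h1, fun h => h.elim h3 fun h => h2 (hD h)⟩
      · intro Q a b ha hb ha' hb' hab
        refine (hsw Q a b ha hb ha' hb' (hab.mono ?_)).mono ?_
        · rintro e ⟨⟨h1, h2⟩, h3⟩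
          exact ⟨⟨⟨h1, h3⟩, fun h => h2 (Or.inl h)⟩, fun h => h2 (Or.inr h)⟩
        · rintro e ⟨⟨⟨h1, h2⟩, h3⟩, h4⟩
          exact ⟨⟨⟨h1, h3⟩, h4⟩, h2⟩
    obtain ⟨x', c', hc', hcA', hmix'⟩ := L2 h2
    refine hY ⟨x', c', hc', hg.a2 x' c' hc' (fun e he => (hcA' e he).1.1) hmix', ?_⟩
    intro e he
    exact ⟨⟨(hcA' e he).1.1, fun h => (hcA' e he).1.2 (hwE e h)⟩, (hcA' e he).2⟩
  have h1 := hm _ key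
  have h2 := Set.ncard_union_le Y D
  omega

end switch
end EP
namespace EP
open Classical SimpleGraph

section short
variable {V : Type*} {ι : Type*} {cl : Sym2 V → ι} {A : Set (Sym2 V)} {ℓ q : ℕ}

theorem long_has (hg : Good ℓ q A cl) {B : Set (Sym2 V)} (hB : B ⊆ A) (h : LongCyc ℓ B) :
    HasCyc cl B := by
  obtain ⟨x, c, hc, hcl, hcA⟩ := h
  refine L1 c hc hcA ?_
  by_contra hcon
  push Not at hcon
  obtain ⟨e0, he0⟩ := c.edges.exists_mem_of_ne_nil (by simp [hc.not_nil])
  exact hg.a1 (cl e0) ⟨x, c, hc, hcl, fun e he => ⟨hB (hcA e he), (hcon e0 he0 e he).symm⟩⟩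

theorem has_long (hg : Good ℓ q A cl) {B : Set (Sym2 V)} (hB : B ⊆ A) (h : HasCyc cl B) :
    LongCyc ℓ B := by
  obtain ⟨x, c, hc, hcA, hmix⟩ := L2 h
  exact ⟨x, c, hc, hg.a2 x c hc (fun e he => hB (hcA e he)) hmix, hcA⟩

theorem two_terms (hg : Good ℓ q A cl) {m : ℕ} (hm : TauGe ℓ A m)
    (hmin : ∀ e ∈ A, ¬ TauGe ℓ (A \ {e}) m) {Q : ι} (hQ : ∃ e ∈ A, cl e = Q) :
    ∃ a b, a ≠ b ∧ term cl A a ∧ inc cl A a Q ∧ term cl A b ∧ inc cl A b Q := by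
  by_contra hcon
  push Not at hcon
  obtain ⟨e, he, rfl⟩ := hQ
  have h := hmin e he
  unfold TauGe at h
  push Not at h
  obtain ⟨Y, hY, hYm⟩ := h
  have h1 : LongCyc ℓ (A \ Y) := by
    by_contra h
    have := hm Y h
    omega
  have h2 := long_has hg Set.sdiff_subset h1
  refine hY (has_long hg (fun f hf => hf.1.1) (L3 (A := A) ?_ Set.sdiff_subset ?_ h2))
  · exact fun f hf => ⟨hf.1.1, hf.2⟩
  · intro R a b ha hb ha' hb' hab
    by_cases hR : R = cl e
    · subst hR
      by_cases hne : a = b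
      · subst hne; exact Cn.refl _ _
      · exact absurd hb' (hcon a b hne ha ha' hb)
    · refine hab.mono ?_
      rintro f ⟨h1, h2⟩
      refine ⟨⟨⟨h1.1, ?_⟩, h1.2⟩, h2⟩
      rintro rfl
      exact hR h2.symm

theorem nb {W : Type*} {J : SimpleGraph W}
    (h2 : ∀ x y, J.Adj x y → ∀ y', ∃ w, w ≠ y' ∧ J.Adj x w) {z a : W} (hz : ¬ Br J z)
    (ha : J.Adj z a) : ∃ b, b ≠ a ∧ J.Adj z b ∧ ∀ x, J.Adj z x → x = a ∨ x = b := by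
  unfold Br at hz
  push Not at hz
  obtain ⟨y, hy⟩ := hz
  obtain ⟨b, hba, hb⟩ := h2 z a ha a
  refine ⟨b, hba, hb, fun x hx => ?_⟩
  by_contra hcon
  push Not at hcon
  by_cases hay : a = y
  · subst hay
    exact hy x b hcon.2 hcon.1 hba hx hb
  · by_cases hby : b = y
    · subst hby
      exact hy x a hcon.1 hcon.2 hay hx ha
    · exact hy a b hba.symm hay hby ha hb

theorem JG_lr {v : V} {Q : ι} : (JG cl A).Adj (Sum.inl v) (Sum.inr Q) ↔
    term cl A v ∧ inc cl A v Q := by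
  rw [JG_left]
  constructor
  · rintro ⟨Q', h, h1, h2⟩
    have : Q = Q' := by simpa using h
    subst this; exact ⟨h1, h2⟩
  · rintro ⟨h1, h2⟩; exact ⟨Q, rfl, h1, h2⟩

theorem short_cycle [Fintype V] [Finite ι] (hA : ∀ e ∈ A, ¬ e.IsDiag) (hg : Good ℓ q A cl) {m : ℕ}
    (hm1 : 1 ≤ m) (hm : TauGe ℓ A m) (hmin : ∀ e ∈ A, ¬ TauGe ℓ (A \ {e}) m)
    (hnoM : ∀ v c c' Q Q', ¬ Mergeable cl A v c c' Q Q') {h R : ℕ} (hR : 11 * m < 2 ^ R)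
    (hh : h = 4 ∨ (h = 2 ∧ ℓ = 2)) :
    ∃ x, ∃ c : (JG cl A).Walk x x, c.IsCycle ∧ c.length ≤ 2 * (h * R + 1) := by
  by_contra hcon
  push Not at hcon
  have hR1 : 1 ≤ h * R := by
    have : R ≠ 0 := by rintro rfl; simp at hR; omega
    have : 1 ≤ R := by omega
    rcases hh with rfl | ⟨rfl, -⟩ <;> omega
  have htt : ∀ Q, (∃ e ∈ A, cl e = Q) → ∃ a b, a ≠ b ∧ term cl A a ∧ inc cl A a Q ∧
    term cl A b ∧ inc cl A b Q := fun Q hQ => two_terms hg hm hmin hQ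
  have hAne : ∃ e, e ∈ A := by
    by_contra h
    push Not at h
    have := hm ∅ (by
      rintro ⟨v, w, hw, -, hwA⟩
      obtain ⟨e0, he0⟩ := w.edges.exists_mem_of_ne_nil (by simp [hw.not_nil])
      exact h e0 (hwA e0 he0).1)
    simp at this
    omega
  obtain ⟨X, hX, hXm⟩ : ∃ X, ¬ LongCyc ℓ (A \ X) ∧ X.ncard ≤ m := by
    obtain ⟨e, he⟩ := hAne
    have h := hmin e he
    unfold TauGe at h
    push Not at h
    obtain ⟨Y, hY, hYm⟩ := h
    refine ⟨insert e Y, fun hl => hY (hl.mono ?_), (Set.ncard_insert_le _ _).trans hYm⟩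
    rintro f ⟨h1, h2⟩
    exact ⟨⟨h1, fun h => h2 (Or.inl h)⟩, fun h => h2 (Or.inr h)⟩
  have h2 : ∀ x y, (JG cl A).Adj x y → ∀ y', ∃ w, w ≠ y' ∧ (JG cl A).Adj x w := by
    intro x y hxy y'
    cases x with
    | inl v =>
      obtain ⟨Q, -, ht, -⟩ := JG_left.1 hxy
      obtain ⟨Q1, Q2, hne, i1, i2⟩ := id ht
      by_cases h : (Sum.inr Q1 : V ⊕ ι) = y'
      · exact ⟨Sum.inr Q2, by rw [← h]; simpa using hne.symm, JG_lr.2 ⟨ht, i2⟩⟩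
      · exact ⟨Sum.inr Q1, h, JG_lr.2 ⟨ht, i1⟩⟩
    | inr Q =>
      obtain ⟨v, -, ht, hi⟩ := JG_right.1 hxy
      obtain ⟨e, he, -, heQ⟩ := hi
      obtain ⟨a, b, hab, ta, ia, tb, ib⟩ := htt Q ⟨e, he, heQ⟩
      by_cases h : (Sum.inl a : V ⊕ ι) = y'
      · exact ⟨Sum.inl b, by rw [← h]; simpa using hab.symm, (JG_lr.2 ⟨tb, ib⟩).symm⟩
      · exact ⟨Sum.inl a, h, (JG_lr.2 ⟨ta, ia⟩).symm⟩
  have noM' : ∀ v Q Q', Q ≠ Q' → (JG cl A).Adj (Sum.inl v) (Sum.inr Q) →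
      (JG cl A).Adj (Sum.inl v) (Sum.inr Q') →
      (∀ x, (JG cl A).Adj (Sum.inl v) x → x = Sum.inr Q ∨ x = Sum.inr Q') →
      ¬ Br (JG cl A) (Sum.inr Q) → ¬ Br (JG cl A) (Sum.inr Q') → False := by
    intro v Q Q' hne a1 a2 honly b1 b2
    obtain ⟨y1, hy1, ay1, only1⟩ := nb h2 b1 a1.symm
    obtain ⟨y2, hy2, ay2, only2⟩ := nb h2 b2 a2.symm
    obtain ⟨c, rfl, tc, ic⟩ := JG_right.1 ay1
    obtain ⟨c', rfl, tc', ic'⟩ := JG_right.1 ay2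
    have hcv : c ≠ v := by simpa using hy1
    have hcv' : c' ≠ v := by simpa using hy2
    have hcc : c ≠ c' := by
      rintro rfl
      have hcyc : (Walk.cons a1 (Walk.cons ay1 (Walk.cons ay2.symm (Walk.cons a2.symm Walk.nil)))).IsCycle := by
        rw [Walk.cons_isCycle_iff]
        constructor
        · simp [Walk.cons_isPath_iff, hne, hcv, hne.symm]
        · simp [hne, hcv, hcv.symm]
      have := hcon _ _ hcyc
      simp at this
      omega
    refine hnoM v c c' Q Q' ⟨hne, (JG_lr.1 a1).2, (JG_lr.1 a2).2, ?_, hcv, hcv', hcc, tc, tc', ic, ic',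
      ?_, ?_⟩
    · intro S hS
      have := honly (Sum.inr S) (JG_lr.2 ⟨(JG_lr.1 a1).1, hS⟩)
      simpa using this
    · intro x hx hx'
      have := only1 (Sum.inl x) (JG_lr.2 ⟨hx, hx'⟩).symm
      simp at this; tauto
    · intro x hx hx'
      have := only2 (Sum.inl x) (JG_lr.2 ⟨hx, hx'⟩).symm
      simp at this; tauto
  -- three consecutive vertices
  have tri : ∀ v Q Q', Q ≠ Q' → (JG cl A).Adj (Sum.inl v) (Sum.inr Q) →
      (JG cl A).Adj (Sum.inl v) (Sum.inr Q') → ¬ Br (JG cl A) (Sum.inl v) →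
      ¬ Br (JG cl A) (Sum.inr Q) → ¬ Br (JG cl A) (Sum.inr Q') → False := by
    intro v Q Q' hne a1 a2 b0 b1 b2
    refine noM' v Q Q' hne a1 a2 ?_ b1 b2
    obtain ⟨b, hb, ab, honly⟩ := nb h2 b0 a1
    have : b = Sum.inr Q' := by
      rcases honly _ a2 with h | h
      · exact absurd (by simpa using h.symm) hne
      · exact h.symm
    subst this
    exact honly
  have nobr2 : ℓ = 2 → ∀ Q, ¬ Br (JG cl A) (Sum.inr Q) ∨ ¬ ∃ y, (JG cl A).Adj (Sum.inr Q) y := by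
    intro hl Q
    by_contra hc
    push Not at hc
    obtain ⟨hB, y, hy⟩ := hc
    obtain ⟨a, b, hab, ha, hb, h1, h3⟩ := hB y
    obtain ⟨v, rfl, tv, iv⟩ := JG_right.1 hy
    obtain ⟨a, rfl, ta, ia⟩ := JG_right.1 h1
    obtain ⟨b, rfl, tb, ib⟩ := JG_right.1 h3
    rcases hg.d hl Q v a b tv ta tb iv ia ib with h | h | h
    · exact ha (by rw [h])
    · exact hab (by rw [h])
    · exact hb (by rw [h])
  have hbr : ∀ x y (p : (JG cl A).Walk x y), p.IsPath → p.length + 1 = h →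
      ∃ z ∈ p.support, Br (JG cl A) z := by
    intro x y p hp hl
    by_contra hcb
    push Not at hcb
    rcases hh with rfl | ⟨rfl, hl2⟩
    · obtain ⟨x1, a1, p, rfl⟩ := Walk.exists_eq_cons_of_ne (by
        rintro rfl; rw [Walk.isPath_iff_eq_nil] at hp; simp [hp] at hl) p
      cases p with
      | nil => simp at hl
      | @cons _ x2 _ a2 p =>
      cases p with
      | nil => simp at hl
      | @cons _ x3 _ a3 p =>
      simp only [Walk.cons_isPath_iff, Walk.support_cons, List.mem_cons, not_or] at hp hcb
      have hx3 := p.start_mem_support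
      cases x with
      | inl v0 =>
        obtain ⟨Q, rfl, -, -⟩ := JG_left.1 a1
        obtain ⟨v, rfl, -, -⟩ := JG_right.1 a2
        obtain ⟨Q', rfl, -, -⟩ := JG_left.1 a3
        refine tri v Q Q' ?_ a2.symm a3 (hcb _ (by simp)) (hcb _ (by simp)) (hcb _ (by simp))
        rintro rfl
        exact hp.1.2.2 hx3
      | inr Q =>
        obtain ⟨v, rfl, -, -⟩ := JG_right.1 a1
        obtain ⟨Q', rfl, -, -⟩ := JG_left.1 a2
        refine tri v Q Q' ?_ a1.symm a2 (hcb _ (by simp)) (hcb _ (by simp)) (hcb _ (by simp))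
        rintro rfl
        exact hp.2.2.1 rfl
    · have fin : ∀ v y, (JG cl A).Adj (Sum.inl v) y → ¬ Br (JG cl A) (Sum.inl v) → False := by
        intro v y hvy hB
        obtain ⟨b, hb, ab, -⟩ := nb h2 hB hvy
        obtain ⟨Q, rfl, -, -⟩ := JG_left.1 hvy
        obtain ⟨Q', rfl, -, -⟩ := JG_left.1 ab
        refine tri v Q Q' (by rintro rfl; exact hb rfl) hvy ab hB ?_ ?_
        · exact (nobr2 hl2 Q).resolve_right fun h => h ⟨_, hvy.symm⟩
        · exact (nobr2 hl2 Q').resolve_right fun h => h ⟨_, ab.symm⟩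
      cases p with
      | nil => simp at hl
      | cons a1 p =>
      cases x with
      | inl v => exact fin v _ a1 (hcb _ (by simp))
      | inr Q =>
        obtain ⟨v, rfl, -, -⟩ := JG_right.1 a1
        exact fin v _ a1.symm (hcb _ (by simp))
  have hne : ∃ x y, (JG cl A).Adj x y := by
    obtain ⟨e, he⟩ := hAne
    obtain ⟨a, b, hab, ta, ia, tb, ib⟩ := htt (cl e) ⟨e, he, rfl⟩
    exact ⟨_, _, JG_lr.2 ⟨ta, ia⟩⟩
  have hmoore := moore (h := h) (R := R) (by rcases hh with rfl | ⟨rfl, -⟩ <;> omega) hcon h2 hbr hne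
  -- counting
  have : Fintype ι := Fintype.ofFinite ι
  let T : Finset V := Finset.univ.filter fun v => term cl A v
  let Cs : Finset ι := Finset.univ.filter fun Q => ∃ e ∈ A, cl e = Q
  have hcount := count hA hg X hX Cs (by intro Q; simp [Cs])
  have hTc : {v | term cl A v}.ncard = T.card := by
    rw [← Set.ncard_coe_finset]; congr 1; ext v; simp [T]
  have hQc : ∀ Q, {v | term cl A v ∧ inc cl A v Q}.ncard = {v ∈ T | inc cl A v Q}.card := by
    intro Q
    rw [← Set.ncard_coe_finset]; congr 1; ext v; simp [T]
  rw [hTc, Finset.sum_congr rfl (fun Q _ => hQc Q)] at hcount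
  have hCmem : ∀ {v Q}, inc cl A v Q → Q ∈ Cs := by
    rintro v Q ⟨e, he, -, hQ⟩; simp only [Cs, Finset.mem_filter, Finset.mem_univ, true_and]
    exact ⟨e, he, hQ⟩
  have hTmem : ∀ {v}, v ∈ T ↔ term cl A v := by intro v; simp [T]
  have hdis := discharge T Cs (inc cl A) X.ncard (by
      intro v hv
      obtain ⟨Q1, Q2, hne, i1, i2⟩ := hTmem.1 hv
      refine Finset.one_lt_card.2 ⟨Q1, ?_, Q2, ?_, hne⟩
      · exact Finset.mem_filter.2 ⟨hCmem i1, i1⟩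
      · exact Finset.mem_filter.2 ⟨hCmem i2, i2⟩) (by
      intro Q hQ
      obtain ⟨a, b, hab, ta, ia, tb, ib⟩ := htt Q (by simpa [Cs] using hQ)
      refine Finset.one_lt_card.2 ⟨a, ?_, b, ?_, hab⟩
      · exact Finset.mem_filter.2 ⟨hTmem.2 ta, ia⟩
      · exact Finset.mem_filter.2 ⟨hTmem.2 tb, ib⟩) (by
      intro v hv h2v
      by_contra hall
      push Not at hall
      obtain ⟨Q, Q', hne, heq⟩ := Finset.card_eq_two.1 h2v
      have hmem : ∀ S, inc cl A v S ↔ S = Q ∨ S = Q' := by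
        intro S
        have : S ∈ ({Q, Q'} : Finset ι) ↔ inc cl A v S := by
          rw [← heq, Finset.mem_filter]
          exact ⟨fun h => h.2, fun h => ⟨hCmem h, h⟩⟩
        rw [← this]; simp
      have tv := hTmem.1 hv
      have nB : ∀ S, inc cl A v S → ¬ Br (JG cl A) (Sum.inr S) := by
        intro S hS hB
        have h2S := hall S (hCmem hS) hS
        obtain ⟨a, b, hab, ha, hb, h1, h3⟩ := hB (Sum.inl v)
        obtain ⟨a, rfl, ta, ia⟩ := JG_right.1 h1
        obtain ⟨b, rfl, tb, ib⟩ := JG_right.1 h3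
        have : 2 < {v ∈ T | inc cl A v S}.card := by
          refine Finset.two_lt_card.2 ⟨v, ?_, a, ?_, b, ?_, ?_, ?_, ?_⟩
          · exact Finset.mem_filter.2 ⟨hv, hS⟩
          · exact Finset.mem_filter.2 ⟨hTmem.2 ta, ia⟩
          · exact Finset.mem_filter.2 ⟨hTmem.2 tb, ib⟩
          · rintro rfl; exact ha rfl
          · rintro rfl; exact hb rfl
          · rintro rfl; exact hab rfl
        omega
      refine noM' v Q Q' hne (JG_lr.2 ⟨tv, (hmem Q).2 (Or.inl rfl)⟩)
        (JG_lr.2 ⟨tv, (hmem Q').2 (Or.inr rfl)⟩) ?_ (nB Q ((hmem Q).2 (Or.inl rfl)))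
        (nB Q' ((hmem Q').2 (Or.inr rfl)))
      intro x hx
      obtain ⟨S, rfl, -, hS⟩ := JG_left.1 hx
      simpa using (hmem S).1 hS) hcount
  have hN : {x | ∃ y, (JG cl A).Adj x y}.ncard ≤ T.card + Cs.card := by
    rw [← Finset.card_disjSum, ← Set.ncard_coe_finset]
    refine Set.ncard_le_ncard ?_ (Set.toFinite _)
    rintro x ⟨y, hxy⟩
    rw [Finset.mem_coe]
    cases x with
    | inl v =>
      obtain ⟨Q, -, ht, hi⟩ := JG_left.1 hxy
      exact Finset.inl_mem_disjSum.2 (hTmem.2 ht)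
    | inr Q =>
      obtain ⟨v, -, ht, hi⟩ := JG_right.1 hxy
      exact Finset.inr_mem_disjSum.2 (hCmem hi)
  omega

end short
end EP
namespace EP
open Classical SimpleGraph

section final
variable {V : Type*} {A : Set (Sym2 V)} {ℓ : ℕ}

theorem step [Fintype V] (hA : ∀ e ∈ A, ¬ e.IsDiag) (hℓ : 2 ≤ ℓ) {m : ℕ}
    (hm1 : 1 ≤ m) (hm : TauGe ℓ A m) (hmin : ∀ e ∈ A, ¬ TauGe ℓ (A \ {e}) m)
    {L R : ℕ} (hL : 2 * ℓ ≤ L + 1) (hR : 11 * m < 2 ^ R)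
    (hcost : ∀ h, ((h = 4 ∧ 3 ≤ ℓ) ∨ (h = 2 ∧ ℓ = 2)) → max 1 ((ℓ - 1) / 2) * (h * R + 1) ≤ L) :
    ∃ (v : V) (w : (⊤ : SimpleGraph V).Walk v v), w.IsCycle ∧ ℓ ≤ w.length ∧
      (∀ e ∈ w.edges, e ∈ A) ∧ TauGe ℓ (A \ {e | e ∈ w.edges}) (m - L) := by
  by_cases hshort : ∃ (v : V) (w : (⊤ : SimpleGraph V).Walk v v), w.IsCycle ∧ ℓ ≤ w.length ∧
      (∀ e ∈ w.edges, e ∈ A) ∧ w.length ≤ L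
  · obtain ⟨v, w, hw, hl, hwA, hwL⟩ := hshort
    refine ⟨v, w, hw, hl, hwA, fun Y hY => ?_⟩
    have h1 := hm (Y ∪ {e | e ∈ w.edges}) (fun h => hY (h.mono (by
      rintro e ⟨h1, h2⟩
      exact ⟨⟨h1, fun h => h2 (Or.inr h)⟩, fun h => h2 (Or.inl h)⟩)))
    have h2 := Set.ncard_union_le Y {e | e ∈ w.edges}
    have h3 := ncard_edges_le w
    omega
  · push Not at hshort
    have gap : ∀ v (w : (⊤ : SimpleGraph V).Walk v v), w.IsCycle →
        (∀ e ∈ w.edges, e ∈ A) → ℓ ≤ w.length → 2 * ℓ ≤ w.length := by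
      intro v w hw hwA hl
      have := hshort v w hw hl hwA
      omega
    have hex : ∃ n, ∃ cl : Sym2 V → Set (Sym2 V),
        Good ℓ (max 1 ((ℓ - 1) / 2)) A cl ∧ (Set.image cl A).ncard = n :=
      ⟨_, cl0 ℓ A, good_initial hℓ gap, rfl⟩
    obtain ⟨cl, hg, hn⟩ := Nat.find_spec hex
    have hnoM : ∀ v c c' Q Q', ¬ Mergeable cl A v c c' Q Q' := by
      intro v c c' Q Q' M
      have h1 := mcl_image_lt M
      rw [hn] at h1
      exact Nat.find_min hex h1 ⟨_, good_merge hg M, rfl⟩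
    obtain ⟨h, hh, hc⟩ : ∃ h, ((h = 4 ∧ 3 ≤ ℓ) ∨ (h = 2 ∧ ℓ = 2)) ∧
        (h = 4 ∨ (h = 2 ∧ ℓ = 2)) := by
      by_cases h : ℓ = 2
      · exact ⟨2, by omega, by omega⟩
      · exact ⟨4, by omega, by omega⟩
    obtain ⟨x, c, hcyc, hcl⟩ := short_cycle hA hg hm1 hm hmin hnoM hR hc
    obtain ⟨E, n, hnq, hE, hE'⟩ := sw_cycle hg c hcyc hcl
    obtain ⟨v, w, h1, h2, h3, h4⟩ := remove_cycle hg hm hE hE'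
    refine ⟨v, w, h1, h2, h3, fun Y hY => ?_⟩
    have := h4 Y hY
    have := hcost h hh
    omega

theorem exists_minimal_sub [Finite V] {m : ℕ} (hm : TauGe ℓ A m) :
    ∃ B ⊆ A, TauGe ℓ B m ∧ ∀ e ∈ B, ¬ TauGe ℓ (B \ {e}) m := by
  have hex : ∃ n, ∃ B ⊆ A, TauGe ℓ B m ∧ B.ncard = n := ⟨_, A, le_rfl, hm, rfl⟩
  obtain ⟨B, hB, hBm, hn⟩ := Nat.find_spec hex
  refine ⟨B, hB, hBm, fun e he h => ?_⟩
  have h1 : (B \ {e}).ncard < B.ncard := Set.ncard_sdiff_singleton_lt_of_mem he (Set.toFinite _)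
  rw [hn] at h1
  exact Nat.find_min hex h1 ⟨_, Set.sdiff_subset.trans hB, h, rfl⟩

theorem packing [Fintype V] (hℓ : 2 ≤ ℓ) {L R : ℕ} (hL : 2 * ℓ ≤ L + 1)
    (hcost : ∀ h, ((h = 4 ∧ 3 ≤ ℓ) ∨ (h = 2 ∧ ℓ = 2)) → max 1 ((ℓ - 1) / 2) * (h * R + 1) ≤ L)
    (j : ℕ) : 11 * (j * L) < 2 ^ R → ∀ A : Set (Sym2 V), (∀ e ∈ A, ¬ e.IsDiag) →
    TauGe ℓ A (j * L) → ∃ cs : Fin j → Σ v : V, (⊤ : SimpleGraph V).Walk v v,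
      (∀ i, (cs i).2.IsCycle ∧ ℓ ≤ (cs i).2.length ∧ ∀ e ∈ (cs i).2.edges, e ∈ A) ∧
      (∀ i j, i ≠ j → ∀ e ∈ (cs i).2.edges, e ∉ (cs j).2.edges) := by
  induction j with
  | zero => exact fun _ A _ _ => ⟨fun i => i.elim0, fun i => i.elim0, fun i => i.elim0⟩
  | succ j ih =>
    intro hR A hA hm
    obtain ⟨B, hBA, hBm, hmin⟩ := exists_minimal_sub hm
    have hjL : (j + 1) * L = j * L + L := Nat.succ_mul j L
    rw [hjL] at hR hBm
    simp only [hjL] at hmin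
    obtain ⟨v, w, h1, h2, h3, h4⟩ := step (fun e he => hA e (hBA he)) hℓ (by omega) hBm hmin hL hR hcost
    rw [Nat.add_sub_cancel] at h4
    obtain ⟨cs, hcs, hdis⟩ := ih (by omega) _ (fun e he => hA e (hBA he.1)) h4
    refine ⟨Fin.cons ⟨v, w⟩ cs, ?_, ?_⟩
    · intro i
      refine Fin.cases ?_ (fun i => ?_) i
      · exact ⟨h1, h2, fun e he => hBA (h3 e he)⟩
      · exact ⟨(hcs i).1, (hcs i).2.1, fun e he => hBA ((hcs i).2.2 e he).1⟩
    · intro a b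
      refine Fin.cases ?_ (fun a => ?_) a
      · refine Fin.cases ?_ (fun b => ?_) b
        · exact fun h => absurd rfl h
        · intro _ e he he'
          exact ((hcs b).2.2 e he').2 he
      · refine Fin.cases ?_ (fun b => ?_) b
        · intro _ e he he'
          exact ((hcs a).2.2 e he).2 he'
        · intro hab e he
          exact hdis a b (fun h => hab (by rw [h])) e he

theorem arith {k c : ℕ} (hℓ : 2 ≤ ℓ) (hk : 2 ≤ k) (hc : c = Nat.clog 2 (k * ℓ)) :
    2 * ℓ ≤ 8 * (ℓ - 1) * (c + 1) + 1 ∧ 11 * (k * (8 * (ℓ - 1) * (c + 1))) < 2 ^ (2 * c + 7) ∧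
    ∀ h, ((h = 4 ∧ 3 ≤ ℓ) ∨ (h = 2 ∧ ℓ = 2)) →
      max 1 ((ℓ - 1) / 2) * (h * (2 * c + 7) + 1) ≤ 8 * (ℓ - 1) * (c + 1) := by
  have h1 : k * ℓ ≤ 2 ^ c := hc ▸ Nat.le_pow_clog (by norm_num) _
  have h4 : 4 ≤ k * ℓ := Nat.mul_le_mul hk hℓ
  have hc2 : 2 ≤ c := by
    by_contra h
    have : 2 ^ c ≤ 2 ^ 1 := Nat.pow_le_pow_right (by norm_num) (by omega)
    omega
  have hc3 : c + 1 ≤ 2 ^ c := Nat.lt_two_pow_self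
  obtain ⟨a, rfl⟩ : ∃ a, ℓ = a + 1 := ⟨ℓ - 1, by omega⟩
  simp only [Nat.add_sub_cancel]
  refine ⟨by nlinarith, ?_, ?_⟩
  · have h5 : k * a ≤ 2 ^ c := le_trans (Nat.mul_le_mul_left _ (by omega)) h1
    have h6 : (k * a) * (c + 1) ≤ 2 ^ c * 2 ^ c := Nat.mul_le_mul h5 hc3
    have h7 : 2 ^ (2 * c + 7) = 128 * (2 ^ c * 2 ^ c) := by
      rw [pow_add, two_mul, pow_add]; ring
    have h8 : 0 < 2 ^ c * 2 ^ c := by positivity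
    have h9 : 11 * (k * (8 * a * (c + 1))) = 88 * ((k * a) * (c + 1)) := by ring
    rw [h7, h9]
    omega
  · rintro h (⟨rfl, h3⟩ | ⟨rfl, h3⟩)
    · have hq : max 1 (a / 2) * 2 ≤ a := by
        rw [max_eq_right (by omega)]; omega
      generalize max 1 (a / 2) = q at hq
      nlinarith
    · have : a = 1 := by omega
      subst this
      simp
      omega

end final
end EP

theorem edge_erdos_posa_long_cycles {V : Type*} [Fintype V] (G : SimpleGraph V)
    (ℓ k : ℕ) (hℓ : 2 ≤ ℓ) :
    (∃ cs : Fin k → Σ v : V, G.Walk v v,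
      (∀ i, (cs i).2.IsCycle ∧ ℓ ≤ (cs i).2.length) ∧
      (∀ i j, i ≠ j → ∀ e ∈ (cs i).2.edges, e ∉ (cs j).2.edges)) ∨
    (∃ F : Finset (Sym2 V), ↑F ⊆ G.edgeSet ∧
      F.card ≤ 8 * k * (ℓ - 1) * (Nat.clog 2 (k * ℓ) + 1) ∧
      ∀ (v : V) (w : (G.deleteEdges ↑F).Walk v v), w.IsCycle → w.length < ℓ) := by
  classical
  by_cases hk0 : k = 0
  · subst hk0
    exact Or.inl ⟨fun i => i.elim0, fun i => i.elim0, fun i => i.elim0⟩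
  by_cases hk1 : k = 1
  · subst hk1
    by_cases h : ∃ (v : V) (w : G.Walk v v), w.IsCycle ∧ ℓ ≤ w.length
    · obtain ⟨v, w, h⟩ := h
      exact Or.inl ⟨fun _ => ⟨v, w⟩, fun _ => h, fun i j hij => absurd (Subsingleton.elim i j) hij⟩
    · push Not at h
      refine Or.inr ⟨∅, by simp, by simp, fun v w hw => ?_⟩
      have := h v (w.mapLe (SimpleGraph.deleteEdges_le _)) (by simpa using hw)
      simpa using this
  obtain ⟨hL, hR, hcost⟩ := EP.arith hℓ (by omega : 2 ≤ k) rfl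
  by_cases hT : EP.TauGe ℓ G.edgeSet (k * (8 * (ℓ - 1) * (Nat.clog 2 (k * ℓ) + 1)))
  · left
    obtain ⟨cs, hcs, hdis⟩ := EP.packing hℓ hL hcost k hR G.edgeSet
      (fun e he => G.not_isDiag_of_mem_edgeSet he) hT
    refine ⟨fun i => ⟨(cs i).1, (cs i).2.transfer G (hcs i).2.2⟩, fun i => ⟨?_, ?_⟩, ?_⟩
    · exact (hcs i).1.transfer _
    · simpa using (hcs i).2.1
    · intro i j hij e he
      simp only [SimpleGraph.Walk.edges_transfer] at he ⊢
      exact hdis i j hij e he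
  · right
    unfold EP.TauGe at hT
    push Not at hT
    obtain ⟨Y, hY, hYc⟩ := hT
    refine ⟨(Y ∩ G.edgeSet).toFinset, by simp, ?_, ?_⟩
    · rw [← Set.ncard_eq_toFinset_card']
      have h1 : (Y ∩ G.edgeSet).ncard ≤ Y.ncard := Set.ncard_le_ncard Set.inter_subset_left (Set.toFinite _)
      have h2 : 8 * k * (ℓ - 1) * (Nat.clog 2 (k * ℓ) + 1) =
        k * (8 * (ℓ - 1) * (Nat.clog 2 (k * ℓ) + 1)) := by ring
      omega
    · intro v w hw
      by_contra hlt
      push Not at hlt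
      refine hY ⟨v, w.mapLe le_top, by simpa using hw, by simpa using hlt, ?_⟩
      intro e he
      rw [SimpleGraph.Walk.edges_mapLe_eq_edges] at he
      have := w.edges_subset_edgeSet he
      rw [SimpleGraph.edgeSet_deleteEdges] at this
      refine ⟨this.1, fun h => this.2 ?_⟩
      rw [Set.coe_toFinset]
      exact ⟨h, this.1⟩
end

section
/- For every finite graph G and every nonnegative integer k, either G contains k pairwise vertex-disjoint cycles, or there is a set F of at most k·(8⌈log₂ k⌉ + 2) vertices of G such that the graph G − F (obtained by deleting the vertices in F) has no cycle. -/
namespace EPV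
open Finset

/-- Number of edges (of the multigraph with edge set `E` and end maps `a`, `b`) inside `S`. -/
noncomputable def ein {ι V : Type*} (E : Finset ι) (a b : ι → V) (S : Finset V) : ℕ := by
  classical exact (E.filter (fun e => a e ∈ S ∧ b e ∈ S)).card

/-- Degree in the multigraph. -/
noncomputable def mdeg {ι V : Type*} (E : Finset ι) (a b : ι → V) (v : V) : ℕ := by
  classical exact (E.filter (fun e => a e = v)).card + (E.filter (fun e => b e = v)).card

section
variable {ι V : Type*} 
open scoped Classical

theorem ein_eq (E : Finset ι) (a b : ι → V) (S : Finset V) :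
    ein E a b S = (E.filter (fun e => a e ∈ S ∧ b e ∈ S)).card := by
  unfold ein; congr

theorem mdeg_eq (E : Finset ι) (a b : ι → V) (v : V) :
    mdeg E a b v = (E.filter (fun e => a e = v)).card + (E.filter (fun e => b e = v)).card := by
  unfold mdeg; congr

theorem ein_super (E : Finset ι) (a b : ι → V) (P Q : Finset V) :
    ein E a b P + ein E a b Q ≤ ein E a b (P ∪ Q) + ein E a b (P ∩ Q) := by
  simp only [ein_eq]
  rw [← card_union_add_card_inter]
  apply Nat.add_le_add <;> apply card_le_card <;> intro e <;> simp only [mem_union, mem_inter, mem_filter] <;> tauto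

theorem ein_add (E : Finset ι) (a b : ι → V) (P P' : Finset V) (T : Finset ι) (hPP : P ⊆ P')
    (hT : ∀ e ∈ T, e ∈ E ∧ a e ∈ P' ∧ b e ∈ P' ∧ ¬ (a e ∈ P ∧ b e ∈ P)) :
    ein E a b P + T.card ≤ ein E a b P' := by
  simp only [ein_eq]
  rw [← card_union_of_disjoint]
  · apply card_le_card
    intro e he
    simp only [mem_union, mem_filter] at he ⊢
    rcases he with ⟨h1, h2, h3⟩ | h
    · exact ⟨h1, hPP h2, hPP h3⟩
    · have := hT e h; tauto
  · rw [disjoint_left]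
    intro e he h
    have := hT e h
    simp only [mem_filter] at he
    tauto

theorem sum_fiber (E : Finset ι) (a : ι → V) (B : Finset V) :
    ∑ v ∈ B, (E.filter (fun e => a e = v)).card = (E.filter (fun e => a e ∈ B)).card := by
  rw [card_eq_sum_card_fiberwise (f := a) (t := B)]
  · apply sum_congr rfl
    intro v hv
    congr 1
    ext e
    simp only [mem_filter]
    constructor
    · rintro ⟨h, rfl⟩; exact ⟨⟨h, hv⟩, rfl⟩
    · rintro ⟨⟨h, _⟩, h'⟩; exact ⟨h, h'⟩
  · intro e he
    simp at he
    exact he.2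

theorem sum_mdeg (E : Finset ι) (a b : ι → V) (B : Finset V) :
    ∑ v ∈ B, mdeg E a b v = (E.filter (fun e => a e ∈ B)).card + (E.filter (fun e => b e ∈ B)).card := by
  simp only [mdeg_eq, sum_add_distrib, sum_fiber]

/-- Edges with at least one end in `B`. -/
theorem sum_mdeg' (E : Finset ι) (a b : ι → V) (B : Finset V) :
    ∑ v ∈ B, mdeg E a b v = ein E a b B + (E.filter (fun e => a e ∈ B ∨ b e ∈ B)).card := by
  rw [sum_mdeg, ein_eq, ← card_union_add_card_inter, ← filter_or, ← filter_and, add_comm]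

theorem sum_mdeg_boundary (E : Finset ι) (a b : ι → V) (B : Finset V) :
    ∑ v ∈ B, mdeg E a b v = 2 * ein E a b B +
      (E.filter (fun e => (a e ∈ B ∧ b e ∉ B) ∨ (a e ∉ B ∧ b e ∈ B))).card := by
  rw [sum_mdeg']
  have : (E.filter (fun e => a e ∈ B ∨ b e ∈ B)).card = ein E a b B + 
      (E.filter (fun e => (a e ∈ B ∧ b e ∉ B) ∨ (a e ∉ B ∧ b e ∈ B))).card := by
    rw [ein_eq, ← card_union_of_disjoint]
    · congr 1
      ext e
      simp only [mem_union, mem_filter]; tauto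
    · rw [disjoint_left]
      intro e he h
      simp only [mem_filter] at he h
      tauto
  omega

theorem short_cycle (E : Finset ι) (a b : ι → V) (W : Finset V)
    (hE : ∀ e ∈ E, a e ∈ W ∧ b e ∈ W) (hd : ∀ v ∈ W, mdeg E a b v = 3) (hW : W.Nonempty)
    (i : ℕ) (hi : W.card + 2 < 3 * 2 ^ i) :
    ∃ S ⊆ W, S.Nonempty ∧ S.card ≤ 2 * i + 1 ∧ S.card ≤ ein E a b S := by
  by_contra hcon
  have hno : ∀ S ⊆ W, S.Nonempty → S.card ≤ 2 * i + 1 → ein E a b S < S.card := by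
    intro S h1 h2 h3
    by_contra h4
    exact hcon ⟨S, h1, h2, h3, by omega⟩
  obtain ⟨r, hr⟩ := hW
  have key : ∀ j ≤ i, ∃ B ⊆ W, r ∈ B ∧ 3 * 2 ^ j ≤ B.card + 2 ∧ ein E a b B + 1 ≤ B.card ∧
      ∀ x ∈ B, ∃ P ⊆ B, r ∈ P ∧ x ∈ P ∧ P.card ≤ j + 1 ∧ P.card ≤ ein E a b P + 1 := by
    intro j
    induction j with
    | zero =>
      intro _
      refine ⟨{r}, by simpa using hr, by simp, by simp, ?_, ?_⟩
      · have := hno {r} (by simpa using hr) (by simp) (by simp)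
        simpa using this
      · intro x hx
        exact ⟨{r}, by simp, by simp, by simpa using hx, by simp, by simp⟩
    | succ j ih =>
      intro hj
      obtain ⟨B, hBW, hrB, hBc, hBe, hP⟩ := ih (by omega)
      -- union of two paths
      have hU : ∀ x ∈ B, ∀ y ∈ B, ∃ P ⊆ B, x ∈ P ∧ y ∈ P ∧ P.card ≤ 2 * j + 1 ∧
          P.card ≤ ein E a b P + 1 := by
        intro x hx y hy
        obtain ⟨P, hPB, hrP, hxP, hPc, hPe⟩ := hP x hx
        obtain ⟨Q, hQB, hrQ, hyQ, hQc, hQe⟩ := hP y hy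
        have h1 := ein_super E a b P Q
        have h2 := card_union_add_card_inter P Q
        have hrI : r ∈ P ∩ Q := by simp [hrP, hrQ]
        have h4 : 0 < (P ∩ Q).card := card_pos.2 ⟨r, hrI⟩
        have h5 : (P ∩ Q).card ≤ P.card := card_le_card inter_subset_left
        have h3 := hno (P ∩ Q) (inter_subset_left.trans (hPB.trans hBW)) ⟨r, hrI⟩ (by omega)
        exact ⟨P ∪ Q, union_subset hPB hQB, by simp [hxP], by simp [hyQ], by omega, by omega⟩
      set D := E.filter (fun e => (a e ∈ B ∧ b e ∉ B) ∨ (a e ∉ B ∧ b e ∈ B)) with hD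
      let out : ι → V := fun e => if a e ∈ B then b e else a e
      let inn : ι → V := fun e => if a e ∈ B then a e else b e
      have hDs : ∀ e ∈ D, e ∈ E ∧ inn e ∈ B ∧ out e ∉ B ∧ out e ∈ W ∧
          ((a e = inn e ∧ b e = out e) ∨ (a e = out e ∧ b e = inn e)) := by
        intro e he
        simp only [hD, mem_filter] at he
        have := hE e he.1
        by_cases h : a e ∈ B
        · simp only [inn, out, if_pos h]; tauto
        · simp only [inn, out, if_neg h]; tauto
      have hDc : 3 * B.card = 2 * ein E a b B + D.card := by
        rw [← sum_mdeg_boundary, sum_congr rfl (fun v hv => hd v (hBW hv))]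
        simp [mul_comm]
      have hinj : Set.InjOn out D := by
        intro e he f hf hef
        by_contra hne
        obtain ⟨e1, e2, e3, e4, e5⟩ := hDs e he
        obtain ⟨f1, f2, f3, f4, f5⟩ := hDs f hf
        obtain ⟨P, hPB, hx, hy, hPc, hPe⟩ := hU _ e2 _ f2
        have hw : out e ∉ P := fun h => e3 (hPB h)
        have h1 := ein_add E a b P (insert (out e) P) {e, f} (subset_insert _ _) (by
          intro g hg
          simp only [mem_insert, mem_singleton] at hg
          rcases hg with rfl | rfl
          · rcases e5 with ⟨h, h'⟩ | ⟨h, h'⟩ <;> simp [h, h', hx, hw, e1]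
          · rw [hef] at hw ⊢
            rcases f5 with ⟨h, h'⟩ | ⟨h, h'⟩ <;> simp [h, h', hy, hw, f1])
        have h2 := card_insert_of_notMem hw
        have h3 := card_pair hne
        have h4 := hno (insert (out e) P) (insert_subset e4 (hPB.trans hBW)) (by simp) (by omega)
        omega
      set N := D.image out with hN
      have hNc : N.card = D.card := card_image_of_injOn hinj
      have hNs : ∀ w ∈ N, ∃ e ∈ D, out e = w := by
        intro w hw; simpa [hN] using hw
      have hdis : Disjoint B N := by
        rw [disjoint_left]
        intro w hw hw'
        obtain ⟨e, he, rfl⟩ := hNs w hw'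
        exact (hDs e he).2.2.1 hw
      have hBN : (B ∪ N).card = B.card + N.card := card_union_of_disjoint hdis
      have hNN : ∀ e ∈ E, a e ∈ N → b e ∈ N → False := by
        intro e he h1 h2
        obtain ⟨f, hf, hfa⟩ := hNs _ h1
        obtain ⟨g, hg, hgb⟩ := hNs _ h2
        obtain ⟨f1, f2, f3, f4, f5⟩ := hDs f hf
        obtain ⟨g1, g2, g3, g4, g5⟩ := hDs g hg
        by_cases hl : a e = b e
        · have h1 := ein_add E a b ∅ {a e} {e} (by simp) (by simp [he, hl])
          have h2 := hno {a e} (by simpa using (hE e he).1) (by simp) (by simp)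
          simp at h1 h2
          omega
        · obtain ⟨P, hPB, hx, hy, hPc, hPe⟩ := hU _ f2 _ g2
          have hw1 : out f ∉ P := fun h => f3 (hPB h)
          have hw2 : out g ∉ P := fun h => g3 (hPB h)
          have hne : out f ≠ out g := by rw [hfa, hgb]; exact hl
          have hfg : f ≠ g := fun h => hne (by rw [h])
          have haeB : a e ∉ B := by rw [← hfa]; exact f3
          have hbeB : b e ∉ B := by rw [← hgb]; exact g3
          have hef : e ≠ f := by
            rintro rfl
            rcases f5 with ⟨h, h'⟩ | ⟨h, h'⟩
            · rw [h] at haeB; exact haeB f2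
            · rw [h'] at hbeB; exact hbeB f2
          have heg : e ≠ g := by
            rintro rfl
            rcases g5 with ⟨h, h'⟩ | ⟨h, h'⟩
            · rw [h] at haeB; exact haeB g2
            · rw [h'] at hbeB; exact hbeB g2
          have h1 := ein_add E a b P (insert (out f) (insert (out g) P)) {e, f, g} (by
              intro z hz; simp [hz]) (by
            intro g' hg
            simp only [mem_insert, mem_singleton] at hg
            rcases hg with rfl | rfl | rfl
            · rw [← hfa, ← hgb]; simp [he, hw1]
            · rcases f5 with ⟨h, h'⟩ | ⟨h, h'⟩ <;> simp [h, h', hx, hw1, f1]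
            · rcases g5 with ⟨h, h'⟩ | ⟨h, h'⟩ <;> simp [h, h', hy, hw2, g1])
          have h2 : (insert (out f) (insert (out g) P)).card = P.card + 2 := by
            rw [card_insert_of_notMem (by simp [hne, hw1]), card_insert_of_notMem hw2]
          have h3 : ({e, f, g} : Finset ι).card = 3 := by
            rw [card_eq_three]; exact ⟨e, f, g, hef, heg, hfg, rfl⟩
          have h4 := hno (insert (out f) (insert (out g) P))
            (insert_subset f4 (insert_subset g4 (hPB.trans hBW))) (by simp) (by omega)
          omega
      refine ⟨B ∪ N, ?_, by simp [hrB], ?_, ?_, ?_⟩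
      · apply union_subset hBW
        intro w hw
        obtain ⟨e, he, rfl⟩ := hNs w hw
        exact (hDs e he).2.2.2.1
      · rw [pow_succ]; omega
      · have : ein E a b (B ∪ N) ≤ ein E a b B + D.card := by
          rw [ein_eq, ein_eq]
          refine le_trans (card_le_card ?_) (card_union_le _ _)
          intro e he
          simp only [hD, mem_filter, mem_union] at he ⊢
          have := hNN e he.1
          have h1 : a e ∈ N → a e ∉ B := fun h h' => disjoint_left.1 hdis h' h
          have h2 : b e ∈ N → b e ∉ B := fun h h' => disjoint_left.1 hdis h' h
          tauto
        omega
      · intro x hx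
        rcases mem_union.1 hx with hx | hx
        · obtain ⟨P, h1, h2, h3, h4, h5⟩ := hP x hx
          exact ⟨P, h1.trans subset_union_left, h2, h3, by omega, h5⟩
        · obtain ⟨e, he, rfl⟩ := hNs x hx
          obtain ⟨e1, e2, e3, e4, e5⟩ := hDs e he
          obtain ⟨P, h1, h2, h3, h4, h5⟩ := hP _ e2
          have hw : out e ∉ P := fun h => e3 (h1 h)
          have h6 := ein_add E a b P (insert (out e) P) {e} (subset_insert _ _) (by
            intro g hg
            simp only [mem_singleton] at hg
            subst hg
            rcases e5 with ⟨h, h'⟩ | ⟨h, h'⟩ <;> simp [h, h', h3, hw, e1])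
          have h7 := card_insert_of_notMem hw
          rw [card_singleton] at h6
          refine ⟨insert (out e) P, ?_, by simp [h2], by simp, by omega, by omega⟩
          exact insert_subset (mem_union_right _ hx) (h1.trans subset_union_left)
  obtain ⟨B, hB, _, h, _⟩ := key i le_rfl
  have := card_le_card hB
  omega

theorem mdeg_erase (E : Finset ι) (a b : ι → V) (e : ι) (he : e ∈ E) (v : V) :
    mdeg E a b v = mdeg (E.erase e) a b v + (if a e = v then 1 else 0) + (if b e = v then 1 else 0) := by
  obtain ⟨F, hF, rfl⟩ : ∃ F, e ∉ F ∧ E = insert e F := ⟨E.erase e, by simp, by simp [insert_erase he]⟩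
  rw [erase_insert hF]
  simp only [mdeg_eq, filter_insert]
  split_ifs <;> simp [hF] <;> omega

theorem mdeg_mono {E F : Finset ι} (a b : ι → V) (h : E ⊆ F) (v : V) :
    mdeg E a b v ≤ mdeg F a b v := by
  simp only [mdeg_eq]
  exact Nat.add_le_add (card_le_card (filter_subset_filter _ h)) (card_le_card (filter_subset_filter _ h))

theorem ein_mono {E F : Finset ι} (a b : ι → V) (h : E ⊆ F) (S : Finset V) :
    ein E a b S ≤ ein F a b S := by
  simp only [ein_eq]
  exact card_le_card (filter_subset_filter _ h)

/-- `k` disjoint vertex sets each spanning at least as many edges as vertices. -/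
def Pack (E : Finset ι) (a b : ι → V) (W : Finset V) (k : ℕ) : Prop :=
  ∃ S : Fin k → Finset V, (∀ t, S t ⊆ W ∧ (S t).Nonempty ∧ (S t).card ≤ ein E a b (S t)) ∧
    ∀ s t, s ≠ t → Disjoint (S s) (S t)

theorem Pack.mono {E F : Finset ι} {a b : ι → V} {W X : Finset V} {k : ℕ} (h : Pack E a b W k)
    (hE : E ⊆ F) (hW : W ⊆ X) : Pack F a b X k := by
  obtain ⟨S, h1, h2⟩ := h
  exact ⟨S, fun t => ⟨(h1 t).1.trans hW, (h1 t).2.1, (h1 t).2.2.trans (ein_mono a b hE _)⟩, h2⟩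

theorem Pack.cons {E F : Finset ι} {a b : ι → V} {W X : Finset V} {k : ℕ} (h : Pack E a b (W \ X) k)
    (hE : E ⊆ F) (hX : X ⊆ W) (hne : X.Nonempty) (hc : X.card ≤ ein F a b X) :
    Pack F a b W (k + 1) := by
  obtain ⟨S, h1, h2⟩ := h.mono hE subset_rfl
  refine ⟨Fin.cons X S, ?_, ?_⟩
  · intro t
    refine Fin.cases ?_ (fun t => ?_) t
    · exact ⟨hX, hne, hc⟩
    · exact ⟨(h1 t).1.trans sdiff_subset, (h1 t).2⟩
  · intro s t
    refine Fin.cases ?_ (fun s => ?_) s <;> refine Fin.cases ?_ (fun t => ?_) t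
    · simp
    · intro _
      simpa using (disjoint_sdiff.mono_right (h1 t).1)
    · intro _
      simpa using (disjoint_sdiff.mono_right (h1 s).1).symm
    · intro hst
      simpa using h2 s t (by simpa using hst)

/-- Lift a packing through the contraction of the edge `e` joining `u` and `v`. -/
theorem Pack.lift {E : Finset ι} {a b : ι → V} {W : Finset V} {k : ℕ} {e : ι} {u v : V}
    (he : e ∈ E) (huv : u ≠ v) (hv : v ∈ W)
    (hev : (a e = u ∧ b e = v) ∨ (a e = v ∧ b e = u))
    (h : Pack (E.erase e) (fun f => if a f = v then u else a f) (fun f => if b f = v then u else b f)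
      (W.erase v) k) : Pack E a b W k := by
  obtain ⟨S, h1, h2⟩ := h
  have hvS : ∀ t, v ∉ S t := fun t ht => by simpa using (h1 t).1 ht
  refine ⟨fun t => if u ∈ S t then insert v (S t) else S t, ?_, ?_⟩
  · intro t
    obtain ⟨h3, h4, h5⟩ := h1 t
    have h3' := h3.trans (erase_subset v W)
    dsimp only
    split_ifs with hu
    · refine ⟨insert_subset hv h3', by simp, ?_⟩
      rw [card_insert_of_notMem (hvS t)]
      refine (Nat.add_le_add_right h5 1).trans ?_
      rw [ein_eq, ein_eq]
      rw [← card_insert_of_notMem (a := e) (by simp)]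
      apply card_le_card
      intro f hf
      simp only [mem_insert, mem_filter, mem_erase] at hf ⊢
      rcases hf with rfl | ⟨⟨_, hf⟩, h6, h7⟩
      · refine ⟨he, ?_⟩
        rcases hev with ⟨h, h'⟩ | ⟨h, h'⟩ <;> simp [h, h', hu]
      · refine ⟨hf, ?_, ?_⟩
        · by_contra hh
          push Not at hh
          rw [if_neg hh.1] at h6
          exact hh.2 h6
        · by_contra hh
          push Not at hh
          rw [if_neg hh.1] at h7
          exact hh.2 h7
    · refine ⟨h3', h4, h5.trans ?_⟩
      rw [ein_eq, ein_eq]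
      apply card_le_card
      intro f hf
      simp only [mem_filter, mem_erase] at hf ⊢
      obtain ⟨⟨_, hf⟩, h6, h7⟩ := hf
      refine ⟨hf, ?_, ?_⟩
      · by_contra hh
        split_ifs at h6 <;> tauto
      · by_contra hh
        split_ifs at h7 <;> tauto
  · intro s t hst
    have h3 := disjoint_left.1 (h2 s t hst)
    have := hvS s
    have := hvS t
    rw [disjoint_left]
    intro x hx hy
    dsimp only at hx hy
    split_ifs at hx hy with h4 h5 h6
    · exact h3 h4 h5
    · rcases mem_insert.1 hx with rfl | hx
      · tauto
      · exact h3 hx hy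
    · rcases mem_insert.1 hy with rfl | hy
      · tauto
      · exact h3 hx hy
    · exact h3 hx hy

theorem pack_main (i : ℕ) (k : ℕ) (hk : 2 * (k * (2 * i + 1)) + 4 < 3 * 2 ^ i) : ∀ (m : ℕ)
    (E : Finset ι) (a b : ι → V) (W : Finset V), E.card + W.card ≤ m →
    (∀ e ∈ E, a e ∈ W ∧ b e ∈ W) → (∀ v ∈ W, mdeg E a b v ≤ 3) →
    W.card + 1 + k * (2 * i + 1) ≤ E.card → Pack E a b W (k + 1) := by
  induction k with
  | zero =>
    intro m E a b W _ hE _ hc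
    refine ⟨fun _ => W, ?_, ?_⟩
    · intro t
      refine ⟨subset_rfl, ?_, ?_⟩
      · have : 0 < E.card := by omega
        obtain ⟨e, he⟩ := card_pos.1 this
        exact ⟨_, (hE e he).1⟩
      · rw [ein_eq, filter_true_of_mem hE]; show W.card ≤ _; omega
    · intro s t hst
      exact absurd (Fin.ext (by omega)) hst
  | succ k ihk =>
    have ihk' := ihk (by nlinarith)
    intro m
    induction m with
    | zero => 
      intro E a b W hm hE hd hc
      omega
    | succ m ih =>
      intro E a b W hm hE hd hc
      -- delete a vertex with at most one incident edge
      by_cases hA : ∃ v ∈ W, (E.filter (fun e => a e = v ∨ b e = v)).card ≤ 1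
      · obtain ⟨v, hv, hvc⟩ := hA
        have h1 : (E.filter (fun e => a e = v ∨ b e = v)).card +
          (E.filter (fun e => ¬ (a e = v ∨ b e = v))).card = E.card := card_filter_add_card_filter_not _
        have h2 := card_erase_add_one hv
        refine (ih (E.filter (fun e => ¬ (a e = v ∨ b e = v))) a b (W.erase v) (by omega) ?_ ?_ 
          (by omega)).mono (filter_subset _ _) (erase_subset _ _)
        · intro e he
          simp only [mem_filter, not_or] at he
          have := hE e he.1
          simp only [mem_erase]; tauto
        · intro w hw
          exact (mdeg_mono a b (filter_subset _ _) w).trans (hd w (mem_of_mem_erase hw))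
      push Not at hA
      by_cases hB : ∃ v ∈ W, mdeg E a b v ≤ 2
      · obtain ⟨v, hv, hvd⟩ := hB
        have hA' := hA v hv
        have hno : ∀ e ∈ E, ¬ (a e = v ∧ b e = v) := by
          intro e he ⟨h1, h2⟩
          have h3 := sum_mdeg' E a b {v}
          simp only [sum_singleton, mem_singleton] at h3
          have : 0 < ein E a b {v} := by
            rw [ein_eq, card_pos]
            exact ⟨e, by simp [he, h1, h2]⟩
          omega
        obtain ⟨e, he⟩ := card_pos.1 (lt_trans Nat.zero_lt_one hA')
        simp only [mem_filter] at he
        obtain ⟨he, hev⟩ := he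
        obtain ⟨u, huW, huv, hu⟩ : ∃ u ∈ W, u ≠ v ∧ ((a e = u ∧ b e = v) ∨ (a e = v ∧ b e = u)) := by
          have h1 := hno e he
          have h2 := hE e he
          rcases hev with h | h
          · exact ⟨b e, h2.2, fun h' => h1 ⟨h, h'⟩, Or.inr ⟨h, rfl⟩⟩
          · exact ⟨a e, h2.1, fun h' => h1 ⟨h', h⟩, Or.inl ⟨rfl, h⟩⟩
        have h2 := card_erase_add_one hv
        have h3 := card_erase_add_one he
        refine Pack.lift he huv hv hu (ih _ _ _ _ (by omega) ?_ ?_ (by omega))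
        · intro f hf
          have h4 := hE f (mem_of_mem_erase hf)
          simp only [mem_erase]
          constructor
          · split_ifs with h
            · exact ⟨huv, huW⟩
            · exact ⟨h, h4.1⟩
          · split_ifs with h
            · exact ⟨huv, huW⟩
            · exact ⟨h, h4.2⟩
        · intro w hw
          have hwv : w ≠ v := ne_of_mem_erase hw
          have hwW := mem_of_mem_erase hw
          by_cases hwu : w = u
          · subst hwu
            have h5 := mdeg_erase E a b e he w
            have h6 := mdeg_erase E a b e he v
            have h7 := hd w hwW
            have h8 : mdeg (E.erase e) (fun f => if a f = v then w else a f)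
                (fun f => if b f = v then w else b f) w ≤
                mdeg (E.erase e) a b w + mdeg (E.erase e) a b v := by
              have key : ∀ c : ι → V, ((E.erase e).filter (fun f => (if c f = v then w else c f) = w)).card ≤
                  ((E.erase e).filter (fun f => c f = w)).card + ((E.erase e).filter (fun f => c f = v)).card := by
                intro c
                refine le_trans (card_le_card ?_) (card_union_le _ _)
                intro f hf
                simp only [mem_union, mem_filter] at hf ⊢
                obtain ⟨h, h'⟩ := hf
                split_ifs at h' <;> tauto
              simp only [mdeg_eq]
              have := key a
              have := key b
              omega
            rcases hu with ⟨ha, hb⟩ | ⟨ha, hb⟩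
            · simp [ha, hb, huv, huv.symm] at h5 h6; omega
            · simp [ha, hb, huv, huv.symm] at h5 h6; omega
          · refine le_trans ?_ (hd w hwW)
            refine le_trans ?_ (mdeg_mono a b (erase_subset e E) w)
            simp only [mdeg_eq]
            apply Nat.add_le_add <;> apply card_le_card <;> intro f hf <;> 
              simp only [mem_filter] at hf ⊢ <;> refine ⟨hf.1, ?_⟩ <;> have hf := hf.2 <;>
              split_ifs at hf <;> first | exact hf | exact absurd hf.symm hwu
      push Not at hB
      have hd3 : ∀ v ∈ W, mdeg E a b v = 3 := fun v hv => le_antisymm (hd v hv) (hB v hv)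
      by_cases hC : W.card + 1 + (k + 1) * (2 * i + 1) < E.card
      · obtain ⟨e, he⟩ := card_pos.1 (show 0 < E.card by omega)
        have h3 := card_erase_add_one he
        exact (ih (E.erase e) a b W (by omega) (fun f hf => hE f (mem_of_mem_erase hf))
          (fun v hv => (mdeg_mono a b (erase_subset e E) v).trans (hd v hv)) (by omega)).mono
          (erase_subset _ _) subset_rfl
      · have h1 : 3 * W.card = 2 * E.card := by
          have := sum_mdeg E a b W
          rw [sum_congr rfl hd3, filter_true_of_mem (fun e he => (hE e he).1),
            filter_true_of_mem (fun e he => (hE e he).2)] at this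
          simp at this
          omega
        have hW : W.Nonempty := by
          rw [← card_pos]; omega
        obtain ⟨S, hSW, hSn, hSc, hSe⟩ := short_cycle E a b W hE hd3 hW i (by omega)
        have h2 := sum_mdeg' E a b S
        rw [sum_congr rfl (fun v hv => hd3 v (hSW hv))] at h2
        simp at h2
        have h4 : (E.filter (fun e => a e ∈ S ∨ b e ∈ S)).card +
          (E.filter (fun e => ¬ (a e ∈ S ∨ b e ∈ S))).card = E.card := card_filter_add_card_filter_not _
        have h5 := card_sdiff_add_card_eq_card hSW
        refine Pack.cons (E := E.filter (fun e => ¬ (a e ∈ S ∨ b e ∈ S))) (X := S) 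
          (ihk' _ _ a b (W \ S) le_rfl ?_ ?_ ?_) (filter_subset _ _) hSW hSn hSe
        · intro e he
          simp only [mem_filter, not_or] at he
          have := hE e he.1
          simp only [mem_sdiff]; tauto
        · intro w hw
          exact (mdeg_mono a b (filter_subset _ _) w).trans (hd w (mem_sdiff.1 hw).1)
        · have : (k + 1) * (2 * i + 1) = k * (2 * i + 1) + (2 * i + 1) := by ring
          omega
end
end EPV

namespace EPV
open SimpleGraph

theorem arith (k : ℕ) : ∃ i : ℕ, 2 * (k * (2 * i + 1)) + 4 < 3 * 2 ^ i ∧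
    k + 2 * (k * (2 * i + 1)) ≤ (k + 1) * (8 * Nat.clog 2 (k + 1) + 2) := by
  by_cases hk : k < 16
  · have hlow : ∀ c : ℕ, 2 ^ c < k + 1 → c < Nat.clog 2 (k + 1) := by
      intro c hc
      by_contra h
      have h1 : k + 1 ≤ 2 ^ Nat.clog 2 (k + 1) := Nat.le_pow_clog (by norm_num) _
      have : 2 ^ Nat.clog 2 (k + 1) ≤ 2 ^ c := Nat.pow_le_pow_right (by norm_num) (by omega)
      omega
    have h0 := hlow 0
    have h1 := hlow 1
    have h2 := hlow 2
    have h3 := hlow 3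
    generalize Nat.clog 2 (k + 1) = c at *
    clear hlow
    by_cases c0 : k = 0
    · subst c0; exact ⟨1, by norm_num, by omega⟩
    by_cases c1 : k = 1
    · subst c1; exact ⟨3, by norm_num, by norm_num at *; omega⟩
    by_cases c2 : k ≤ 3
    · refine ⟨5, by norm_num; omega, ?_⟩
      interval_cases k <;> norm_num at * <;> omega
    by_cases c3 : k ≤ 7
    · refine ⟨6, by norm_num; omega, ?_⟩
      interval_cases k <;> norm_num at * <;> omega
    refine ⟨8, by norm_num; omega, ?_⟩
    have h4 : 4 ≤ c := by norm_num at *; omega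
    nlinarith
  · have h1 : k + 1 ≤ 2 ^ Nat.clog 2 (k + 1) := Nat.le_pow_clog (by norm_num) _
    have h2 : 4 < Nat.clog 2 (k + 1) := by
      by_contra h
      have : 2 ^ Nat.clog 2 (k + 1) ≤ 2 ^ 4 := Nat.pow_le_pow_right (by norm_num) (by omega)
      omega
    generalize Nat.clog 2 (k + 1) = c at h1 h2
    obtain ⟨d, rfl⟩ : ∃ d, c = d + 5 := ⟨c - 5, by omega⟩
    have h3 : 16 * (d + 5) ≤ 3 * 2 ^ (d + 5) + 4 := by
      clear h1 h2 hk
      induction d with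
      | zero => norm_num
      | succ d ih => rw [show d + 1 + 5 = (d + 5) + 1 by ring, pow_succ]; omega
    refine ⟨2 * d + 9, ?_, ?_⟩
    · have h4 : 2 * 2 ^ (2 * d + 9) = 2 ^ (d + 5) * 2 ^ (d + 5) := by
        rw [← pow_succ', ← pow_add]; congr 1; ring
      generalize 2 ^ (d + 5) = p at *
      nlinarith
    · nlinarith

section
variable {V : Type*} [Fintype V]

theorem exists_cycle_of_edges {V : Type*} [Fintype V] [Nonempty V] (H : SimpleGraph V)
    [Fintype H.edgeSet] (h : Fintype.card V ≤ H.edgeFinset.card) :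
    ∃ (v : V) (c : H.Walk v v), c.IsCycle := by
  classical
  by_contra hcon
  have hac : H.IsAcyclic := fun v c hc => hcon ⟨v, c, hc⟩
  obtain ⟨T, h1, _, hT⟩ := (connected_top (V := V)).exists_isTree_le_of_le_of_isAcyclic le_top hac
  have h2 := hT.card_edgeFinset
  have h3 : H.edgeFinset.card ≤ T.edgeFinset.card := Finset.card_le_card (by simpa using h1)
  omega

/-- first chosen end of an edge -/
noncomputable def ea (e : Sym2 V) : V := (Quot.out e).1
/-- second chosen end of an edge -/
noncomputable def eb (e : Sym2 V) : V := (Quot.out e).2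

theorem eab {V : Type*} (e : Sym2 V) : s(ea e, eb e) = e := Quot.out_eq e

open scoped Classical in
theorem mdeg_graph (H : SimpleGraph V) (v : V) : mdeg H.edgeFinset ea eb v = H.degree v := by
  have h := sum_mdeg' H.edgeFinset ea eb {v}
  simp only [Finset.sum_singleton, Finset.mem_singleton] at h
  have h0 : ein H.edgeFinset ea eb {v} = 0 := by
    rw [ein_eq, Finset.card_eq_zero, Finset.filter_eq_empty_iff]
    rintro e he ⟨h1, h2⟩
    simp only [Finset.mem_singleton] at h1 h2
    rw [← eab e, h1, h2] at he
    simp at he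
  rw [h, h0, zero_add, ← card_incidenceFinset_eq_degree]
  congr 1
  ext e
  rw [Finset.mem_filter, mem_incidenceFinset, incidenceSet, Set.mem_sep_iff, mem_edgeFinset]
  conv_rhs => rw [← eab e]
  rw [Sym2.mem_iff, eab]
  tauto

open scoped Classical in
theorem cycle_of_set (H : SimpleGraph V) (S : Finset V) (hS : S.Nonempty)
    (h : S.card ≤ ein H.edgeFinset ea eb S) :
    ∃ (v : V) (c : H.Walk v v), c.IsCycle ∧ ∀ z ∈ c.support, z ∈ S := by
  have : Nonempty (S : Set V) := hS.to_subtype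
  obtain ⟨v, c, hc⟩ := exists_cycle_of_edges (H.induce (S : Set V)) (by
    simp only [Finset.coe_sort_coe, Fintype.card_coe]
    refine h.trans ?_
    rw [ein_eq]
    refine le_trans (Finset.card_le_card ?_) (Finset.card_image_le (f := Sym2.map Subtype.val))
    intro e he
    rw [Finset.mem_filter, mem_edgeFinset] at he
    obtain ⟨h1, h2, h3⟩ := he
    rw [Finset.mem_image]
    refine ⟨s(⟨ea e, h2⟩, ⟨eb e, h3⟩), ?_, ?_⟩
    · rw [mem_edgeFinset, mem_edgeSet]
      rw [← eab e] at h1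
      exact h1
    · exact eab e)
  refine ⟨_, c.map (Embedding.induce (S : Set V)).toHom, ?_, ?_⟩
  · exact hc.map (Embedding.induce (G := H) (S : Set V)).injective
  · intro z hz
    rw [Walk.support_map, List.mem_map] at hz
    obtain ⟨y, _, rfl⟩ := hz
    exact y.2

/-- degree as a cardinality of a set -/
noncomputable def dg (H : SimpleGraph V) (v : V) : ℕ := (H.neighborSet v).ncard

/-- Subgraphs with all degrees `0`, `2`, `3`. -/
def Good (G H : SimpleGraph V) : Prop := H ≤ G ∧ ∀ v, dg H v = 0 ∨ dg H v = 2 ∨ dg H v = 3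

theorem dg_eq_zero {H : SimpleGraph V} {v w : V} (h : dg H v = 0) : ¬ H.Adj v w := by
  intro ha
  rw [dg, Set.ncard_eq_zero (Set.toFinite _)] at h
  have : w ∈ H.neighborSet v := ha
  rw [h] at this
  exact this

theorem dg_sup {H K : SimpleGraph V} (h : Disjoint H K) (v : V) : dg (H ⊔ K) v = dg H v + dg K v := by
  unfold dg
  rw [← Set.ncard_union_eq]
  · congr 1
  · rw [Set.disjoint_left]
    intro w h1 h2
    have := (disjoint_left.1 h) v w h1
    exact this h2

theorem dg_walk {K : SimpleGraph V} {u v : V} (p : K.Walk u v) (w : V) :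
    dg (p.toSubgraph.spanningCoe) w = (p.toSubgraph.neighborSet w).ncard := rfl

theorem dg_walk_out {K : SimpleGraph V} {u v : V} (p : K.Walk u v) (w : V) (h : w ∉ p.support) :
    dg (p.toSubgraph.spanningCoe) w = 0 := by
  rw [dg_walk, Set.ncard_eq_zero (Set.toFinite _), Set.eq_empty_iff_forall_notMem]
  intro z hz
  have : p.toSubgraph.Adj w z := hz
  exact h (p.mem_verts_toSubgraph.1 this.fst_mem)

variable {G H : SimpleGraph V} (hH : Maximal (Good G) H)
include hH

theorem no_outside_cycle {u : V} (c : G.Walk u u) (hc : c.IsCycle) (h : ∀ z ∈ c.support, dg H z = 0) :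
    False := by
  set K := c.toSubgraph.spanningCoe with hK
  have hd : Disjoint H K := by
    rw [disjoint_left]
    intro x y h1 h2
    have h3 : c.toSubgraph.Adj x y := h2
    exact dg_eq_zero (h x (c.mem_verts_toSubgraph.1 h3.fst_mem)) h1
  have hg : Good G (H ⊔ K) := by
    refine ⟨sup_le hH.prop.1 (Subgraph.spanningCoe_le _), fun v => ?_⟩
    rw [dg_sup hd]
    by_cases hv : v ∈ c.support
    · rw [h v hv, hK, dg_walk, hc.ncard_neighborSet_toSubgraph_eq_two hv]; simp
    · rw [hK, dg_walk_out c v hv]; exact hH.prop.2 v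
  have h1 : K ≤ H := le_sup_right.trans (hH.le_of_ge hg le_sup_left)
  have h2 : c.toSubgraph.Adj u c.snd := c.toSubgraph_adj_snd hc.not_nil
  exact dg_eq_zero (h u c.start_mem_support) (h1 h2)
omit hH

/-- edges of `G` outside `H` avoiding the vertices of degree three -/
def Qg (G H : SimpleGraph V) : SimpleGraph V where
  Adj u v := G.Adj u v ∧ ¬ H.Adj u v ∧ dg H u ≠ 3 ∧ dg H v ≠ 3
  symm := ⟨fun u v h => ⟨h.1.symm, fun h' => h.2.1 h'.symm, h.2.2.2, h.2.2.1⟩⟩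
  loopless := ⟨fun u h => G.loopless.irrefl u h.1⟩

include hH
theorem no_ear : ∀ (n : ℕ) {x y : V} (p : (Qg G H).Walk x y), p.length = n → p.IsPath →
    dg H x = 2 → dg H y = 2 → x ≠ y → False := by
  classical
  intro n
  induction n using Nat.strong_induction_on with
  | _ n ih =>
  intro x y p hn hp hx hy hxy
  have hnil : ¬ p.Nil := fun h => hxy h.eq
  by_cases hz : ∃ z ∈ p.support, z ≠ x ∧ z ≠ y ∧ dg H z = 2
  · obtain ⟨z, hz, hzx, hzy, hz2⟩ := hz
    exact ih _ (hn ▸ p.length_takeUntil_lt_length hz hzy) (p.takeUntil z hz) rfl (hp.takeUntil hz) hx hz2 hzx.symm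
  push Not at hz
  set K := p.toSubgraph.spanningCoe with hK
  have hKQ : K ≤ Qg G H := Subgraph.spanningCoe_le _
  have hd : Disjoint H K := by
    rw [disjoint_left]
    intro a b h1 h2
    exact (hKQ h2).2.1 h1
  have hg : Good G (H ⊔ K) := by
    refine ⟨sup_le hH.prop.1 (fun a b h => (hKQ h).1), fun v => ?_⟩
    rw [dg_sup hd]
    by_cases hv : v ∈ p.support
    · by_cases hvx : v = x
      · subst hvx
        rw [hx, hK, dg_walk, hp.neighborSet_toSubgraph_startpoint hnil, Set.ncard_singleton]; simp
      by_cases hvy : v = y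
      · subst hvy
        rw [hy, hK, dg_walk, hp.neighborSet_toSubgraph_endpoint hnil, Set.ncard_singleton]; simp
      have h2 := hz v hv hvx hvy
      obtain ⟨i, rfl, hi⟩ := Walk.mem_support_iff_exists_getVert.1 hv
      have hi0 : i ≠ 0 := by rintro rfl; simp at hvx
      have hil : i < p.length := by
        rcases lt_or_eq_of_le hi with h | rfl
        · exact h
        · simp at hvy
      have h3 := (p.adj_getVert_succ hil).2.2.1
      have h0 : dg H (p.getVert i) = 0 := by
        have := hH.prop.2 (p.getVert i); tauto
      rw [h0, hK, dg_walk, hp.ncard_neighborSet_toSubgraph_internal_eq_two hi0 hil]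
      simp
    · rw [hK, dg_walk_out p v hv]; exact hH.prop.2 v
  have h1 : K ≤ H := le_sup_right.trans (hH.le_of_ge hg le_sup_left)
  have h2 : p.toSubgraph.Adj x p.snd := p.toSubgraph_adj_snd hnil
  exact (hKQ h2).2.1 (h1 h2)

theorem reach_eq {x y : V} (hx : dg H x = 2) (hy : dg H y = 2) (h : (Qg G H).Reachable x y) : x = y := by
  classical
  by_contra hxy
  obtain ⟨p, hp⟩ := h.exists_isPath
  exact no_ear hH _ p rfl hp hx hy hxy

theorem dg_two {x y : V} (h : H.Adj x y) (hx : dg H x ≠ 3) : dg H x = 2 := by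
  have := hH.prop.2 x
  have h0 : dg H x ≠ 0 := fun h0 => dg_eq_zero h0 h
  tauto

theorem path_lem {u v : V} (p : G.Walk u v) : p.IsPath → (∀ z ∈ p.support, dg H z ≠ 3) → dg H v = 2 →
    ∀ s, dg H s = 2 → (Qg G H).Reachable s u → (s = u ∨ s ∉ p.support) →
    s = u ∧ ∀ e ∈ p.edges, e ∈ H.edgeSet := by
  induction p with
  | nil =>
    intro _ _ hv s hs hr _
    exact ⟨reach_eq hH hs hv hr, by simp⟩
  | @cons u w v h p ih =>
    intro hp hU hv s hs hr hsp
    rw [Walk.cons_isPath_iff] at hp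
    have hu3 : dg H u ≠ 3 := hU u (by simp)
    have hw3 : dg H w ≠ 3 := hU w (by simp)
    have hU' : ∀ z ∈ p.support, dg H z ≠ 3 := fun z hz => hU z (by simp [hz])
    by_cases hadj : H.Adj u w
    · have hu2 := dg_two hH hadj hu3
      have hw2 := dg_two hH hadj.symm hw3
      have hsu := reach_eq hH hs hu2 hr
      refine ⟨hsu, ?_⟩
      have := (ih hp.1 hU' hv w hw2 (Reachable.refl _) (Or.inl rfl)).2
      intro e he
      rw [Walk.edges_cons, List.mem_cons] at he
      rcases he with rfl | he
      · exact hadj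
      · exact this e he
    · exfalso
      have hsp' : s ∉ p.support := by
        rcases hsp with rfl | hsp
        · exact hp.2
        · intro h'; exact hsp (by simp [h'])
      have hq : (Qg G H).Adj u w := ⟨h, hadj, hu3, hw3⟩
      have := (ih hp.1 hU' hv s hs (hr.trans hq.reachable) (Or.inr hsp')).1
      exact hsp' (this ▸ p.start_mem_support)

theorem cycle_aux {x : V} (c : G.Walk x x) (hc : c.IsCycle) (hU : ∀ z ∈ c.support, dg H z ≠ 3)
    (h : H.Adj x c.snd) : ∀ e ∈ c.edges, e ∈ H.edgeSet := by
  cases c with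
  | nil => simp
  | @cons _ w _ hxw p =>
    rw [Walk.cons_isCycle_iff] at hc
    replace h : H.Adj x w := by simpa using h
    have hx := dg_two hH h (hU x (by simp))
    have hw := dg_two hH h.symm (hU w (by simp))
    have := (path_lem hH p hc.1 (fun z hz => hU z (by simp [hz])) hx w hw (Reachable.refl _) (Or.inl rfl)).2
    intro e he
    rw [Walk.edges_cons, List.mem_cons] at he
    rcases he with rfl | he
    · exact h
    · exact this e he

theorem cycle_dich {x : V} (c : G.Walk x x) (hc : c.IsCycle) (hU : ∀ z ∈ c.support, dg H z ≠ 3) :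
    (∀ e ∈ c.edges, e ∈ H.edgeSet) ∨ (∀ e ∈ c.edges, e ∈ (Qg G H).edgeSet) := by
  classical
  by_cases hex : ∃ y z, s(y, z) ∈ c.edges ∧ H.Adj y z
  · left
    obtain ⟨y, z, hyz, hadj⟩ := hex
    have hy : y ∈ c.support := c.fst_mem_support_of_mem_edges hyz
    have hr : (c.rotate y hy).IsCycle := hc.rotate hy
    have hz : z ∈ (c.rotate y hy).toSubgraph.neighborSet y := by
      rw [Walk.toSubgraph_rotate]
      exact (Walk.adj_toSubgraph_iff_mem_edges).2 hyz
    have hsup : ∀ z ∈ (c.rotate y hy).support, dg H z ≠ 3 := by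
      intro z hz
      rw [← Walk.mem_verts_toSubgraph, Walk.toSubgraph_rotate, Walk.mem_verts_toSubgraph] at hz
      exact hU z hz
    have hedge : ∀ e ∈ c.edges, e ∈ (c.rotate y hy).edges := by
      intro e he
      rw [← Walk.mem_edges_toSubgraph, Walk.toSubgraph_rotate, Walk.mem_edges_toSubgraph]
      exact he
    rw [hr.neighborSet_toSubgraph_endpoint] at hz
    intro e he
    rcases hz with hz | hz
    · exact cycle_aux hH _ hr hsup (hz ▸ hadj) e (hedge e he)
    · refine cycle_aux hH (c.rotate y hy).reverse hr.reverse (by simpa using hsup) ?_ e (by simpa using hedge e he)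
      rw [Walk.snd_reverse]
      exact hz ▸ hadj
  · right
    push Not at hex
    intro e he
    induction e with
    | _ y z =>
    exact ⟨c.adj_of_mem_edges he, hex y z he, hU y (c.fst_mem_support_of_mem_edges he),
      hU z (c.snd_mem_support_of_mem_edges he)⟩
omit hH

theorem reach_of_walk {G K : SimpleGraph V} {x : V} (c : G.Walk x x) (h : ∀ e ∈ c.edges, e ∈ K.edgeSet)
    {y z : V} (hy : y ∈ c.support) (hz : z ∈ c.support) : K.Reachable y z := by
  classical
  have : ∀ y ∈ c.support, K.Reachable x y := by
    intro y hy
    exact ⟨(c.transfer K h).takeUntil y (by simpa using hy)⟩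
  exact (this y hy).symm.trans (this z hz)

include hH
theorem two_of_H {x : V} (c : G.Walk x x) (hc : c.IsCycle) (hU : ∀ z ∈ c.support, dg H z ≠ 3)
    (h : ∀ e ∈ c.edges, e ∈ H.edgeSet) {y : V} (hy : y ∈ c.support) :
    dg H y = 2 ∧ c.toSubgraph.neighborSet y = H.neighborSet y := by
  have h2 := hc.ncard_neighborSet_toSubgraph_eq_two hy
  have hsub : c.toSubgraph.neighborSet y ⊆ H.neighborSet y := by
    intro z hz
    have : s(y, z) ∈ c.edges := (Walk.adj_toSubgraph_iff_mem_edges).1 hz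
    exact h _ this
  have hd : dg H y = 2 := by
    obtain ⟨z, hz⟩ := Set.nonempty_of_ncard_ne_zero (s := c.toSubgraph.neighborSet y) (by omega)
    exact dg_two hH (hsub hz) (hU y hy)
  exact ⟨hd, Set.eq_of_subset_of_ncard_le hsub (by rw [h2]; exact hd.le) (Set.toFinite _)⟩

theorem closed_of_H {x : V} (c : G.Walk x x) (hc : c.IsCycle) (hU : ∀ z ∈ c.support, dg H z ≠ 3)
    (h : ∀ e ∈ c.edges, e ∈ H.edgeSet) {y z : V} (hy : y ∈ c.support) (hr : H.Reachable y z) :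
    z ∈ c.support := by
  obtain ⟨p⟩ := hr
  induction p with
  | nil => exact hy
  | cons hadj p ih =>
    apply ih
    have h1 := (two_of_H hH c hc hU h hy).2
    have h2 : _ ∈ H.neighborSet _ := hadj
    rw [← h1] at h2
    have h3 : c.toSubgraph.Adj _ _ := h2
    exact c.mem_verts_toSubgraph.1 h3.snd_mem

theorem cycles_disjoint {x y u v : V} (c : G.Walk u u) (hc : c.IsCycle)
    (hU : ∀ z ∈ c.support, dg H z ≠ 3) (d : G.Walk v v) (hd : d.IsCycle)
    (hU' : ∀ z ∈ d.support, dg H z ≠ 3) (hx : dg H x = 2) (hy : dg H y = 2)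
    (hxc : x ∈ c.support) (hyd : y ∈ d.support) (hyc : y ∉ c.support) (hxd : x ∉ d.support) :
    ∀ z ∈ c.support, z ∉ d.support := by
  intro z hz hz'
  rcases cycle_dich hH c hc hU with h1 | h1 <;> rcases cycle_dich hH d hd hU' with h2 | h2
  · exact hyc (closed_of_H hH c hc hU h1 hz (reach_of_walk d h2 hz' hyd))
  · have h3 := (two_of_H hH c hc hU h1 hz).1
    have := reach_eq hH h3 hy (reach_of_walk d h2 hz' hyd)
    exact hyc (this ▸ hz)
  · have h3 := (two_of_H hH d hd hU' h2 hz').1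
    have := reach_eq hH h3 hx (reach_of_walk c h1 hz hxc)
    exact hxd (this ▸ hz')
  · have := reach_eq hH hx hy ((reach_of_walk c h1 hxc hz).trans (reach_of_walk d h2 hz' hyd))
    exact hyc (this ▸ hxc)

open scoped Classical in
theorem hitting : ∃ X : Finset V, (∀ (v : V) (c : G.Walk v v), c.IsCycle →
      (∀ z ∈ c.support, dg H z ≠ 3) → ∃ z ∈ X, z ∈ c.support) ∧
    ∃ cs : X → Σ v : V, G.Walk v v, (∀ i, (cs i).2.IsCycle) ∧
      (∀ i j, i ≠ j → ∀ u ∈ (cs i).2.support, u ∉ (cs j).2.support) := by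
  let P : Finset V → Prop := fun X => (∀ x ∈ X, dg H x = 2) ∧ ∀ (v : V) (c : G.Walk v v), c.IsCycle →
      (∀ z ∈ c.support, dg H z ≠ 3) → ∃ z ∈ X, z ∈ c.support
  have hP0 : P (Finset.univ.filter (fun x => dg H x = 2)) := by
    refine ⟨by simp, fun v c hc hU => ?_⟩
    by_contra hcon
    refine no_outside_cycle hH c hc (fun z hz => ?_)
    have h1 := hU z hz
    have h2 : dg H z ≠ 2 := fun h => hcon ⟨z, by simpa using h, hz⟩
    have := hH.prop.2 z
    tauto
  obtain ⟨X, hX⟩ := exists_minimal_of_wellFoundedLT P ⟨_, hP0⟩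
  refine ⟨X, hX.prop.2, ?_⟩
  have key : ∀ x : X, ∃ c : Σ v : V, G.Walk v v, c.2.IsCycle ∧ (∀ z ∈ c.2.support, dg H z ≠ 3) ∧
      x.1 ∈ c.2.support ∧ ∀ z ∈ X, z ∈ c.2.support → z = x.1 := by
    rintro ⟨x, hx⟩
    have hn : ¬ P (X.erase x) := by
      intro h
      have := hX.le_of_le h (Finset.erase_subset _ _) hx
      simp at this
    by_contra hcon
    apply hn
    refine ⟨fun y hy => hX.prop.1 y (Finset.mem_of_mem_erase hy), fun v c hc hU => ?_⟩
    by_contra hno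
    have honly : ∀ z ∈ X, z ∈ c.support → z = x := by
      intro z hz hzc
      by_contra hzx
      exact hno ⟨z, Finset.mem_erase.2 ⟨hzx, hz⟩, hzc⟩
    obtain ⟨z, hz, hzc⟩ := hX.prop.2 v c hc hU
    have := honly z hz hzc
    subst this
    exact hcon ⟨⟨v, c⟩, hc, hU, hzc, honly⟩
  choose cs h1 h2 h3 h4 using key
  refine ⟨cs, h1, fun i j hij => ?_⟩
  refine cycles_disjoint hH (cs i).2 (h1 i) (h2 i) (cs j).2 (h1 j) (h2 j) (hX.prop.1 i.1 i.2)
    (hX.prop.1 j.1 j.2) (h3 i) (h3 j) ?_ ?_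
  · intro h; exact hij (Subtype.ext (h4 i j.1 j.2 h).symm)
  · intro h; exact hij (Subtype.ext (h4 j i.1 i.2 h))
omit hH

end
end EPV

/-- **Erdős–Pósa theorem (vertex version).** Every finite graph either contains `k`
pairwise vertex-disjoint cycles, or a set `F` of at most `k(8⌈log₂ k⌉ + 2)` vertices
such that the induced subgraph `G - F` has no cycle. -/
theorem erdos_posa_vertex {V : Type*} [Fintype V] (G : SimpleGraph V) (k : ℕ) :
    (∃ cs : Fin k → Σ v : V, G.Walk v v,
      (∀ i, (cs i).2.IsCycle) ∧
      (∀ i j, i ≠ j → ∀ u ∈ (cs i).2.support, u ∉ (cs j).2.support)) ∨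
    (∃ F : Finset V, F.card ≤ k * (8 * Nat.clog 2 k + 2) ∧
      ∀ (v : ((↑F : Set V)ᶜ : Set V)) (w : (G.induce ((↑F : Set V)ᶜ)).Walk v v),
        ¬ w.IsCycle) := by
  classical
  cases k with
  | zero => exact Or.inl ⟨fun i => i.elim0, fun i => i.elim0, fun i => i.elim0⟩
  | succ k =>
  obtain ⟨i, hi1, hi2⟩ := EPV.arith k
  have hbot : EPV.Good G ⊥ := ⟨bot_le, fun v => Or.inl (by simp [EPV.dg])⟩
  obtain ⟨H, hH⟩ : ∃ H, Maximal (EPV.Good G) H := by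
    obtain ⟨H, _, hH⟩ := (Set.toFinite {H | EPV.Good G H}).exists_le_maximal hbot
    exact ⟨H, hH⟩
  have hdg : ∀ v, EPV.mdeg H.edgeFinset EPV.ea EPV.eb v = EPV.dg H v := by
    intro v
    rw [EPV.mdeg_graph, EPV.dg, Set.ncard_eq_toFinset_card', ← SimpleGraph.card_neighborFinset_eq_degree]
    rfl
  set W : Finset V := Finset.univ.filter (fun v => EPV.dg H v ≠ 0) with hW
  set U : Finset V := Finset.univ.filter (fun v => EPV.dg H v = 3) with hU
  have hE : ∀ e ∈ H.edgeFinset, EPV.ea e ∈ W ∧ EPV.eb e ∈ W := by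
    intro e he
    rw [← EPV.eab e, SimpleGraph.mem_edgeFinset, SimpleGraph.mem_edgeSet] at he
    simp only [hW, Finset.mem_filter, Finset.mem_univ, true_and]
    exact ⟨fun h => EPV.dg_eq_zero h he, fun h => EPV.dg_eq_zero h he.symm⟩
  by_cases hbig : W.card + 1 + k * (2 * i + 1) ≤ H.edgeFinset.card
  · left
    obtain ⟨S, hS, hdis⟩ := EPV.pack_main i k hi1 _ H.edgeFinset EPV.ea EPV.eb W le_rfl hE (by
      intro v _
      rw [hdg]
      rcases hH.prop.2 v with h | h | h <;> omega) hbig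
    have key : ∀ t, ∃ c : Σ v : V, G.Walk v v, c.2.IsCycle ∧ ∀ z ∈ c.2.support, z ∈ S t := by
      intro t
      obtain ⟨v, c, hc, hz⟩ := EPV.cycle_of_set H (S t) (hS t).2.1 (hS t).2.2
      exact ⟨⟨v, c.mapLe hH.prop.1⟩, hc.mapLe hH.prop.1, by simpa using hz⟩
    choose cs h1 h2 using key
    refine ⟨cs, h1, fun s t hst u hu hu' => ?_⟩
    exact Finset.disjoint_left.1 (hdis s t hst) (h2 s u hu) (h2 t u hu')
  · obtain ⟨X, hX, cs, h1, h2⟩ := EPV.hitting hH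
    by_cases hXc : k + 1 ≤ X.card
    · left
      obtain ⟨f⟩ : Nonempty (Fin (k + 1) ↪ X) := by
        apply Function.Embedding.nonempty_of_card_le
        simpa using hXc
      exact ⟨fun t => cs (f t), fun t => h1 _, fun s t hst => h2 _ _ (fun h => hst (f.injective h))⟩
    · right
      refine ⟨U ∪ X, ?_, ?_⟩
      · have hsum := EPV.sum_mdeg H.edgeFinset EPV.ea EPV.eb W
        rw [Finset.filter_true_of_mem (fun e he => (hE e he).1),
          Finset.filter_true_of_mem (fun e he => (hE e he).2)] at hsum
        have h3 : ∑ v ∈ W, EPV.mdeg H.edgeFinset EPV.ea EPV.eb v = 2 * W.card + U.card := by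
          have h4 : ∀ v ∈ W, EPV.mdeg H.edgeFinset EPV.ea EPV.eb v = 2 + if EPV.dg H v = 3 then 1 else 0 := by
            intro v hv
            rw [hdg]
            simp only [hW, Finset.mem_filter, Finset.mem_univ, true_and] at hv
            rcases hH.prop.2 v with h | h | h
            · exact absurd h hv
            · simp [h]
            · simp [h]
          rw [Finset.sum_congr rfl h4, Finset.sum_add_distrib, ← Finset.card_filter]
          have h5 : W.filter (fun v => EPV.dg H v = 3) = U := by
            ext v
            simp only [hW, hU, Finset.mem_filter, Finset.mem_univ, true_and]
            omega
          rw [h5]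
          simp [mul_comm]
        have := Finset.card_union_le U X
        omega
      · intro v w hw
        have hc : (w.map (SimpleGraph.Embedding.induce (G := G) ((↑(U ∪ X) : Set V)ᶜ)).toHom).IsCycle :=
          hw.map (SimpleGraph.Embedding.induce (G := G) _).injective
        have hs : ∀ z ∈ (w.map (SimpleGraph.Embedding.induce (G := G) ((↑(U ∪ X) : Set V)ᶜ)).toHom).support,
            z ∉ U ∪ X := by
          intro z hz
          rw [SimpleGraph.Walk.support_map, List.mem_map] at hz
          obtain ⟨y, _, rfl⟩ := hz
          have := y.2
          simpa using this
        obtain ⟨z, hz, hz'⟩ := hX _ _ hc (by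
          intro z hz h
          exact hs z hz (Finset.mem_union_left _ (by simpa [hU] using h)))
        exact hs z hz' (Finset.mem_union_right _ hz)
end
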